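/- Invariance of rational solutions: let u : [0,T) × ℝ → S² be a sufficiently regular solution of the half-wave maps equation ∂_t u = u × |∇|u in one space dimension. If each component of the initial datum x ↦ u(0,x) is a rational function of x, then for every t ∈ [0,T) each component of x ↦ u(t,x) is a rational function of x. -/

import Mathlib

/-!
Invariance of rational solutions under the half-wave maps flow: if the initial
datum of a sufficiently regular solution of `∂ₜu = u × |∇|u` is rational in `x`
(componentwise), then the solution stays rational in `x` for all times.
-/

open MeasureTheory Filter
open scoped Topology

noncomputable section

/-- Vectors in ℝ³. -/
abbrev V3 : Type := Fin 3 → ℝ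

/-- Cross product on ℝ³. -/
def cross3 (a b : V3) : V3 := crossProduct a b

/-- `HasHalfLap u g` means that `g = |∇|u` pointwise, where `|∇|` (the Fourier
multiplier with symbol `|ξ|`) is realized as the principal-value singular integral
`|∇|u(x) = (1/π) p.v. ∫ (u(x)-u(y))/(x-y)² dy`. -/
def HasHalfLap {E : Type*} [NormedAddCommGroup E] [NormedSpace ℝ E]
    (u g : ℝ → E) : Prop :=
  ∀ x : ℝ, Filter.Tendsto
    (fun ε : ℝ =>
      (Real.pi)⁻¹ • ∫ y in {y : ℝ | ε ≤ |x - y|}, ((x - y) ^ 2)⁻¹ • (u x - u y))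
    (nhdsWithin 0 (Set.Ioi 0)) (nhds (g x))

/-- A function `f : ℝ → ℝ` is rational if `f = p/q` for real polynomials `p, q`
with `q` nowhere vanishing on ℝ. -/
def IsRationalFn (f : ℝ → ℝ) : Prop :=
  ∃ p q : Polynomial ℝ, (∀ x : ℝ, q.eval x ≠ 0) ∧ ∀ x : ℝ, f x = p.eval x / q.eval x

/-- **Invariance of rational solutions.**  If a sufficiently regular solution
`u : [0,T) × ℝ → 𝕊²` of the half-wave maps equation `∂ₜu = u × |∇|u` has an
initial datum `u(0,·)` whose components are rational functions of `x`, then for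
every `t ∈ [0,T)` the components of `u(t,·)` are rational functions of `x`. -/

theorem hasDerivAt_arctan_div (ε y x : ℝ) (hε : 0 < ε) :
    HasDerivAt (fun x => Real.arctan ((x - y) / ε)) (ε / ((x - y) ^ 2 + ε ^ 2)) x := by
  have h : HasDerivAt (fun x : ℝ => (x - y) / ε) (1 / ε) x :=
    ((hasDerivAt_id x).sub_const y).div_const ε
  convert h.arctan using 1
  have : (x - y) ^ 2 + ε ^ 2 ≠ 0 := by positivity
  field_simp
  ring

theorem tendsto_arctan_div_atTop (ε y : ℝ) (hε : 0 < ε) :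
    Tendsto (fun x => Real.arctan ((x - y) / ε)) atTop (𝓝 (Real.pi / 2)) := by
  refine (tendsto_nhds_of_tendsto_nhdsWithin Real.tendsto_arctan_atTop).comp ?_
  exact (tendsto_atTop_add_const_right _ (-y) tendsto_id).atTop_div_const hε

theorem tendsto_arctan_div_atBot (ε y : ℝ) (hε : 0 < ε) :
    Tendsto (fun x => Real.arctan ((x - y) / ε)) atBot (𝓝 (-(Real.pi / 2))) := by
  refine (tendsto_nhds_of_tendsto_nhdsWithin Real.tendsto_arctan_atBot).comp ?_
  exact (tendsto_atBot_add_const_right _ (-y) tendsto_id).atBot_div_const hε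

theorem integrable_inv_sq_add_sq (ε y : ℝ) (hε : 0 < ε) :
    Integrable (fun x : ℝ => ((x - y) ^ 2 + ε ^ 2)⁻¹) := by
  have h := ((integrable_inv_one_add_sq.comp_div hε.ne').comp_sub_right y).const_mul (ε ^ 2)⁻¹
  refine h.congr (Eventually.of_forall fun x => ?_)
  have : (x - y) ^ 2 + ε ^ 2 ≠ 0 := by positivity
  have : 1 + ((x - y) / ε) ^ 2 ≠ 0 := by positivity
  simp only
  field_simp
  ring

theorem tendsto_log_ratio (ε y z : ℝ) (hε : 0 < ε) (l : Filter ℝ)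
    (hl : Tendsto (fun x : ℝ => x⁻¹) l (𝓝 0)) (hl0 : ∀ᶠ x in l, x ≠ 0) :
    Tendsto (fun x => Real.log (((x - y) ^ 2 + ε ^ 2) / ((x - z) ^ 2 + ε ^ 2))) l (𝓝 0) := by
  have key : ∀ w : ℝ, Tendsto (fun x : ℝ => (1 - w * x⁻¹) ^ 2 + (ε * x⁻¹) ^ 2) l (𝓝 1) := by
    intro w
    have := ((tendsto_const_nhds (x := (1 : ℝ))).sub (hl.const_mul w)).pow 2 |>.add
      ((hl.const_mul ε).pow 2)
    simpa using this
  have h := (key y).div (key z) one_ne_zero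
  have h2 := (Real.continuousAt_log (by norm_num : (1 : ℝ) / 1 ≠ 0)).tendsto.comp h
  simp only [div_one, Real.log_one] at h2
  refine h2.congr' ?_
  filter_upwards [hl0] with x hx
  simp only [Function.comp, Pi.div_apply]
  congr 1
  have : (x - z) ^ 2 + ε ^ 2 ≠ 0 := by positivity
  have h3 : (1 - z * x⁻¹) ^ 2 + (ε * x⁻¹) ^ 2 = ((x - z) ^ 2 + ε ^ 2) / x ^ 2 := by field_simp
  have h4 : (1 - y * x⁻¹) ^ 2 + (ε * x⁻¹) ^ 2 = ((x - y) ^ 2 + ε ^ 2) / x ^ 2 := by field_simp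
  rw [h3, h4]
  field_simp

/-- Real part of the product of two Cauchy kernels. -/
def cauchyProd (ε a b : ℝ) : ℝ := (a * b + ε ^ 2) / ((a ^ 2 + ε ^ 2) * (b ^ 2 + ε ^ 2))

theorem abs_cauchyProd_le (ε a b : ℝ) (hε : 0 < ε) :
    |cauchyProd ε a b| ≤ (a ^ 2 + ε ^ 2)⁻¹ + (b ^ 2 + ε ^ 2)⁻¹ := by
  have ha : 0 < a ^ 2 + ε ^ 2 := by positivity
  have hb : 0 < b ^ 2 + ε ^ 2 := by positivity
  rw [cauchyProd, abs_div, abs_of_pos (mul_pos ha hb), div_le_iff₀ (mul_pos ha hb)]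
  have : ((a ^ 2 + ε ^ 2)⁻¹ + (b ^ 2 + ε ^ 2)⁻¹) * ((a ^ 2 + ε ^ 2) * (b ^ 2 + ε ^ 2))
      = (a ^ 2 + ε ^ 2) + (b ^ 2 + ε ^ 2) := by field_simp; ring
  rw [this, abs_le]
  constructor <;> nlinarith [sq_nonneg (a + b), sq_nonneg (a - b), sq_nonneg ε]

theorem integrable_cauchyProd (ε y z : ℝ) (hε : 0 < ε) :
    Integrable (fun x : ℝ => cauchyProd ε (x - y) (x - z)) := by
  refine ((integrable_inv_sq_add_sq ε y hε).add (integrable_inv_sq_add_sq ε z hε)).mono' ?_ ?_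
  · refine Continuous.aestronglyMeasurable ?_
    unfold cauchyProd
    refine Continuous.div (by fun_prop) (by fun_prop) fun x => by positivity
  · exact Eventually.of_forall fun x => abs_cauchyProd_le ε _ _ hε

theorem integral_cauchyProd (ε y z : ℝ) (hε : 0 < ε) :
    ∫ x : ℝ, cauchyProd ε (x - y) (x - z) =
      4 * Real.pi * ε / ((y - z) ^ 2 + 4 * ε ^ 2) := by
  set D : ℝ := (y - z) ^ 2 + 4 * ε ^ 2 with hD
  have hDpos : 0 < D := by positivity
  have hder : ∀ x : ℝ, HasDerivAt (fun x => ((y - z) / 2 *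
      Real.log (((x - y) ^ 2 + ε ^ 2) / ((x - z) ^ 2 + ε ^ 2)) +
      2 * ε * (Real.arctan ((x - y) / ε) + Real.arctan ((x - z) / ε))) / D)
      (cauchyProd ε (x - y) (x - z)) x := by
    intro x
    have hy : 0 < (x - y) ^ 2 + ε ^ 2 := by positivity
    have hz : 0 < (x - z) ^ 2 + ε ^ 2 := by positivity
    have d1 : ∀ w : ℝ, HasDerivAt (fun x : ℝ => (x - w) ^ 2 + ε ^ 2) (2 * (x - w)) x := by
      intro w
      simpa using (((hasDerivAt_id x).sub_const w).pow 2).add_const (ε ^ 2)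
    have d2 := ((d1 y).div (d1 z) hz.ne').log (div_pos hy hz).ne'
    have d3 := (hasDerivAt_arctan_div ε y x hε).add (hasDerivAt_arctan_div ε z x hε)
    refine (((d2.const_mul ((y - z) / 2)).add (d3.const_mul (2 * ε))).div_const D).congr_deriv ?_
    simp only [cauchyProd, Pi.div_apply]
    field_simp
    rw [hD]
    ring
  have htop := ((tendsto_log_ratio ε y z hε atTop tendsto_inv_atTop_zero
    (eventually_ne_atTop 0)).const_mul ((y - z) / 2)).add
    (((tendsto_arctan_div_atTop ε y hε).add (tendsto_arctan_div_atTop ε z hε)).const_mul (2 * ε))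
    |>.div_const D
  have hbot := ((tendsto_log_ratio ε y z hε atBot tendsto_inv_atBot_zero
    (eventually_ne_atBot 0)).const_mul ((y - z) / 2)).add
    (((tendsto_arctan_div_atBot ε y hε).add (tendsto_arctan_div_atBot ε z hε)).const_mul (2 * ε))
    |>.div_const D
  rw [integral_of_hasDerivAt_of_tendsto hder (integrable_cauchyProd ε y z hε) hbot htop]
  field_simp
  ring

theorem integral_inv_sub_sq_add_sq (ε y : ℝ) (hε : 0 < ε) :
    ∫ x : ℝ, ((x - y) ^ 2 + ε ^ 2)⁻¹ = Real.pi / ε := by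
  have h := integral_cauchyProd ε y y hε
  have h1 : ∀ x : ℝ, cauchyProd ε (x - y) (x - y) = ((x - y) ^ 2 + ε ^ 2)⁻¹ := by
    intro x
    have : (x - y) ^ 2 + ε ^ 2 ≠ 0 := by positivity
    unfold cauchyProd
    field_simp
  simp only [h1] at h
  rw [h]
  field_simp
  ring

/-- Lebesgue measure on the interval `[-R, R]`. -/
def muR (R : ℝ) : Measure ℝ := volume.restrict (Set.Icc (-R) R)

instance isFiniteMeasure_muR (R : ℝ) : IsFiniteMeasure (muR R) := by
  unfold muR; infer_instance

theorem muR_le (R : ℝ) : muR R ≤ volume := Measure.restrict_le_self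

theorem integrable_muR {E : Type*} [NormedAddCommGroup E] {f : ℝ → E} (hf : Continuous f) (R : ℝ) :
    Integrable f (muR R) := hf.continuousOn.integrableOn_compact isCompact_Icc

theorem muR_prod (R : ℝ) : (muR R).prod (muR R) =
    (volume.prod volume).restrict (Set.Icc (-R) R ×ˢ Set.Icc (-R) R) :=
  Measure.prod_restrict _ _

theorem integrable_muR_prod {E : Type*} [NormedAddCommGroup E] {f : ℝ × ℝ → E}
    (hf : Continuous f) (R : ℝ) : Integrable f ((muR R).prod (muR R)) := by
  rw [muR_prod]
  exact hf.continuousOn.integrableOn_compact (isCompact_Icc.prod isCompact_Icc)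

theorem ae_muR (R : ℝ) : ∀ᵐ x ∂(muR R), x ∈ Set.Icc (-R) R := by
  unfold muR
  exact ae_restrict_mem measurableSet_Icc

theorem ae_muR_prod (R : ℝ) : ∀ᵐ z ∂((muR R).prod (muR R)),
    z.1 ∈ Set.Icc (-R) R ∧ z.2 ∈ Set.Icc (-R) R := by
  rw [muR_prod]
  filter_upwards [ae_restrict_mem (measurableSet_Icc.prod measurableSet_Icc)] with z hz
  exact hz

theorem inv_sub_sq_add_sq_le {ε R x y : ℝ} (hε : 0 < ε) (hy : y ∈ Set.Icc (-R) R) :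
    ((x - y) ^ 2 + ε ^ 2)⁻¹ ≤ (2 + (1 + 2 * R ^ 2) / ε ^ 2) * (1 + x ^ 2)⁻¹ := by
  have h1 : 0 < (x - y) ^ 2 + ε ^ 2 := by positivity
  have h2 : 0 < 1 + x ^ 2 := by positivity
  rw [inv_eq_one_div, div_le_iff₀ h1, mul_assoc, inv_mul_eq_div, mul_div_assoc',
    le_div_iff₀ h2]
  have h3 : y ^ 2 ≤ R ^ 2 := by
    obtain ⟨a, b⟩ := hy
    nlinarith
  have h4 : (2 + (1 + 2 * R ^ 2) / ε ^ 2) * ((x - y) ^ 2 + ε ^ 2) =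
    2 * (x - y) ^ 2 + 2 * ε ^ 2 + (1 + 2 * R ^ 2) * (x - y) ^ 2 / ε ^ 2 + (1 + 2 * R ^ 2) := by
    field_simp
    ring
  rw [h4]
  have h5 : 0 ≤ (1 + 2 * R ^ 2) * (x - y) ^ 2 / ε ^ 2 := by positivity
  nlinarith [sq_nonneg (x - 2 * y), sq_nonneg ε]

theorem exists_bound_muR {g : ℝ → ℝ} (hg : Continuous g) (R : ℝ) :
    ∃ C, 0 ≤ C ∧ ∀ x ∈ Set.Icc (-R) R, |g x| ≤ C := by
  obtain ⟨C, hC⟩ := (isCompact_Icc (a := -R) (b := R)).exists_bound_of_continuousOn hg.continuousOn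
  exact ⟨max C 0, le_max_right _ _, fun x hx => (hC x hx).trans (le_max_left _ _)⟩

theorem continuous_cauchyProd {X : Type*} [TopologicalSpace X] {ε : ℝ} (hε : 0 < ε) {a b : X → ℝ}
    (ha : Continuous a) (hb : Continuous b) : Continuous fun x => cauchyProd ε (a x) (b x) := by
  unfold cauchyProd
  exact Continuous.div (by fun_prop) (by fun_prop) fun x => by positivity

theorem integrable_triple {ε R : ℝ} (hε : 0 < ε) {g : ℝ → ℝ} (hg : Continuous g) :
    Integrable (fun p : ℝ × (ℝ × ℝ) => g p.2.1 * g p.2.2 * cauchyProd ε (p.1 - p.2.1) (p.1 - p.2.2))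
      (volume.prod ((muR R).prod (muR R))) := by
  obtain ⟨C, hC0, hC⟩ := exists_bound_muR hg R
  set D := 2 + (1 + 2 * R ^ 2) / ε ^ 2
  have hD : 0 ≤ D := by positivity
  have hdom : Integrable (fun p : ℝ × (ℝ × ℝ) => (1 + p.1 ^ 2)⁻¹ * (C * C * (2 * D)))
      (volume.prod ((muR R).prod (muR R))) :=
    integrable_inv_one_add_sq.mul_prod (integrable_const _)
  refine hdom.mono' ?_ ?_
  · refine Continuous.aestronglyMeasurable ?_
    exact Continuous.mul (by fun_prop) (continuous_cauchyProd hε (by fun_prop) (by fun_prop))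
  · have hae : ∀ᵐ p : ℝ × (ℝ × ℝ) ∂(volume.prod ((muR R).prod (muR R))),
        p.2.1 ∈ Set.Icc (-R) R ∧ p.2.2 ∈ Set.Icc (-R) R :=
      Measure.quasiMeasurePreserving_snd.ae (ae_muR_prod R)
    filter_upwards [hae] with p hp
    rw [Real.norm_eq_abs, abs_mul, abs_mul]
    have h1 := hC _ hp.1
    have h2 := hC _ hp.2
    have h3 := abs_cauchyProd_le ε (p.1 - p.2.1) (p.1 - p.2.2) hε
    have h4 := inv_sub_sq_add_sq_le (x := p.1) hε hp.1
    have h5 := inv_sub_sq_add_sq_le (x := p.1) hε hp.2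
    calc _ ≤ (C * C) * (2 * D * (1 + p.1 ^ 2)⁻¹) := by
          refine mul_le_mul (mul_le_mul h1 h2 (abs_nonneg _) hC0) (by linarith) (abs_nonneg _)
            (by positivity)
      _ = _ := by ring

theorem sq_add_sq_eq_integral {ε R : ℝ} (hε : 0 < ε) {g : ℝ → ℝ} (hg : Continuous g) (x : ℝ) :
    (∫ y, g y * ((x - y) / ((x - y) ^ 2 + ε ^ 2)) ∂(muR R)) ^ 2 +
    (∫ y, g y * (ε / ((x - y) ^ 2 + ε ^ 2)) ∂(muR R)) ^ 2 =
    ∫ p : ℝ × ℝ, g p.1 * g p.2 * cauchyProd ε (x - p.1) (x - p.2) ∂((muR R).prod (muR R)) := by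
  have hpos : ∀ y : ℝ, (x - y) ^ 2 + ε ^ 2 ≠ 0 := fun y => by positivity
  rw [sq (∫ y, g y * ((x - y) / ((x - y) ^ 2 + ε ^ 2)) ∂(muR R)),
    sq (∫ y, g y * (ε / ((x - y) ^ 2 + ε ^ 2)) ∂(muR R)), ← integral_prod_mul,
    ← integral_prod_mul, ← integral_add]
  · congr 1
    ext p
    have h1 := hpos p.1
    have h2 := hpos p.2
    simp only [cauchyProd]
    field_simp
  · refine integrable_muR_prod ?_ R
    refine Continuous.mul ?_ ?_ <;> refine Continuous.mul (by fun_prop) ?_ <;>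
      exact Continuous.div (by fun_prop) (by fun_prop) fun p => hpos _
  · refine integrable_muR_prod ?_ R
    refine Continuous.mul ?_ ?_ <;> refine Continuous.mul (by fun_prop) ?_ <;>
      exact Continuous.div (by fun_prop) (by fun_prop) fun p => hpos _

theorem integral_sq_mul_kernel_le {ε R : ℝ} (hε : 0 < ε) {g : ℝ → ℝ} (hg : Continuous g) :
    ∫ p : ℝ × ℝ, g p.1 ^ 2 * (4 * Real.pi * ε / ((p.1 - p.2) ^ 2 + 4 * ε ^ 2))
      ∂((muR R).prod (muR R)) ≤ 2 * Real.pi ^ 2 * ∫ y, g y ^ 2 ∂(muR R) := by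
  have hpos : ∀ p : ℝ × ℝ, (p.1 - p.2) ^ 2 + 4 * ε ^ 2 ≠ 0 := fun y => by positivity
  have hInt : Integrable (fun p : ℝ × ℝ => g p.1 ^ 2 *
      (4 * Real.pi * ε / ((p.1 - p.2) ^ 2 + 4 * ε ^ 2))) ((muR R).prod (muR R)) :=
    integrable_muR_prod (Continuous.mul (by fun_prop)
      (Continuous.div (by fun_prop) (by fun_prop) hpos)) R
  rw [integral_prod _ hInt, ← integral_const_mul]
  refine integral_mono hInt.integral_prod_left ((integrable_muR (by fun_prop) R).const_mul _) ?_
  intro y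
  simp only
  rw [integral_const_mul, mul_comm]
  refine mul_le_mul_of_nonneg_right ?_ (sq_nonneg _)
  have h2 : (0 : ℝ) < 2 * ε := by positivity
  have hi := (integrable_inv_sq_add_sq (2 * ε) y h2).const_mul (4 * Real.pi * ε)
  have he : ∀ z : ℝ, 4 * Real.pi * ε / ((y - z) ^ 2 + 4 * ε ^ 2) =
      4 * Real.pi * ε * ((z - y) ^ 2 + (2 * ε) ^ 2)⁻¹ := fun z => by
    rw [div_eq_mul_inv]; congr 2; ring
  simp only [he]
  calc _ ≤ ∫ z : ℝ, 4 * Real.pi * ε * ((z - y) ^ 2 + (2 * ε) ^ 2)⁻¹ := by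
        refine integral_mono_measure (muR_le R) (Eventually.of_forall fun z => ?_) hi
        have := Real.pi_pos
        simp only [Pi.zero_apply]
        positivity
    _ = _ := by
        rw [integral_const_mul, integral_inv_sub_sq_add_sq _ _ h2]
        field_simp
        ring

theorem integral_sq_hilbert_le {ε R : ℝ} (hε : 0 < ε) {g : ℝ → ℝ} (hg : Continuous g) :
    ∫ x, (∫ y, g y * ((x - y) / ((x - y) ^ 2 + ε ^ 2)) ∂(muR R)) ^ 2 ∂(muR R) ≤
      2 * Real.pi ^ 2 * ∫ y, g y ^ 2 ∂(muR R) := by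
  have h3 := integrable_triple (R := R) hε hg
  have hInt := h3.integral_prod_left
  simp only [← sq_add_sq_eq_integral hε hg] at hInt
  have hpos : ∀ p : ℝ × ℝ, (p.1 - p.2) ^ 2 + 4 * ε ^ 2 ≠ 0 := fun y => by positivity
  have hk : Continuous fun p : ℝ × ℝ => 4 * Real.pi * ε / ((p.1 - p.2) ^ 2 + 4 * ε ^ 2) :=
    Continuous.div (by fun_prop) (by fun_prop) hpos
  calc _ ≤ ∫ x, ((∫ y, g y * ((x - y) / ((x - y) ^ 2 + ε ^ 2)) ∂(muR R)) ^ 2 +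
        (∫ y, g y * (ε / ((x - y) ^ 2 + ε ^ 2)) ∂(muR R)) ^ 2) ∂(muR R) := by
        refine integral_mono_of_nonneg (Eventually.of_forall fun x => sq_nonneg _)
          (hInt.mono_measure (muR_le R)) (Eventually.of_forall fun x => ?_)
        exact le_add_of_nonneg_right (sq_nonneg _)
    _ ≤ ∫ x, ((∫ y, g y * ((x - y) / ((x - y) ^ 2 + ε ^ 2)) ∂(muR R)) ^ 2 +
        (∫ y, g y * (ε / ((x - y) ^ 2 + ε ^ 2)) ∂(muR R)) ^ 2) :=
        integral_mono_measure (muR_le R) (Eventually.of_forall fun x => by positivity) hInt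
    _ = ∫ p : ℝ × ℝ, g p.1 * g p.2 * (4 * Real.pi * ε / ((p.1 - p.2) ^ 2 + 4 * ε ^ 2))
        ∂((muR R).prod (muR R)) := by
        simp only [sq_add_sq_eq_integral hε hg]
        rw [integral_integral_swap h3]
        simp only [integral_const_mul, integral_cauchyProd ε _ _ hε]
    _ ≤ ∫ p : ℝ × ℝ, (1 / 2 * (g p.1 ^ 2 * (4 * Real.pi * ε / ((p.1 - p.2) ^ 2 + 4 * ε ^ 2))) +
        1 / 2 * (g p.2 ^ 2 * (4 * Real.pi * ε / ((p.2 - p.1) ^ 2 + 4 * ε ^ 2))))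
        ∂((muR R).prod (muR R)) := by
        have hs : ∀ p : ℝ × ℝ, (p.2 - p.1) ^ 2 = (p.1 - p.2) ^ 2 := fun p => by ring
        simp only [hs]
        refine integral_mono (integrable_muR_prod (by fun_prop) R)
          (integrable_muR_prod (by fun_prop) R) fun p => ?_
        simp only
        have h0 : 0 ≤ 4 * Real.pi * ε / ((p.1 - p.2) ^ 2 + 4 * ε ^ 2) := by
          have := Real.pi_pos
          positivity
        nlinarith [mul_nonneg h0 (sq_nonneg (g p.1 - g p.2))]
    _ ≤ _ := by
        have hk' : Continuous fun p : ℝ × ℝ => g p.1 ^ 2 *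
          (4 * Real.pi * ε / ((p.1 - p.2) ^ 2 + 4 * ε ^ 2)) := by fun_prop
        have hsw : Continuous fun p : ℝ × ℝ => g p.2 ^ 2 *
          (4 * Real.pi * ε / ((p.2 - p.1) ^ 2 + 4 * ε ^ 2)) := hk'.comp continuous_swap
        rw [integral_add ((integrable_muR_prod hk' R).const_mul _)
          ((integrable_muR_prod hsw R).const_mul _), integral_const_mul, integral_const_mul]
        have e := integral_prod_swap (μ := muR R) (ν := muR R) (fun p : ℝ × ℝ => g p.1 ^ 2 *
          (4 * Real.pi * ε / ((p.1 - p.2) ^ 2 + 4 * ε ^ 2)))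
        simp only [Prod.fst_swap, Prod.snd_swap] at e
        rw [e]
        linarith [integral_sq_mul_kernel_le (R := R) hε hg]

theorem abs_hilbert_le {ε R : ℝ} (hε : 0 < ε) {f g : ℝ → ℝ} (hf : Continuous f)
    (hg : Continuous g) :
    |∫ p : ℝ × ℝ, (p.1 - p.2) / ((p.1 - p.2) ^ 2 + ε ^ 2) * (f p.1 * g p.2)
      ∂((muR R).prod (muR R))| ≤
      10 * ((∫ x, f x ^ 2 ∂(muR R)) + ∫ x, g x ^ 2 ∂(muR R)) := by
  have hpos : ∀ p : ℝ × ℝ, (p.1 - p.2) ^ 2 + ε ^ 2 ≠ 0 := fun p => by positivity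
  have hk : Continuous fun p : ℝ × ℝ => (p.1 - p.2) / ((p.1 - p.2) ^ 2 + ε ^ 2) :=
    Continuous.div (by fun_prop) (by fun_prop) hpos
  set A : ℝ → ℝ := fun x => ∫ y, g y * ((x - y) / ((x - y) ^ 2 + ε ^ 2)) ∂(muR R) with hA
  have hAc : Continuous A := by
    have : Continuous (Function.uncurry fun x y : ℝ =>
        g y * ((x - y) / ((x - y) ^ 2 + ε ^ 2))) := by
      refine Continuous.mul (by fun_prop) hk
    exact continuous_parametric_integral_of_continuous this isCompact_Icc
  rw [integral_prod _ (integrable_muR_prod (by fun_prop) R)]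
  have e : ∀ x, ∫ y, (x - y) / ((x - y) ^ 2 + ε ^ 2) * (f x * g y) ∂(muR R) = f x * A x := by
    intro x
    rw [hA, ← integral_const_mul]
    congr 1
    ext y
    ring
  simp only [e]
  have h1 := integral_sq_hilbert_le (R := R) hε hg
  have h2 : ∫ x, |f x * A x| ∂(muR R) ≤ ∫ x, (1 / 2 * f x ^ 2 + 1 / 2 * A x ^ 2) ∂(muR R) := by
    refine integral_mono (integrable_muR (by fun_prop) R) (integrable_muR (by fun_prop) R)
      fun x => ?_
    simp only
    rw [abs_le]
    constructor <;> nlinarith [sq_nonneg (f x - A x), sq_nonneg (f x + A x)]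
  rw [integral_add (integrable_muR (by fun_prop) R) (integrable_muR (by fun_prop) R),
    integral_const_mul, integral_const_mul] at h2
  have h3 : 0 ≤ ∫ x, f x ^ 2 ∂(muR R) := integral_nonneg fun x => sq_nonneg _
  have h4 : 0 ≤ ∫ x, g x ^ 2 ∂(muR R) := integral_nonneg fun x => sq_nonneg _
  have h5 : Real.pi ^ 2 ≤ 10 := by nlinarith [Real.pi_lt_d2, Real.pi_pos]
  refine (abs_integral_le_integral_abs).trans (h2.trans ?_)
  have h6 : ∫ x, A x ^ 2 ∂(muR R) ≤ 2 * Real.pi ^ 2 * ∫ x, g x ^ 2 ∂(muR R) := h1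
  nlinarith

/-- `L²` bound for the truncated Hilbert transform on `[-R, R]`, complex-valued. -/
theorem norm_hilbert_le {ε R : ℝ} (hε : 0 < ε) {f g : ℝ → ℂ} (hf : Continuous f)
    (hg : Continuous g) :
    ‖∫ p : ℝ × ℝ, ((p.1 - p.2) / ((p.1 - p.2) ^ 2 + ε ^ 2) : ℝ) * (f p.1 * g p.2)
      ∂((muR R).prod (muR R))‖ ≤
      20 * ((∫ x, ‖f x‖ ^ 2 ∂(muR R)) + ∫ x, ‖g x‖ ^ 2 ∂(muR R)) := by
  have hpos : ∀ p : ℝ × ℝ, (p.1 - p.2) ^ 2 + ε ^ 2 ≠ 0 := fun p => by positivity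
  have hk : Continuous fun p : ℝ × ℝ => (p.1 - p.2) / ((p.1 - p.2) ^ 2 + ε ^ 2) :=
    Continuous.div (by fun_prop) (by fun_prop) hpos
  set k := fun p : ℝ × ℝ => (p.1 - p.2) / ((p.1 - p.2) ^ 2 + ε ^ 2) with hkdef
  have hfr : Continuous fun x => (f x).re := by fun_prop
  have hfi : Continuous fun x => (f x).im := by fun_prop
  have hgr : Continuous fun x => (g x).re := by fun_prop
  have hgi : Continuous fun x => (g x).im := by fun_prop
  have hI : Integrable (fun p : ℝ × ℝ => ((k p : ℝ) : ℂ) * (f p.1 * g p.2))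
    ((muR R).prod (muR R)) := integrable_muR_prod (by fun_prop) R
  have hre : (∫ p : ℝ × ℝ, ((k p : ℝ) : ℂ) * (f p.1 * g p.2) ∂((muR R).prod (muR R))).re =
      (∫ p : ℝ × ℝ, k p * ((f p.1).re * (g p.2).re) ∂((muR R).prod (muR R))) -
      ∫ p : ℝ × ℝ, k p * ((f p.1).im * (g p.2).im) ∂((muR R).prod (muR R)) := by
    rw [← integral_sub (integrable_muR_prod (by fun_prop) R) (integrable_muR_prod (by fun_prop) R)]
    have := integral_re hI
    simp only [RCLike.re_to_complex] at this
    rw [← this]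
    congr 1
    ext p
    rw [Complex.re_ofReal_mul, Complex.mul_re]
    ring
  have him : (∫ p : ℝ × ℝ, ((k p : ℝ) : ℂ) * (f p.1 * g p.2) ∂((muR R).prod (muR R))).im =
      (∫ p : ℝ × ℝ, k p * ((f p.1).re * (g p.2).im) ∂((muR R).prod (muR R))) +
      ∫ p : ℝ × ℝ, k p * ((f p.1).im * (g p.2).re) ∂((muR R).prod (muR R)) := by
    rw [← integral_add (integrable_muR_prod (by fun_prop) R) (integrable_muR_prod (by fun_prop) R)]
    have := integral_im hI
    simp only [RCLike.im_to_complex] at this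
    rw [← this]
    congr 1
    ext p
    rw [Complex.im_ofReal_mul, Complex.mul_im]
    ring
  have hn : ∀ h : ℝ → ℂ, Continuous h → ∫ x, ‖h x‖ ^ 2 ∂(muR R) =
      (∫ x, (h x).re ^ 2 ∂(muR R)) + ∫ x, (h x).im ^ 2 ∂(muR R) := by
    intro h hh
    rw [← integral_add (integrable_muR (by fun_prop) R) (integrable_muR (by fun_prop) R)]
    congr 1
    ext x
    rw [Complex.sq_norm, Complex.normSq_apply]
    ring
  rw [hn f hf, hn g hg]
  refine (Complex.norm_le_abs_re_add_abs_im _).trans ?_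
  rw [hre, him]
  have h1 := abs_hilbert_le (R := R) hε hfr hgr
  have h2 := abs_hilbert_le (R := R) hε hfi hgi
  have h3 := abs_hilbert_le (R := R) hε hfr hgi
  have h4 := abs_hilbert_le (R := R) hε hfi hgr
  refine (add_le_add (abs_sub _ _) (abs_add_le _ _)).trans ?_
  linarith

/-- The Cayley transform of the real line onto the unit circle. -/
def cay (x : ℝ) : ℂ := (x - Complex.I) / (x + Complex.I)

theorem ofReal_add_I_ne_zero (x : ℝ) : (x : ℂ) + Complex.I ≠ 0 := by
  intro h
  have := congrArg Complex.im h
  simp at this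

theorem norm_sq_ofReal_add_I (x : ℝ) : ‖(x : ℂ) + Complex.I‖ ^ 2 = 1 + x ^ 2 := by
  rw [Complex.sq_norm, Complex.normSq_apply]
  simp
  ring

theorem norm_sq_ofReal_sub_I (x : ℝ) : ‖(x : ℂ) - Complex.I‖ ^ 2 = 1 + x ^ 2 := by
  rw [Complex.sq_norm, Complex.normSq_apply]
  simp
  ring

theorem continuous_cay : Continuous cay := by
  unfold cay
  exact Continuous.div (by fun_prop) (by fun_prop) ofReal_add_I_ne_zero

theorem norm_cay (x : ℝ) : ‖cay x‖ = 1 := by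
  have h : ‖cay x‖ ^ 2 = 1 := by
    rw [cay, norm_div, div_pow, norm_sq_ofReal_add_I, norm_sq_ofReal_sub_I, div_self]
    positivity
  exact (pow_eq_one_iff_of_nonneg (norm_nonneg _) two_ne_zero).1 h

theorem cay_sub_cay (x y : ℝ) : cay x - cay y =
    2 * Complex.I * ((x - y : ℝ) : ℂ) / ((x + Complex.I) * (y + Complex.I)) := by
  have h1 := ofReal_add_I_ne_zero x
  have h2 := ofReal_add_I_ne_zero y
  unfold cay
  push_cast
  field_simp
  ring

/-- The weighted local `L²` quantity. -/
def wnorm (R : ℝ) (f : ℝ → ℂ) : ℝ := ∫ x, (1 + x ^ 2)⁻¹ * ‖f x‖ ^ 2 ∂(muR R)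

/-- The regularised singular kernel. -/
def ker2 (ε s : ℝ) : ℝ := (s ^ 2 + ε ^ 2)⁻¹

theorem continuous_ker2 {ε : ℝ} (hε : 0 < ε) : Continuous (ker2 ε) := by
  unfold ker2
  exact Continuous.inv₀ (by fun_prop) fun x => by positivity

theorem ker2_nonneg (ε s : ℝ) : 0 ≤ ker2 ε s := by unfold ker2; positivity

/-- The commutator form of `φ` with the regularised singular kernel. -/
def commForm (R ε : ℝ) (φ f g : ℝ → ℂ) : ℂ :=
  ∫ p : ℝ × ℝ, (ker2 ε (p.1 - p.2) : ℂ) * ((φ p.1 - φ p.2) * (f p.1 * g p.2))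
    ∂((muR R).prod (muR R))

/-- Families of bounded multipliers whose commutators with the singular kernel are
bounded uniformly in the family and in the regularisation. -/
def GoodFam {ι : Type*} (φ : ι → ℝ → ℂ) : Prop :=
  (∀ t, Continuous (φ t)) ∧ ∃ C M : ℝ, 0 ≤ C ∧ 0 ≤ M ∧ ∀ t, (∀ x, ‖φ t x‖ ≤ M) ∧
    ∀ R ε, 0 < ε → ∀ f g : ℝ → ℂ, Continuous f → Continuous g →
      ‖commForm R ε (φ t) f g‖ ≤ C * (wnorm R f + wnorm R g)

theorem continuous_weight : Continuous fun x : ℝ => (1 + x ^ 2)⁻¹ :=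
  Continuous.inv₀ (by fun_prop) fun x => by positivity

theorem wnorm_nonneg (R : ℝ) (f : ℝ → ℂ) : 0 ≤ wnorm R f :=
  integral_nonneg fun x => by positivity

theorem wnorm_mono {R C : ℝ} {f g : ℝ → ℂ} (hf : Continuous f) (hg : Continuous g)
    (h : ∀ x, ‖f x‖ ≤ C * ‖g x‖) : wnorm R f ≤ C ^ 2 * wnorm R g := by
  unfold wnorm
  have := continuous_weight
  rw [← integral_const_mul]
  refine integral_mono (integrable_muR (by fun_prop) R) (integrable_muR (by fun_prop) R)
    fun x => ?_
  simp only
  have h1 : ‖f x‖ ^ 2 ≤ C ^ 2 * ‖g x‖ ^ 2 := by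
    rw [← mul_pow]
    exact pow_le_pow_left₀ (norm_nonneg _) (h x) 2
  calc _ ≤ (1 + x ^ 2)⁻¹ * (C ^ 2 * ‖g x‖ ^ 2) := by gcongr
    _ = _ := by ring

theorem integrable_commForm {R ε : ℝ} (hε : 0 < ε) {φ f g : ℝ → ℂ} (hφ : Continuous φ)
    (hf : Continuous f) (hg : Continuous g) :
    Integrable (fun p : ℝ × ℝ => (ker2 ε (p.1 - p.2) : ℂ) * ((φ p.1 - φ p.2) * (f p.1 * g p.2)))
      ((muR R).prod (muR R)) := by
  have := continuous_ker2 hε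
  exact integrable_muR_prod (by fun_prop) R

theorem goodFam_const {ι : Type*} (c : ι → ℂ) (M : ℝ) (hM : ∀ t, ‖c t‖ ≤ M) :
    GoodFam fun t (_ : ℝ) => c t := by
  refine ⟨fun t => continuous_const, 0, max M 0, le_rfl, le_max_right _ _, fun t =>
    ⟨fun x => (hM t).trans (le_max_left _ _), fun R ε hε f g hf hg => ?_⟩⟩
  simp [commForm]

theorem goodFam_cay {ι : Type*} : GoodFam fun (_ : ι) => cay := by
  refine ⟨fun _ => continuous_cay, 40, 1, by norm_num, by norm_num, fun _ =>
    ⟨fun x => (norm_cay x).le, fun R ε hε f g hf hg => ?_⟩⟩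
  have hden : Continuous fun x : ℝ => ((x : ℂ) + Complex.I)⁻¹ :=
    Continuous.inv₀ (by fun_prop) ofReal_add_I_ne_zero
  have hF : Continuous fun x => f x * ((x : ℂ) + Complex.I)⁻¹ := by fun_prop
  have hG : Continuous fun x => g x * ((x : ℂ) + Complex.I)⁻¹ := by fun_prop
  have h := norm_hilbert_le (R := R) hε hF hG
  have e : ∀ h : ℝ → ℂ, ∫ x, ‖h x * ((x : ℂ) + Complex.I)⁻¹‖ ^ 2 ∂(muR R) = wnorm R h := by
    intro h
    unfold wnorm
    congr 1
    ext x
    rw [norm_mul, mul_pow, norm_inv, inv_pow, norm_sq_ofReal_add_I]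
    ring
  rw [e, e] at h
  have e2 : commForm R ε cay f g = (2 * Complex.I) *
      ∫ p : ℝ × ℝ, ((p.1 - p.2) / ((p.1 - p.2) ^ 2 + ε ^ 2) : ℝ) *
        (f p.1 * ((p.1 : ℂ) + Complex.I)⁻¹ * (g p.2 * ((p.2 : ℂ) + Complex.I)⁻¹))
      ∂((muR R).prod (muR R)) := by
    unfold commForm
    rw [← integral_const_mul]
    congr 1
    ext p
    rw [cay_sub_cay, ker2]
    simp only [div_eq_mul_inv, mul_inv, Complex.ofReal_mul]
    ring
  rw [e2, norm_mul]
  simp only [norm_mul, Complex.norm_I, Complex.norm_ofNat, mul_one]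
  norm_num at h ⊢
  linarith

theorem GoodFam.add {ι : Type*} {φ ψ : ι → ℝ → ℂ} (h₁ : GoodFam φ) (h₂ : GoodFam ψ) :
    GoodFam fun t x => φ t x + ψ t x := by
  obtain ⟨c₁, C₁, M₁, hC₁, hM₁, h₁⟩ := h₁
  obtain ⟨c₂, C₂, M₂, hC₂, hM₂, h₂⟩ := h₂
  refine ⟨fun t => (c₁ t).add (c₂ t), C₁ + C₂, M₁ + M₂, by positivity, by positivity, fun t =>
    ⟨fun x => (norm_add_le _ _).trans (add_le_add ((h₁ t).1 x) ((h₂ t).1 x)),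
      fun R ε hε f g hf hg => ?_⟩⟩
  have e : commForm R ε (fun x => φ t x + ψ t x) f g =
      commForm R ε (φ t) f g + commForm R ε (ψ t) f g := by
    unfold commForm
    rw [← integral_add (integrable_commForm hε (c₁ t) hf hg) (integrable_commForm hε (c₂ t) hf hg)]
    congr 1
    ext p
    ring
  rw [e, add_mul]
  exact (norm_add_le _ _).trans
    (add_le_add ((h₁ t).2 R ε hε f g hf hg) ((h₂ t).2 R ε hε f g hf hg))

theorem GoodFam.mul {ι : Type*} {φ ψ : ι → ℝ → ℂ} (h₁ : GoodFam φ) (h₂ : GoodFam ψ) :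
    GoodFam fun t x => φ t x * ψ t x := by
  obtain ⟨c₁, C₁, M₁, hC₁, hM₁, h₁⟩ := h₁
  obtain ⟨c₂, C₂, M₂, hC₂, hM₂, h₂⟩ := h₂
  refine ⟨fun t => (c₁ t).mul (c₂ t), C₁ * (M₂ ^ 2 + 1) + C₂ * (M₁ ^ 2 + 1), M₁ * M₂,
    by positivity, by positivity, fun t =>
    ⟨fun x => ?_, fun R ε hε f g hf hg => ?_⟩⟩
  · rw [norm_mul]
    exact mul_le_mul ((h₁ t).1 x) ((h₂ t).1 x) (norm_nonneg _) hM₁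
  have hf' : Continuous fun x => ψ t x * f x := (c₂ t).mul hf
  have hg' : Continuous fun x => φ t x * g x := (c₁ t).mul hg
  have e : commForm R ε (fun x => φ t x * ψ t x) f g =
      commForm R ε (φ t) (fun x => ψ t x * f x) g +
      commForm R ε (ψ t) f (fun x => φ t x * g x) := by
    unfold commForm
    rw [← integral_add (integrable_commForm hε (c₁ t) hf' hg)
      (integrable_commForm hε (c₂ t) hf hg')]
    congr 1
    ext p
    ring
  rw [e]
  refine (norm_add_le _ _).trans ((add_le_add ((h₁ t).2 R ε hε _ g hf' hg)
    ((h₂ t).2 R ε hε f _ hf hg')).trans ?_)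
  have n1 : wnorm R (fun x => ψ t x * f x) ≤ M₂ ^ 2 * wnorm R f := by
    refine wnorm_mono hf' hf fun x => ?_
    rw [norm_mul]
    exact mul_le_mul_of_nonneg_right ((h₂ t).1 x) (norm_nonneg _)
  have n2 : wnorm R (fun x => φ t x * g x) ≤ M₁ ^ 2 * wnorm R g := by
    refine wnorm_mono hg' hg fun x => ?_
    rw [norm_mul]
    exact mul_le_mul_of_nonneg_right ((h₁ t).1 x) (norm_nonneg _)
  have p1 := wnorm_nonneg R f
  have p2 := wnorm_nonneg R g
  have q1 : 0 ≤ M₂ ^ 2 * wnorm R g := by positivity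
  have q2 : 0 ≤ M₁ ^ 2 * wnorm R f := by positivity
  have r1 := mul_le_mul_of_nonneg_left n1 hC₁
  have r2 := mul_le_mul_of_nonneg_left n2 hC₂
  nlinarith [mul_nonneg hC₁ q1, mul_nonneg hC₂ q2, mul_nonneg hC₁ p1, mul_nonneg hC₂ p2,
    mul_nonneg hC₁ p2, mul_nonneg hC₂ p1]

theorem GoodFam.conj {ι : Type*} {φ : ι → ℝ → ℂ} (h₁ : GoodFam φ) :
    GoodFam fun t x => (starRingEnd ℂ) (φ t x) := by
  obtain ⟨c₁, C₁, M₁, hC₁, hM₁, h₁⟩ := h₁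
  refine ⟨fun t => Complex.continuous_conj.comp (c₁ t), C₁, M₁, hC₁, hM₁, fun t =>
    ⟨fun x => by rw [Complex.norm_conj]; exact (h₁ t).1 x, fun R ε hε f g hf hg => ?_⟩⟩
  have e : commForm R ε (fun x => (starRingEnd ℂ) (φ t x)) f g = (starRingEnd ℂ)
      (commForm R ε (φ t) (fun x => (starRingEnd ℂ) (f x)) (fun x => (starRingEnd ℂ) (g x))) := by
    unfold commForm
    rw [← integral_conj]
    congr 1
    ext p
    simp
  have n : ∀ f : ℝ → ℂ, wnorm R (fun x => (starRingEnd ℂ) (f x)) = wnorm R f := by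
    intro f
    simp [wnorm]
  rw [e, Complex.norm_conj]
  refine ((h₁ t).2 R ε hε _ _ (Complex.continuous_conj.comp hf)
    (Complex.continuous_conj.comp hg)).trans (le_of_eq ?_)
  rw [← n f, ← n g]
  rfl

theorem GoodFam.inv {ι : Type*} {φ : ι → ℝ → ℂ} (h₁ : GoodFam φ) (M : ℝ)
    (h0 : ∀ t x, φ t x ≠ 0) (hM : ∀ t x, ‖(φ t x)⁻¹‖ ≤ M) :
    GoodFam fun t x => (φ t x)⁻¹ := by
  obtain ⟨c₁, C₁, M₁, hC₁, hM₁, h₁⟩ := h₁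
  have ci : ∀ t, Continuous fun x => (φ t x)⁻¹ := fun t => (c₁ t).inv₀ (h0 t)
  refine ⟨ci, C₁ * M ^ 2, max M 0, by positivity, le_max_right _ _, fun t =>
    ⟨fun x => (hM t x).trans (le_max_left _ _), fun R ε hε f g hf hg => ?_⟩⟩
  have hf' : Continuous fun x => -((φ t x)⁻¹ * f x) := ((ci t).mul hf).neg
  have hg' : Continuous fun x => (φ t x)⁻¹ * g x := (ci t).mul hg
  have e : commForm R ε (fun x => (φ t x)⁻¹) f g =
      commForm R ε (φ t) (fun x => -((φ t x)⁻¹ * f x)) (fun x => (φ t x)⁻¹ * g x) := by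
    unfold commForm
    congr 1
    ext p
    have := h0 t p.1
    have := h0 t p.2
    field_simp
    ring
  rw [e]
  refine ((h₁ t).2 R ε hε _ _ hf' hg').trans ?_
  have n1 : wnorm R (fun x => -((φ t x)⁻¹ * f x)) ≤ M ^ 2 * wnorm R f := by
    refine wnorm_mono hf' hf fun x => ?_
    rw [norm_neg, norm_mul]
    exact mul_le_mul_of_nonneg_right (hM t x) (norm_nonneg _)
  have n2 : wnorm R (fun x => (φ t x)⁻¹ * g x) ≤ M ^ 2 * wnorm R g := by
    refine wnorm_mono hg' hg fun x => ?_
    rw [norm_mul]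
    exact mul_le_mul_of_nonneg_right (hM t x) (norm_nonneg _)
  calc _ ≤ C₁ * (M ^ 2 * wnorm R f + M ^ 2 * wnorm R g) := by gcongr
    _ = _ := by ring

theorem GoodFam.comp {ι κ : Type*} {φ : ι → ℝ → ℂ} (h : GoodFam φ) (s : κ → ι) :
    GoodFam fun k => φ (s k) := by
  obtain ⟨c, C, M, hC, hM, h⟩ := h
  exact ⟨fun k => c _, C, M, hC, hM, fun k => h _⟩

theorem goodFam_pow_cay {ι : Type*} (k : ℕ) : GoodFam fun (_ : ι) x => cay x ^ k := by
  induction k with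
  | zero => simpa using goodFam_const (fun _ : ι => (1 : ℂ)) 1 (by simp)
  | succ k ih => simpa only [pow_succ] using ih.mul goodFam_cay

theorem goodFam_sum {ι : Type*} {n : ℕ} {φ : Fin n → ι → ℝ → ℂ} (h : ∀ k, GoodFam (φ k)) :
    GoodFam fun t x => ∑ k, φ k t x := by
  induction n with
  | zero => simpa using goodFam_const (fun _ : ι => (0 : ℂ)) 0 (by simp)
  | succ n ih =>
    simp only [Fin.sum_univ_succ]
    exact (h 0).add (ih fun k => h _)

theorem weight_eq_cay (x : ℝ) : (((1 + x ^ 2)⁻¹ : ℝ) : ℂ) =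
    (1 / 4) * ((1 - cay x) * (starRingEnd ℂ) (1 - cay x)) := by
  have h1 : 1 - cay x = 2 * Complex.I / (x + Complex.I) := by
    have := ofReal_add_I_ne_zero x
    unfold cay
    field_simp
    ring
  rw [Complex.mul_conj, h1, Complex.normSq_eq_norm_sq, norm_div, div_pow, norm_sq_ofReal_add_I]
  simp
  ring

theorem goodFam_weight {ι : Type*} :
    GoodFam fun (_ : ι) (x : ℝ) => (((1 + x ^ 2)⁻¹ : ℝ) : ℂ) := by
  simp only [weight_eq_cay]
  have h1 : GoodFam fun (_ : ι) (x : ℝ) => 1 - cay x := by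
    have := (goodFam_const (fun _ : ι => (1 : ℂ)) 1 (by simp)).add
      ((goodFam_const (fun _ : ι => (-1 : ℂ)) 1 (by simp)).mul goodFam_cay)
    simpa [sub_eq_add_neg] using this
  exact (goodFam_const (fun _ : ι => (1 / 4 : ℂ)) 1 (by norm_num)).mul (h1.mul h1.conj)

/-- Second symmetric difference. -/
def symDiff2 {E : Type*} [NormedAddCommGroup E] (g : ℝ → E) (x s : ℝ) : E :=
  (g x - g (x - s)) + (g x - g (x + s))

theorem continuous_symDiff2 {E : Type*} [NormedAddCommGroup E] {g : ℝ → E} (hg : Continuous g)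
    (x : ℝ) :
    Continuous (symDiff2 g x) := by
  unfold symDiff2
  fun_prop

section HalfLaplacian

variable {E : Type*} [NormedAddCommGroup E] [NormedSpace ℝ E]

/-- The half-Laplacian in the form of an absolutely convergent integral. -/
def halfLap (g : ℝ → E) (x : ℝ) : E :=
  (Real.pi)⁻¹ • ∫ s in Set.Ioi (0 : ℝ), (s ^ 2)⁻¹ • symDiff2 g x s

theorem exists_symDiff2_le {g : ℝ → E} (hg : ContDiff ℝ 2 g) {M : ℝ} (hM : ∀ x, ‖g x‖ ≤ M)
    (R : ℝ) : ∃ C, 0 ≤ C ∧ ∀ x ∈ Set.Icc (-R) R, ∀ s, 0 < s →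
      ‖symDiff2 g x s‖ ≤ C * (s ^ 2 * (1 + s ^ 2)⁻¹) := by
  have hM0 : 0 ≤ M := (norm_nonneg _).trans (hM 0)
  have hg1 : Differentiable ℝ g := hg.differentiable (by norm_num)
  have hg2 : ContDiff ℝ 1 (deriv g) := by
    have : ContDiff ℝ (1 + 1) g := by norm_num; exact hg
    exact (contDiff_succ_iff_deriv.1 this).2.2
  have hg3 : Differentiable ℝ (deriv g) := hg2.differentiable (by norm_num)
  have hg4 : Continuous (deriv (deriv g)) := hg2.continuous_deriv (by norm_num)
  obtain ⟨B, hB⟩ := (isCompact_Icc (a := -(R + 1)) (b := R + 1)).exists_bound_of_continuousOn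
    hg4.continuousOn
  have key : ∀ x ∈ Set.Icc (-R) R, ∀ s, 0 < s → s ≤ 1 → ‖symDiff2 g x s‖ ≤ 2 * max B 0 * s ^ 2 := by
    intro x hx s hs hs1
    have hder : ∀ τ ∈ Set.Icc (0 : ℝ) s, HasDerivWithinAt (symDiff2 g x)
        (deriv g (x - τ) - deriv g (x + τ)) (Set.Icc 0 s) τ := by
      intro τ _
      have e1 : HasDerivAt (fun τ => g (x - τ)) (-deriv g (x - τ)) τ := by
        simpa [Function.comp_def] using
          (hg1 (x - τ)).hasDerivAt.scomp τ ((hasDerivAt_id τ).const_sub x)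
      have e2 : HasDerivAt (fun τ => g (x + τ)) (deriv g (x + τ)) τ := by
        simpa [Function.comp_def] using
          (hg1 (x + τ)).hasDerivAt.scomp τ ((hasDerivAt_id τ).const_add x)
      have e3 := (e1.const_sub (g x)).add (e2.const_sub (g x))
      refine (HasDerivAt.congr_deriv e3 ?_).hasDerivWithinAt
      abel
    have hbd : ∀ τ ∈ Set.Ico (0 : ℝ) s,
        ‖deriv g (x - τ) - deriv g (x + τ)‖ ≤ 2 * max B 0 * s := by
      intro τ hτ
      have hmem : ∀ z ∈ Set.Icc (-(R + 1)) (R + 1), ‖deriv (deriv g) z‖ ≤ max B 0 :=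
        fun z hz => (hB z hz).trans (le_max_left _ _)
      have := (convex_Icc (-(R + 1)) (R + 1)).norm_image_sub_le_of_norm_deriv_le
        (f := deriv g) (fun z _ => hg3 z) hmem
        (x := x + τ) (y := x - τ) ⟨by linarith [hx.1, hτ.1], by linarith [hx.2, hτ.2]⟩
        ⟨by linarith [hx.1, hτ.2], by linarith [hx.2, hτ.1]⟩
      refine this.trans ?_
      have e : ‖x - τ - (x + τ)‖ = 2 * τ := by
        rw [Real.norm_eq_abs, show x - τ - (x + τ) = -(2 * τ) by ring, abs_neg,
          abs_of_nonneg (by linarith [hτ.1])]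
      rw [e]
      have : 0 ≤ max B 0 := le_max_right _ _
      nlinarith [hτ.1, hτ.2]
    have h := norm_image_sub_le_of_norm_deriv_le_segment' hder hbd s ⟨hs.le, le_rfl⟩
    have h0 : symDiff2 g x 0 = 0 := by simp [symDiff2]
    rw [h0, sub_zero, sub_zero] at h
    linarith
  refine ⟨4 * max B 0 + 8 * M, by positivity, fun x hx s hs => ?_⟩
  have hpos : 0 < 1 + s ^ 2 := by positivity
  have hB0 : 0 ≤ max B 0 := le_max_right _ _
  rw [← mul_assoc, ← div_eq_mul_inv, le_div_iff₀ hpos]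
  rcases le_total s 1 with h | h
  · have h1 := key x hx s hs h
    have h2 : s ^ 2 ≤ 1 := pow_le_one₀ hs.le h
    have h3 : 0 ≤ max B 0 * s ^ 2 := by positivity
    have h4 : 0 ≤ M * s ^ 2 := by positivity
    have h5 : 0 ≤ ‖symDiff2 g x s‖ := norm_nonneg _
    nlinarith
  · have h1 : ‖symDiff2 g x s‖ ≤ 4 * M := by
      unfold symDiff2
      refine (norm_add_le _ _).trans ?_
      have a1 := norm_sub_le (g x) (g (x - s))
      have a2 := norm_sub_le (g x) (g (x + s))
      linarith [hM x, hM (x - s), hM (x + s)]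
    have h2 : 1 ≤ s ^ 2 := one_le_pow₀ h
    have h3 : 0 ≤ max B 0 * s ^ 2 := by positivity
    nlinarith [mul_le_mul_of_nonneg_right h1 hpos.le, mul_le_mul_of_nonneg_left h2 hM0]

theorem continuousOn_inv_sq_smul_symDiff2 {g : ℝ → E} (hg : Continuous g) (x : ℝ) :
    ContinuousOn (fun s : ℝ => (s ^ 2)⁻¹ • symDiff2 g x s) (Set.Ioi 0) := by
  refine ContinuousOn.smul (ContinuousOn.inv₀ (by fun_prop) fun s hs => ?_)
    (continuous_symDiff2 hg x).continuousOn
  exact pow_ne_zero 2 (ne_of_gt hs)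

theorem norm_smul_symDiff2_le {C s k : ℝ} {e : E} (hs : 0 < s)
    (h : ‖e‖ ≤ C * (s ^ 2 * (1 + s ^ 2)⁻¹)) (hk0 : 0 ≤ k) (hk : k ≤ (s ^ 2)⁻¹) :
    ‖k • e‖ ≤ C * (1 + s ^ 2)⁻¹ := by
  rw [norm_smul, Real.norm_eq_abs, abs_of_nonneg hk0]
  calc _ ≤ (s ^ 2)⁻¹ * (C * (s ^ 2 * (1 + s ^ 2)⁻¹)) :=
        mul_le_mul hk h (norm_nonneg _) (by positivity)
    _ = _ := by field_simp

theorem integrableOn_symDiff2 {g : ℝ → E} (hg : ContDiff ℝ 2 g) {M : ℝ} (hM : ∀ x, ‖g x‖ ≤ M)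
    (x : ℝ) : IntegrableOn (fun s : ℝ => (s ^ 2)⁻¹ • symDiff2 g x s) (Set.Ioi 0) := by
  obtain ⟨C, hC0, hC⟩ := exists_symDiff2_le hg hM |x|
  refine (integrable_inv_one_add_sq.integrableOn.const_mul C).mono'
    ((continuousOn_inv_sq_smul_symDiff2 hg.continuous x).aestronglyMeasurable measurableSet_Ioi) ?_
  filter_upwards [ae_restrict_mem measurableSet_Ioi] with s hs
  exact norm_smul_symDiff2_le hs (hC x (abs_le.1 le_rfl) s hs) (by positivity) le_rfl

theorem halfLap_sub {g h : ℝ → E}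
    (hg : ContDiff ℝ 2 g) {M : ℝ} (hM : ∀ x, ‖g x‖ ≤ M)
    (hh : ContDiff ℝ 2 h) {M' : ℝ} (hM' : ∀ x, ‖h x‖ ≤ M') (x : ℝ) :
    halfLap (fun y => g y - h y) x = halfLap g x - halfLap h x := by
  unfold halfLap
  rw [← smul_sub, ← integral_sub (integrableOn_symDiff2 hg hM x) (integrableOn_symDiff2 hh hM' x)]
  congr 2
  ext s
  rw [← smul_sub]
  congr 1
  simp only [symDiff2]
  abel

theorem integral_even_kernel {k : ℝ → ℝ} (hk : Integrable k) (heven : ∀ s, k (-s) = k s)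
    {g : ℝ → E} (hg : Continuous g) {M : ℝ} (hM : ∀ x, ‖g x‖ ≤ M) (x : ℝ) :
    ∫ y, k (x - y) • (g x - g y) = ∫ s in Set.Ioi (0 : ℝ), k s • symDiff2 g x s := by
  have hF : Integrable fun s => k s • (g x - g (x - s)) := by
    refine hk.smul_bdd (2 * M) (Continuous.aestronglyMeasurable (by fun_prop)) ?_
    exact Eventually.of_forall fun s => (norm_sub_le _ _).trans
      (by linarith [hM x, hM (x - s)])
  have h1 : ∫ y, k (x - y) • (g x - g y) = ∫ s, k s • (g x - g (x - s)) := by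
    rw [← integral_sub_left_eq_self (fun s => k s • (g x - g (x - s))) volume x]
    simp
  have hF' : Integrable fun s => k s • (g x - g (x + s)) := by
    have := hF.comp_neg
    simpa [heven, sub_neg_eq_add] using this
  rw [h1, ← integral_add_compl (measurableSet_Ioi (a := (0 : ℝ))) hF, Set.compl_Ioi]
  have h2 := integral_comp_neg_Ioi (0 : ℝ) (fun s => k s • (g x - g (x - s)))
  simp only [neg_zero, heven, sub_neg_eq_add] at h2
  rw [← h2, ← integral_add hF.integrableOn hF'.integrableOn]
  congr 1
  ext s
  rw [← smul_add]
  rfl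

/-- An approximation from below of the kernel `s⁻²` by even integrable kernels. -/
structure ApproxKernel (k : ℝ → ℝ → ℝ) : Prop where
  integrable : ∀ ε, 0 < ε → Integrable (k ε)
  even : ∀ ε s, k ε (-s) = k ε s
  nonneg : ∀ ε s, 0 ≤ k ε s
  le : ∀ ε s, 0 < s → k ε s ≤ (s ^ 2)⁻¹
  tendsto : ∀ s, 0 < s → Tendsto (fun ε => k ε s) (𝓝[>] 0) (𝓝 (s ^ 2)⁻¹)

theorem ApproxKernel.tendsto_integral {k : ℝ → ℝ → ℝ} (hk : ApproxKernel k) {g : ℝ → E}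
    (hg : ContDiff ℝ 2 g) {M : ℝ} (hM : ∀ x, ‖g x‖ ≤ M) (x : ℝ) :
    Tendsto (fun ε => ∫ y, k ε (x - y) • (g x - g y)) (𝓝[>] 0)
      (𝓝 (∫ s in Set.Ioi (0 : ℝ), (s ^ 2)⁻¹ • symDiff2 g x s)) := by
  obtain ⟨C, hC0, hC⟩ := exists_symDiff2_le hg hM |x|
  have h : Tendsto (fun ε => ∫ s in Set.Ioi (0 : ℝ), k ε s • symDiff2 g x s) (𝓝[>] 0)
      (𝓝 (∫ s in Set.Ioi (0 : ℝ), (s ^ 2)⁻¹ • symDiff2 g x s)) := by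
    refine tendsto_integral_filter_of_dominated_convergence (fun s => C * (1 + s ^ 2)⁻¹) ?_ ?_
      (integrable_inv_one_add_sq.integrableOn.const_mul C) ?_
    · filter_upwards [self_mem_nhdsWithin] with ε hε
      exact ((hk.integrable ε hε).aestronglyMeasurable.restrict).smul
        (continuous_symDiff2 hg.continuous x).aestronglyMeasurable
    · filter_upwards [self_mem_nhdsWithin] with ε hε
      filter_upwards [ae_restrict_mem measurableSet_Ioi] with s hs
      exact norm_smul_symDiff2_le hs (hC x (abs_le.1 le_rfl) s hs) (hk.nonneg _ _) (hk.le _ _ hs)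
    · filter_upwards [ae_restrict_mem measurableSet_Ioi] with s hs
      exact (hk.tendsto s hs).smul_const _
  refine h.congr' ?_
  filter_upwards [self_mem_nhdsWithin] with ε hε
  exact (integral_even_kernel (hk.integrable ε hε) (hk.even ε) hg.continuous hM x).symm

theorem ApproxKernel.exists_bound {k : ℝ → ℝ → ℝ} (hk : ApproxKernel k) {g : ℝ → E}
    (hg : ContDiff ℝ 2 g) {M : ℝ} (hM : ∀ x, ‖g x‖ ≤ M) (R : ℝ) :
    ∃ C, 0 ≤ C ∧ ∀ ε, 0 < ε → ∀ x ∈ Set.Icc (-R) R,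
      ‖∫ y, k ε (x - y) • (g x - g y)‖ ≤ C := by
  obtain ⟨C, hC0, hC⟩ := exists_symDiff2_le hg hM R
  refine ⟨∫ s in Set.Ioi (0 : ℝ), C * (1 + s ^ 2)⁻¹,
    integral_nonneg fun s => by positivity, fun ε hε x hx => ?_⟩
  rw [integral_even_kernel (hk.integrable ε hε) (hk.even ε) hg.continuous hM x]
  refine norm_integral_le_of_norm_le (integrable_inv_one_add_sq.integrableOn.const_mul C) ?_
  filter_upwards [ae_restrict_mem measurableSet_Ioi] with s hs
  exact norm_smul_symDiff2_le hs (hC x hx s hs) (hk.nonneg _ _) (hk.le _ _ hs)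

theorem approxKernel_ker2 : ApproxKernel ker2 where
  integrable ε hε := by
    unfold ker2
    simpa using integrable_inv_sq_add_sq ε 0 hε
  even ε s := by simp [ker2]
  nonneg := ker2_nonneg
  le ε s hs := by
    unfold ker2
    exact inv_anti₀ (by positivity) (by nlinarith [sq_nonneg ε])
  tendsto s hs := by
    have h : ContinuousAt (fun ε => ker2 ε s) 0 := by
      unfold ker2
      refine ContinuousAt.inv₀ (by fun_prop) ?_
      positivity
    have := h.tendsto
    simp only [ker2] at this ⊢
    simp only [ne_eq, OfNat.ofNat_ne_zero, not_false_eq_true, zero_pow, add_zero] at this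
    exact this.mono_left nhdsWithin_le_nhds

theorem approxKernel_trunc :
    ApproxKernel fun ε s => Set.indicator {s : ℝ | ε ≤ |s|} (fun s => (s ^ 2)⁻¹) s where
  integrable ε hε := by
    have hm : MeasurableSet {s : ℝ | ε ≤ |s|} :=
      measurableSet_le measurable_const continuous_abs.measurable
    refine (integrable_inv_one_add_sq.const_mul (1 + (ε ^ 2)⁻¹)).mono' ?_ ?_
    · exact (Measurable.indicator (by fun_prop) hm).aestronglyMeasurable
    · refine Eventually.of_forall fun s => ?_
      by_cases hs : ε ≤ |s|
      · rw [Set.indicator_of_mem (by exact hs), Real.norm_eq_abs, abs_of_nonneg (by positivity)]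
        have h1 : ε ^ 2 ≤ s ^ 2 := by
          rw [← sq_abs s]
          exact pow_le_pow_left₀ hε.le hs 2
        have h2 : 0 < s ^ 2 := lt_of_lt_of_le (by positivity) h1
        rw [← div_eq_mul_inv, le_div_iff₀ (by positivity), mul_add, inv_mul_cancel₀ h2.ne']
        have := inv_anti₀ (by positivity) h1
        linarith
      · rw [Set.indicator_of_notMem (by exact hs)]
        simp only [norm_zero]
        positivity
  even ε s := by simp [Set.indicator]
  nonneg ε s := Set.indicator_nonneg (fun s _ => by positivity) s
  le ε s _ := Set.indicator_le_self' (fun s _ => by positivity) s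
  tendsto s hs := by
    refine tendsto_const_nhds.congr' ?_
    have : Set.Iio s ∈ 𝓝[>] (0 : ℝ) := mem_nhdsWithin_of_mem_nhds (Iio_mem_nhds hs)
    filter_upwards [this] with ε hε
    rw [Set.indicator_of_mem]
    exact (le_of_lt hε).trans (le_abs_self s)

theorem HasHalfLap.eq_halfLap {g G : ℝ → E} (h : HasHalfLap g G)
    (hg : ContDiff ℝ 2 g) {M : ℝ} (hM : ∀ x, ‖g x‖ ≤ M) (x : ℝ) : G x = halfLap g x := by
  refine tendsto_nhds_unique (h x) ?_
  have h1 := (approxKernel_trunc.tendsto_integral hg hM x).const_smul (Real.pi)⁻¹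
  refine h1.congr fun ε => ?_
  congr 1
  have hm : MeasurableSet {y : ℝ | ε ≤ |x - y|} :=
    measurableSet_le measurable_const (by fun_prop)
  rw [← integral_indicator hm]
  congr 1
  ext y
  by_cases hy : ε ≤ |x - y|
  · rw [Set.indicator_of_mem (by exact hy), Set.indicator_of_mem (by exact hy)]
  · rw [Set.indicator_of_notMem (by exact hy), Set.indicator_of_notMem (by exact hy), zero_smul]

end HalfLaplacian

/-- The scalar triple product. -/
def det3 (a b c : V3) : ℝ :=
  a 0 * (b 1 * c 2 - b 2 * c 1) + a 1 * (b 2 * c 0 - b 0 * c 2) + a 2 * (b 0 * c 1 - b 1 * c 0)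

/-- The scalar triple product as a continuous linear map in its last argument. -/
def det3CLM (a b : V3) : V3 →L[ℝ] ℝ :=
  LinearMap.toContinuousLinearMap
    { toFun := det3 a b
      map_add' := fun c d => by simp only [det3, Pi.add_apply]; ring
      map_smul' := fun r c => by
        simp only [det3, Pi.smul_apply, smul_eq_mul, RingHom.id_apply]
        ring }

@[simp] theorem det3CLM_apply (a b c : V3) : det3CLM a b c = det3 a b c := rfl

theorem abs_det3_le {a b c : V3} {A B D : ℝ} (ha : ∀ i, |a i| ≤ A) (hb : ∀ i, |b i| ≤ B)
    (hc : ∀ i, |c i| ≤ D) : |det3 a b c| ≤ 6 * (A * B * D) := by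
  have hA : 0 ≤ A := (abs_nonneg _).trans (ha 0)
  have hB : 0 ≤ B := (abs_nonneg _).trans (hb 0)
  have hD : 0 ≤ D := (abs_nonneg _).trans (hc 0)
  have h : ∀ i j k, |a i * (b j * c k)| ≤ A * B * D := by
    intro i j k
    rw [abs_mul, abs_mul, mul_assoc]
    exact mul_le_mul (ha i) (mul_le_mul (hb j) (hc k) (abs_nonneg _) hB)
      (by positivity) hA
  have e : det3 a b c = a 0 * (b 1 * c 2) - a 0 * (b 2 * c 1) + a 1 * (b 2 * c 0)
      - a 1 * (b 0 * c 2) + a 2 * (b 0 * c 1) - a 2 * (b 1 * c 0) := by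
    unfold det3; ring
  rw [e, abs_le]
  have h1 := abs_le.1 (h 0 1 2)
  have h2 := abs_le.1 (h 0 2 1)
  have h3 := abs_le.1 (h 1 2 0)
  have h4 := abs_le.1 (h 1 0 2)
  have h5 := abs_le.1 (h 2 0 1)
  have h6 := abs_le.1 (h 2 1 0)
  constructor <;> linarith [h1.1, h2.1, h3.1, h4.1, h5.1, h6.1, h1.2, h2.2, h3.2, h4.2, h5.2, h6.2]

/-- The cut-off weight on `[-R, R]`. -/
def chi (R x : ℝ) : ℝ := (1 + x ^ 2)⁻¹ - (1 + R ^ 2)⁻¹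

theorem continuous_chi (R : ℝ) : Continuous (chi R) := by
  unfold chi
  have := continuous_weight
  fun_prop

theorem chi_nonneg {R x : ℝ} (hx : x ∈ Set.Icc (-R) R) : 0 ≤ chi R x := by
  unfold chi
  rw [sub_nonneg]
  refine inv_anti₀ (by positivity) ?_
  nlinarith [hx.1, hx.2]

theorem integral_Ioi_inv_sq {R x : ℝ} (hx : x < R) :
    IntegrableOn (fun y : ℝ => ((x - y) ^ 2)⁻¹) (Set.Ioi R) ∧
      ∫ y in Set.Ioi R, ((x - y) ^ 2)⁻¹ = (R - x)⁻¹ := by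
  have hd : ∀ y ∈ Set.Ici R, HasDerivAt (fun y : ℝ => -(y - x)⁻¹) ((x - y) ^ 2)⁻¹ y := by
    intro y hy
    have hne : y - x ≠ 0 := by
      have : R ≤ y := hy
      exact ne_of_gt (by linarith)
    have := (((hasDerivAt_id y).sub_const x).inv hne).neg
    refine this.congr_deriv ?_
    rw [show (x - y) ^ 2 = (id y - x) ^ 2 by simp only [id]; ring]
    ring
  have hl : Tendsto (fun y : ℝ => -(y - x)⁻¹) atTop (𝓝 0) := by
    have : Tendsto (fun y : ℝ => y - x) atTop atTop :=
      tendsto_atTop_add_const_right _ (-x) tendsto_id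
    simpa using (tendsto_inv_atTop_zero.comp this).neg
  have hi := integrableOn_Ioi_deriv_of_nonneg' hd (fun y _ => by positivity) hl
  refine ⟨hi, ?_⟩
  rw [integral_Ioi_of_hasDerivAt_of_tendsto' hd hi hl]
  simp

theorem integral_compl_ker2_le {R x ε : ℝ} (hR : 0 < R) (hε : 0 < ε) (hx : x ∈ Set.Ioo (-R) R) :
    ∫ y in (Set.Icc (-R) R)ᶜ, ker2 ε (x - y) ≤ (R - x)⁻¹ + (R + x)⁻¹ := by
  have hInt : Integrable fun y => ker2 ε (x - y) := by
    unfold ker2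
    have := integrable_inv_sq_add_sq ε x hε
    refine this.congr (Eventually.of_forall fun y => ?_)
    simp only
    congr 2
    ring
  have hle : ∀ y, y ≠ x → ker2 ε (x - y) ≤ ((x - y) ^ 2)⁻¹ := by
    intro y hy
    have : 0 < (x - y) ^ 2 := by
      have : x - y ≠ 0 := sub_ne_zero.2 (Ne.symm hy)
      positivity
    exact inv_anti₀ this (by nlinarith [sq_nonneg ε])
  have h1 : ∫ y in Set.Ioi R, ker2 ε (x - y) ≤ (R - x)⁻¹ := by
    obtain ⟨a, b⟩ := integral_Ioi_inv_sq hx.2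
    rw [← b]
    refine setIntegral_mono_on hInt.integrableOn a measurableSet_Ioi fun y hy => hle y ?_
    have : R < y := hy
    exact ne_of_gt (hx.2.trans this)
  have h2 : ∫ y in Set.Iic (-R), ker2 ε (x - y) ≤ (R + x)⁻¹ := by
    rw [← integral_comp_neg_Ioi R (fun y => ker2 ε (x - y))]
    obtain ⟨a, b⟩ := integral_Ioi_inv_sq (R := R) (x := -x) (by linarith [hx.1])
    have e : R - -x = R + x := by ring
    rw [e] at b
    rw [← b]
    refine setIntegral_mono_on hInt.comp_neg.integrableOn a measurableSet_Ioi fun y hy => ?_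
    have hy' : R < y := hy
    refine (hle (-y) (ne_of_lt (by linarith [hx.1]))).trans (le_of_eq ?_)
    congr 1
    ring
  have hsub : (Set.Icc (-R) R)ᶜ ⊆ Set.Ioi R ∪ Set.Iic (-R) := by
    intro y hy
    by_contra hc
    simp only [Set.mem_union, Set.mem_Ioi, Set.mem_Iic, not_or, not_lt, not_le] at hc
    exact hy ⟨hc.2.le, hc.1⟩
  have hdis : Disjoint (Set.Ioi R) (Set.Iic (-R)) := by
    rw [Set.disjoint_left]
    intro y h3 h4
    simp only [Set.mem_Ioi, Set.mem_Iic] at h3 h4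
    linarith
  calc _ ≤ ∫ y in Set.Ioi R ∪ Set.Iic (-R), ker2 ε (x - y) :=
        setIntegral_mono_set hInt.integrableOn
          (Eventually.of_forall fun y => ker2_nonneg _ _) (LE.le.eventuallyLE hsub)
    _ = _ := setIntegral_union hdis measurableSet_Iic hInt.integrableOn hInt.integrableOn
    _ ≤ _ := add_le_add h1 h2

theorem chi_mul_le {R x : ℝ} (hR : 0 < R) (hx : x ∈ Set.Ioo (-R) R) :
    chi R x * ((R - x)⁻¹ + (R + x)⁻¹) ≤ 2 / R * (1 + x ^ 2)⁻¹ := by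
  have h1 : 0 < R - x := by linarith [hx.2]
  have h2 : 0 < R + x := by linarith [hx.1]
  have e : chi R x * ((R - x)⁻¹ + (R + x)⁻¹) = 2 * R / (1 + R ^ 2) * (1 + x ^ 2)⁻¹ := by
    unfold chi
    field_simp
    ring
  rw [e]
  refine mul_le_mul_of_nonneg_right ?_ (by positivity)
  rw [div_le_div_iff₀ (by positivity) hR]
  nlinarith

theorem abs_outer_le {R ε x D : ℝ} (hR : 0 < R) (hε : 0 < ε) (hx : x ∈ Set.Ioo (-R) R)
    {γ : ℝ → ℝ} (hγ : ∀ y, |γ y| ≤ D) :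
    |∫ y in (Set.Icc (-R) R)ᶜ, ker2 ε (x - y) * (chi R x * γ y)| ≤
      D * (2 / R * (1 + x ^ 2)⁻¹) := by
  have hD : 0 ≤ D := (abs_nonneg _).trans (hγ 0)
  have hc : 0 ≤ chi R x := chi_nonneg (Set.Ioo_subset_Icc_self hx)
  have hInt : Integrable fun y => ker2 ε (x - y) := by
    unfold ker2
    have := integrable_inv_sq_add_sq ε x hε
    refine this.congr (Eventually.of_forall fun y => ?_)
    simp only
    congr 2
    ring
  have h : ‖∫ y in (Set.Icc (-R) R)ᶜ, ker2 ε (x - y) * (chi R x * γ y)‖ ≤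
      ∫ y in (Set.Icc (-R) R)ᶜ, ker2 ε (x - y) * (chi R x * D) := by
    refine norm_integral_le_of_norm_le (hInt.integrableOn.mul_const _)
      (Eventually.of_forall fun y => ?_)
    rw [norm_mul, norm_mul, Real.norm_eq_abs, Real.norm_eq_abs, Real.norm_eq_abs,
      abs_of_nonneg (ker2_nonneg _ _), abs_of_nonneg hc]
    exact mul_le_mul_of_nonneg_left (mul_le_mul_of_nonneg_left (hγ y) hc) (ker2_nonneg _ _)
  refine h.trans ?_
  rw [integral_mul_const]
  calc _ ≤ ((R - x)⁻¹ + (R + x)⁻¹) * (chi R x * D) :=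
        mul_le_mul_of_nonneg_right (integral_compl_ker2_le hR hε hx) (by positivity)
    _ = D * (chi R x * ((R - x)⁻¹ + (R + x)⁻¹)) := by ring
    _ ≤ _ := mul_le_mul_of_nonneg_left (chi_mul_le hR hx) hD

theorem abs_inner_le {R ε C : ℝ} (hε : 0 < ε) {v w : ℝ → V3} (hv : Continuous v)
    (hw : Continuous w)
    (hC : ∀ i, ∀ f g : ℝ → ℂ, Continuous f → Continuous g →
      ‖commForm R ε (fun x => ((chi R x * v x i : ℝ) : ℂ)) f g‖ ≤ C * (wnorm R f + wnorm R g)) :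
    |∫ p : ℝ × ℝ, ker2 ε (p.1 - p.2) * (chi R p.1 * det3 (v p.1) (w p.1) (w p.2))
      ∂((muR R).prod (muR R))| ≤ 2 * C * ∑ i, wnorm R (fun x => (w x i : ℂ)) := by
  have hk := continuous_ker2 hε
  have hχ := continuous_chi R
  have hvi : ∀ i, Continuous fun x => v x i := fun i => (continuous_apply i).comp hv
  have hwi : ∀ i, Continuous fun x => w x i := fun i => (continuous_apply i).comp hw
  set H : ℝ × ℝ → ℝ := fun p =>
    ker2 ε (p.1 - p.2) * (chi R p.1 * det3 (v p.1) (w p.1) (w p.2)) with hH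
  have hHc : Continuous H := by
    simp only [hH, det3]
    fun_prop
  set I := ∫ p, H p ∂((muR R).prod (muR R)) with hI
  have hsw : I = ∫ p : ℝ × ℝ, H p.swap ∂((muR R).prod (muR R)) :=
    (integral_prod_swap (μ := muR R) (ν := muR R) H).symm
  have hcx : ∀ i, Continuous fun x => (w x i : ℂ) := fun i => by
    have := hwi i
    fun_prop
  set cf : Fin 3 → Fin 3 → Fin 3 → ℂ := fun i j k =>
    commForm R ε (fun x => ((chi R x * v x i : ℝ) : ℂ)) (fun x => (w x j : ℂ))
      (fun x => (w x k : ℂ)) with hcf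
  have hφ : ∀ i, Continuous fun x => ((chi R x * v x i : ℝ) : ℂ) := fun i => by
    have := hvi i
    fun_prop
  set K : Fin 3 → Fin 3 → Fin 3 → ℝ × ℝ → ℝ := fun i j k p => ker2 ε (p.1 - p.2) *
      ((chi R p.1 * v p.1 i - chi R p.2 * v p.2 i) * (w p.1 j * w p.2 k)) with hK
  have hcfI : ∀ i j k, cf i j k = ((∫ p, K i j k p ∂((muR R).prod (muR R)) : ℝ) : ℂ) := by
    intro i j k
    simp only [hcf, commForm, hK]
    rw [← integral_complex_ofReal]
    refine integral_congr_ae (Eventually.of_forall fun p => ?_)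
    push_cast
    ring
  have hInt : ∀ i j k, Integrable (fun p => K i j k p) ((muR R).prod (muR R)) := by
    intro i j k
    simp only [hK]
    have := hvi i
    have := hwi j
    have := hwi k
    exact integrable_muR_prod (by fun_prop) R
  have hd : ∀ i j k l m n, Integrable (fun p => K i j k p - K l m n p)
      ((muR R).prod (muR R)) := fun i j k l m n => (hInt _ _ _).sub (hInt _ _ _)
  have hdd : Integrable (fun p => K 0 1 2 p - K 0 2 1 p + (K 1 2 0 p - K 1 0 2 p))
      ((muR R).prod (muR R)) := (hd _ _ _ _ _ _).add (hd _ _ _ _ _ _)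
  have h2 : ((2 * I : ℝ) : ℂ) = cf 0 1 2 - cf 0 2 1 + (cf 1 2 0 - cf 1 0 2) +
      (cf 2 0 1 - cf 2 1 0) := by
    simp only [hcfI]
    rw [two_mul]
    nth_rewrite 2 [hsw]
    have hHs : Integrable (fun p : ℝ × ℝ => H p.swap) ((muR R).prod (muR R)) :=
      integrable_muR_prod (hHc.comp continuous_swap) R
    rw [hI, ← integral_add (integrable_muR_prod hHc R) hHs]
    simp only [← Complex.ofReal_sub, ← Complex.ofReal_add]
    rw [← integral_sub (hInt _ _ _) (hInt _ _ _), ← integral_sub (hInt _ _ _) (hInt _ _ _),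
      ← integral_sub (hInt _ _ _) (hInt _ _ _),
      ← integral_add (hd _ _ _ _ _ _) (hd _ _ _ _ _ _),
      ← integral_add hdd (hd _ _ _ _ _ _)]
    congr 2
    ext p
    have hs : ker2 ε (p.2 - p.1) = ker2 ε (p.1 - p.2) := by
      unfold ker2
      congr 1
      ring
    simp only [hH, Prod.fst_swap, Prod.snd_swap, hs, det3, hK]
    ring
  have hb : ∀ i j k, ‖cf i j k‖ ≤ C * (wnorm R (fun x => (w x j : ℂ)) +
      wnorm R (fun x => (w x k : ℂ))) := fun i j k => hC i _ _ (hcx j) (hcx k)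
  have h3 : |2 * I| ≤ ‖cf 0 1 2‖ + ‖cf 0 2 1‖ + (‖cf 1 2 0‖ + ‖cf 1 0 2‖) +
      (‖cf 2 0 1‖ + ‖cf 2 1 0‖) := by
    rw [← Real.norm_eq_abs, ← Complex.norm_real, h2]
    refine (norm_add_le _ _).trans (add_le_add ((norm_add_le _ _).trans
      (add_le_add (norm_sub_le _ _) (norm_sub_le _ _))) (norm_sub_le _ _))
  rw [abs_mul, abs_two] at h3
  rw [Fin.sum_univ_three]
  linarith [hb 0 1 2, hb 0 2 1, hb 1 2 0, hb 1 0 2, hb 2 0 1, hb 2 1 0]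

theorem integral_weight_muR_le (R : ℝ) : ∫ x, (1 + x ^ 2)⁻¹ ∂(muR R) ≤ Real.pi := by
  rw [← integral_univ_inv_one_add_sq]
  exact integral_mono_measure (muR_le R) (Eventually.of_forall fun x => by
    simp only [Pi.zero_apply]; positivity) integrable_inv_one_add_sq

theorem ae_muR_Ioo (R : ℝ) : ∀ᵐ x ∂(muR R), x ∈ Set.Ioo (-R) R := by
  have h : (muR R) = volume.restrict (Set.Ioo (-R) R) := by
    unfold muR
    exact (Measure.restrict_congr_set Ioo_ae_eq_Icc).symm
  rw [h]
  exact ae_restrict_mem measurableSet_Ioo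

section

variable {R C : ℝ} {v w : ℝ → V3}

theorem norm_le_of_abs_le {e : V3} {D : ℝ} (h : ∀ i, |e i| ≤ D) : ‖e‖ ≤ D :=
  (pi_norm_le_iff_of_nonneg ((abs_nonneg _).trans (h 0))).2 h

theorem det3_approx {ε x : ℝ} (hε : 0 < ε) (hw : Continuous w) (hw2 : ∀ x i, |w x i| ≤ 2) :
    chi R x * det3 (v x) (w x) (∫ y, ker2 ε (x - y) • (w x - w y)) =
      -(∫ y, ker2 ε (x - y) * (chi R x * det3 (v x) (w x) (w y)) ∂(muR R)) -
      ∫ y in (Set.Icc (-R) R)ᶜ, ker2 ε (x - y) * (chi R x * det3 (v x) (w x) (w y)) := by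
  have hK : Integrable fun y => ker2 ε (x - y) := by
    have := (approxKernel_ker2.integrable ε hε).comp_sub_left x
    exact this
  have hb : ∀ y, ‖w x - w y‖ ≤ 4 := fun y => by
    refine (norm_sub_le _ _).trans ?_
    linarith [norm_le_of_abs_le (hw2 x), norm_le_of_abs_le (hw2 y)]
  have hI : Integrable fun y => ker2 ε (x - y) • (w x - w y) :=
    hK.smul_bdd 4 (Continuous.aestronglyMeasurable (by fun_prop)) (Eventually.of_forall hb)
  rw [← det3CLM_apply, ← ContinuousLinearMap.integral_comp_comm _ hI, ← integral_const_mul]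
  have e : ∀ y, chi R x * (det3CLM (v x) (w x)) (ker2 ε (x - y) • (w x - w y)) =
      -(ker2 ε (x - y) * (chi R x * det3 (v x) (w x) (w y))) := by
    intro y
    simp only [det3CLM_apply, det3, Pi.smul_apply, Pi.sub_apply, smul_eq_mul]
    ring
  have hI2 : Integrable fun y => ker2 ε (x - y) * (chi R x * det3 (v x) (w x) (w y)) := by
    have := ((det3CLM (v x) (w x)).integrable_comp hI).const_mul (chi R x)
    simp only [e] at this
    simpa using this.neg
  simp only [e]
  rw [integral_neg, ← integral_add_compl (measurableSet_Icc (a := -R) (b := R)) hI2, neg_add]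
  rfl

theorem abs_integral_det3_approx_le {ε : ℝ} (hR : 0 < R) (hε : 0 < ε) (hv : Continuous v)
    (hv1 : ∀ x i, |v x i| ≤ 1) (hw : Continuous w) (hw2 : ∀ x i, |w x i| ≤ 2)
    (hC : ∀ i, ∀ ε, 0 < ε → ∀ f g : ℝ → ℂ, Continuous f → Continuous g →
      ‖commForm R ε (fun x => ((chi R x * v x i : ℝ) : ℂ)) f g‖ ≤ C * (wnorm R f + wnorm R g))
    (hm : Integrable (fun x => chi R x * det3 (v x) (w x) (∫ y, ker2 ε (x - y) • (w x - w y)))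
      (muR R)) :
    |∫ x, chi R x * det3 (v x) (w x) (∫ y, ker2 ε (x - y) • (w x - w y)) ∂(muR R)| ≤
      2 * C * ∑ i, wnorm R (fun x => (w x i : ℂ)) + 48 * Real.pi / R := by
  have hk := continuous_ker2 hε
  have hχ := continuous_chi R
  have hvi : ∀ i, Continuous fun x => v x i := fun i => (continuous_apply i).comp hv
  have hwi : ∀ i, Continuous fun x => w x i := fun i => (continuous_apply i).comp hw
  have hH : Continuous fun p : ℝ × ℝ =>
      ker2 ε (p.1 - p.2) * (chi R p.1 * det3 (v p.1) (w p.1) (w p.2)) := by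
    simp only [det3]
    fun_prop
  have hin := (integrable_muR_prod hH R).integral_prod_left
  set out : ℝ → ℝ := fun x =>
    ∫ y in (Set.Icc (-R) R)ᶜ, ker2 ε (x - y) * (chi R x * det3 (v x) (w x) (w y)) with hout
  set inn : ℝ → ℝ := fun x =>
    ∫ y, ker2 ε (x - y) * (chi R x * det3 (v x) (w x) (w y)) ∂(muR R) with hinn
  have e : ∀ x, chi R x * det3 (v x) (w x) (∫ y, ker2 ε (x - y) • (w x - w y)) =
      -inn x - out x := fun x => det3_approx hε hw hw2
  simp only [e] at hm ⊢
  have hio : Integrable out (muR R) := by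
    have := (hm.add hin).neg
    refine this.congr (Eventually.of_forall fun x => ?_)
    simp only [Pi.neg_apply, Pi.add_apply, hinn]
    ring
  have hin' : Integrable (fun x => -inn x) (muR R) := hin.neg
  rw [integral_sub hin' hio, integral_neg]
  have h1 : |∫ x, inn x ∂(muR R)| ≤ 2 * C * ∑ i, wnorm R (fun x => (w x i : ℂ)) := by
    have := abs_inner_le hε hv hw (fun i => hC i ε hε)
    rwa [integral_prod _ (integrable_muR_prod hH R)] at this
  have h2 : |∫ x, out x ∂(muR R)| ≤ 48 * Real.pi / R := by
    have hc := continuous_weight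
    have : ‖∫ x, out x ∂(muR R)‖ ≤ ∫ x, 24 * (2 / R * (1 + x ^ 2)⁻¹) ∂(muR R) := by
      refine norm_integral_le_of_norm_le (integrable_muR (by fun_prop) R) ?_
      filter_upwards [ae_muR_Ioo R] with x hx
      refine abs_outer_le hR hε hx fun y => ?_
      have := abs_det3_le (hv1 x) (hw2 x) (hw2 y)
      linarith
    rw [Real.norm_eq_abs] at this
    refine this.trans ?_
    rw [integral_const_mul, integral_const_mul]
    calc _ ≤ 24 * (2 / R * Real.pi) := by
          have := integral_weight_muR_le R
          gcongr
      _ = _ := by ring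
  refine (abs_sub _ _).trans ?_
  rw [abs_neg]
  exact add_le_add h1 h2

/-- The key commutator estimate for the difference of two solutions. -/
theorem abs_integral_det3_halfLap_le (hR : 0 < R) (hv : Continuous v)
    (hv1 : ∀ x i, |v x i| ≤ 1) (hw : ContDiff ℝ 2 w) (hw2 : ∀ x i, |w x i| ≤ 2)
    (hC0 : 0 ≤ C)
    (hC : ∀ i, ∀ ε, 0 < ε → ∀ f g : ℝ → ℂ, Continuous f → Continuous g →
      ‖commForm R ε (fun x => ((chi R x * v x i : ℝ) : ℂ)) f g‖ ≤ C * (wnorm R f + wnorm R g)) :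
    |∫ x, chi R x * det3 (v x) (w x) (halfLap w x) ∂(muR R)| ≤
      2 * C * ∑ i, wnorm R (fun x => (w x i : ℂ)) + 48 / R := by
  have hwb : ∀ x, ‖w x‖ ≤ 2 := fun x => norm_le_of_abs_le (hw2 x)
  set S : ℝ → ℝ → V3 := fun ε x => ∫ y, ker2 ε (x - y) • (w x - w y) with hS
  obtain ⟨B, hB0, hB⟩ := approxKernel_ker2.exists_bound hw hwb R
  have hχ := continuous_chi R
  have hvi : ∀ i, Continuous fun x => v x i := fun i => (continuous_apply i).comp hv
  have hwi : ∀ i, Continuous fun x => w x i := fun i => (continuous_apply i).comp hw.continuous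
  obtain ⟨D, hD0, hD⟩ := exists_bound_muR hχ R
  have hmeas : ∀ ε, 0 < ε → AEStronglyMeasurable
      (fun x => chi R x * det3 (v x) (w x) (S ε x)) (muR R) := by
    intro ε hε
    have hk := continuous_ker2 hε
    have h1 : StronglyMeasurable (S ε) := by
      have : Continuous fun p : ℝ × ℝ => ker2 ε (p.1 - p.2) • (w p.1 - w p.2) := by
        have := hw.continuous
        fun_prop
      exact this.stronglyMeasurable.integral_prod_right'
    have h2 : ∀ i, Measurable fun x => S ε x i := fun i =>
      (measurable_pi_apply i).comp h1.measurable
    have h3 : ∀ i, Measurable fun x => v x i := fun i => (hvi i).measurable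
    have h4 : ∀ i, Measurable fun x => w x i := fun i => (hwi i).measurable
    have h5 := hχ.measurable
    refine Measurable.aestronglyMeasurable ?_
    simp only [det3]
    fun_prop
  have hbound : ∀ ε, 0 < ε → ∀ᵐ x ∂(muR R),
      ‖chi R x * det3 (v x) (w x) (S ε x)‖ ≤ D * (6 * (1 * 2 * B)) := by
    intro ε hε
    filter_upwards [ae_muR R] with x hx
    rw [norm_mul]
    refine mul_le_mul (hD x hx) (abs_det3_le (hv1 x) (hw2 x) fun i => ?_) (norm_nonneg _) hD0
    exact (norm_le_pi_norm (S ε x) i).trans (hB ε hε x hx)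
  have hlim : Tendsto (fun ε => ∫ x, chi R x * det3 (v x) (w x) (S ε x) ∂(muR R)) (𝓝[>] 0)
      (𝓝 (∫ x, Real.pi * (chi R x * det3 (v x) (w x) (halfLap w x)) ∂(muR R))) := by
    refine tendsto_integral_filter_of_dominated_convergence (fun _ => D * (6 * (1 * 2 * B)))
      ?_ ?_ (integrable_const _) (Eventually.of_forall fun x => ?_)
    · filter_upwards [self_mem_nhdsWithin] with ε hε using hmeas ε hε
    · filter_upwards [self_mem_nhdsWithin] with ε hε using hbound ε hε
    · have h1 := approxKernel_ker2.tendsto_integral hw hwb x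
      have h2 := (((det3CLM (v x) (w x)).continuous.tendsto _).comp h1).const_mul (chi R x)
      have e : Real.pi * (chi R x * det3 (v x) (w x) (halfLap w x)) = chi R x *
          det3CLM (v x) (w x) (∫ s in Set.Ioi (0 : ℝ), (s ^ 2)⁻¹ • symDiff2 w x s) := by
        simp only [halfLap, ← det3CLM_apply, map_smul, smul_eq_mul]
        have := Real.pi_ne_zero
        field_simp
      rw [e]
      exact h2
  have hle := le_of_tendsto hlim.abs (by
    filter_upwards [self_mem_nhdsWithin] with ε hε
    exact abs_integral_det3_approx_le hR hε hv hv1 hw.continuous hw2 hC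
      ((integrable_const (D * (6 * (1 * 2 * B)))).mono' (hmeas ε hε) (hbound ε hε)))
  rw [integral_const_mul, abs_mul, abs_of_pos Real.pi_pos] at hle
  have hN : 0 ≤ ∑ i, wnorm R (fun x => (w x i : ℂ)) :=
    Finset.sum_nonneg fun i _ => wnorm_nonneg _ _
  have hp := Real.pi_gt_three
  have h1 : 0 ≤ 2 * C * ∑ i, wnorm R (fun x => (w x i : ℂ)) := by positivity
  refine le_of_mul_le_mul_left (hle.trans ?_) Real.pi_pos
  rw [mul_add]
  refine add_le_add (by nlinarith) (le_of_eq (by ring))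

end

theorem hasDerivAt_integral_muR {a b t R : ℝ} (ht : t ∈ Set.Ioo a b) {F F' : ℝ → ℝ → ℝ}
    (hF : ∀ t ∈ Set.Ioo a b, Continuous (F t))
    (hd : ∀ t ∈ Set.Ioo a b, ∀ x, HasDerivAt (fun s => F s x) (F' t x) t)
    (hc : ContinuousOn (Function.uncurry F') (Set.Ioo a b ×ˢ Set.univ))
    {χ : ℝ → ℝ} (hχ : Continuous χ) :
    HasDerivAt (fun s => ∫ x, χ x * F s x ∂(muR R)) (∫ x, χ x * F' t x ∂(muR R)) t := by
  obtain ⟨η, hη, hball⟩ := Metric.isOpen_iff.1 isOpen_Ioo t ht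
  have hsub : Metric.closedBall t (η / 2) ⊆ Set.Ioo a b :=
    (Metric.closedBall_subset_ball (by linarith)).trans hball
  obtain ⟨B, hB⟩ := ((isCompact_closedBall t (η / 2)).prod
    (isCompact_Icc (a := -R) (b := R))).exists_bound_of_continuousOn
    (hc.mono (Set.prod_mono hsub (Set.subset_univ _)))
  obtain ⟨D, hD0, hD⟩ := exists_bound_muR hχ R
  have hF't : ∀ s ∈ Set.Ioo a b, Continuous (F' s) := fun s hs => by
    rw [← continuousOn_univ]
    exact hc.comp (f := fun x => (s, x)) (by fun_prop) fun x _ => ⟨hs, trivial⟩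
  refine (hasDerivAt_integral_of_dominated_loc_of_deriv_le (F := fun s x => χ x * F s x)
    (F' := fun s x => χ x * F' s x) (bound := fun _ => D * B)
    (Metric.ball_mem_nhds t (half_pos hη)) ?_ ?_ ?_ ?_ (integrable_const _) ?_).2
  · filter_upwards [isOpen_Ioo.mem_nhds ht] with s hs
    exact (hχ.mul (hF s hs)).aestronglyMeasurable
  · exact integrable_muR (hχ.mul (hF t ht)) R
  · exact (hχ.mul (hF't t ht)).aestronglyMeasurable
  · filter_upwards [ae_muR R] with x hx s hs
    rw [norm_mul]
    exact mul_le_mul (hD x hx) (hB (s, x) ⟨Metric.ball_subset_closedBall hs, hx⟩)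
      (norm_nonneg _) hD0
  · refine Eventually.of_forall fun x s hs => ?_
    exact (hd s (hsub (Metric.ball_subset_closedBall hs)) x).const_mul _

/-- Euclidean inner product on `V3`. -/
def dot3 (a b : V3) : ℝ := a 0 * b 0 + a 1 * b 1 + a 2 * b 2

theorem abs_le_one_of_dot3 {a : V3} (h : dot3 a a = 1) (i : Fin 3) : |a i| ≤ 1 := by
  rw [← sq_le_one_iff_abs_le_one]
  unfold dot3 at h
  fin_cases i
  · change a 0 ^ 2 ≤ 1
    nlinarith [sq_nonneg (a 1), sq_nonneg (a 2)]
  · change a 1 ^ 2 ≤ 1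
    nlinarith [sq_nonneg (a 0), sq_nonneg (a 2)]
  · change a 2 ^ 2 ≤ 1
    nlinarith [sq_nonneg (a 0), sq_nonneg (a 1)]

theorem dot3_sub_self {a b : V3} (ha : dot3 a a = 1) (hb : dot3 b b = 1) :
    (a 0 - b 0) ^ 2 + (a 1 - b 1) ^ 2 + (a 2 - b 2) ^ 2 = 2 * (1 - dot3 a b) := by
  unfold dot3 at *
  linarith

theorem eq_of_dot3_eq_one {a b : V3} (ha : dot3 a a = 1) (hb : dot3 b b = 1)
    (h : 1 - dot3 a b = 0) : a = b := by
  have := dot3_sub_self ha hb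
  rw [h] at this
  have h0 : (a 0 - b 0) ^ 2 = 0 := by
    nlinarith [sq_nonneg (a 0 - b 0), sq_nonneg (a 1 - b 1), sq_nonneg (a 2 - b 2)]
  have h1 : (a 1 - b 1) ^ 2 = 0 := by
    nlinarith [sq_nonneg (a 0 - b 0), sq_nonneg (a 1 - b 1), sq_nonneg (a 2 - b 2)]
  have h2 : (a 2 - b 2) ^ 2 = 0 := by
    nlinarith [sq_nonneg (a 0 - b 0), sq_nonneg (a 1 - b 1), sq_nonneg (a 2 - b 2)]
  ext i
  fin_cases i
  · exact sub_eq_zero.1 (pow_eq_zero_iff two_ne_zero |>.1 h0)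
  · exact sub_eq_zero.1 (pow_eq_zero_iff two_ne_zero |>.1 h1)
  · exact sub_eq_zero.1 (pow_eq_zero_iff two_ne_zero |>.1 h2)

theorem cross3_dot3 (u v a b : V3) :
    dot3 (cross3 u a) v + dot3 u (cross3 v b) = det3 v (u - v) (a - b) := by
  simp only [dot3, cross3, cross_apply, det3, Pi.sub_apply, Matrix.cons_val_zero,
    Matrix.cons_val_one, Matrix.cons_val]
  ring

theorem integral_weight_le {R : ℝ} (hR : 0 < R) {F : ℝ → ℝ} (hF : Continuous F)
    (h2 : ∀ x, F x ≤ 2) :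
    ∫ x, (1 + x ^ 2)⁻¹ * F x ∂(muR R) ≤ (∫ x, chi R x * F x ∂(muR R)) + 4 / R := by
  have hw := continuous_weight
  have hχ := continuous_chi R
  have e : ∀ x, (1 + x ^ 2)⁻¹ * F x = chi R x * F x + (1 + R ^ 2)⁻¹ * F x := fun x => by
    unfold chi; ring
  simp only [e]
  rw [integral_add (integrable_muR (by fun_prop) R) (integrable_muR (by fun_prop) R)]
  refine add_le_add le_rfl ?_
  rw [integral_const_mul]
  have h3 : ∫ x, F x ∂(muR R) ≤ ∫ _, 2 ∂(muR R) :=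
    integral_mono (integrable_muR hF R) (integrable_const _) h2
  have h4 : ∫ _, (2 : ℝ) ∂(muR R) = 4 * R := by
    rw [integral_const, muR, Measure.real, Measure.restrict_apply_univ, Real.volume_Icc,
      ENNReal.toReal_ofReal (by linarith), smul_eq_mul]
    ring
  rw [h4] at h3
  calc _ ≤ (1 + R ^ 2)⁻¹ * (4 * R) := by gcongr
    _ ≤ _ := by
      rw [inv_mul_eq_div, div_le_div_iff₀ (by positivity) hR]
      nlinarith

theorem halfwave_unique {a b t₀ : ℝ} (ht₀ : t₀ ∈ Set.Ioo a b) {u v du dv : ℝ → ℝ → V3}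
    (hu : ∀ t ∈ Set.Ioo a b, ∀ x, HasDerivAt (fun s => u s x) (du t x) t)
    (hv : ∀ t ∈ Set.Ioo a b, ∀ x, HasDerivAt (fun s => v s x) (dv t x) t)
    (cu : ContinuousOn (Function.uncurry u) (Set.Ioo a b ×ˢ Set.univ))
    (cv : ContinuousOn (Function.uncurry v) (Set.Ioo a b ×ˢ Set.univ))
    (cdu : ContinuousOn (Function.uncurry du) (Set.Ioo a b ×ˢ Set.univ))
    (cdv : ContinuousOn (Function.uncurry dv) (Set.Ioo a b ×ˢ Set.univ))
    (hueq : ∀ t ∈ Set.Ico t₀ b, ∀ x, du t x = cross3 (u t x) (halfLap (u t) x))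
    (hveq : ∀ t ∈ Set.Ico t₀ b, ∀ x, dv t x = cross3 (v t x) (halfLap (v t) x))
    (us : ∀ t ∈ Set.Ioo a b, ∀ x, dot3 (u t x) (u t x) = 1)
    (vs : ∀ t ∈ Set.Ioo a b, ∀ x, dot3 (v t x) (v t x) = 1)
    (u2 : ∀ t ∈ Set.Ioo a b, ContDiff ℝ 2 (u t)) (v2 : ∀ t ∈ Set.Ioo a b, ContDiff ℝ 2 (v t))
    {C : ℝ} (hC0 : 0 ≤ C)
    (hC : ∀ t ∈ Set.Ioo a b, ∀ R, 0 < R → ∀ i, ∀ ε, 0 < ε → ∀ f g : ℝ → ℂ, Continuous f →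
      Continuous g → ‖commForm R ε (fun x => ((chi R x * v t x i : ℝ) : ℂ)) f g‖ ≤
        C * (wnorm R f + wnorm R g))
    (h0 : u t₀ = v t₀) : ∀ t ∈ Set.Ico t₀ b, u t = v t := by
  have hmem : ∀ t ∈ Set.Ico t₀ b, t ∈ Set.Ioo a b := fun t ht => ⟨ht₀.1.trans_le ht.1, ht.2⟩
  set F : ℝ → ℝ → ℝ := fun t x => 1 - dot3 (u t x) (v t x) with hFdef
  set F' : ℝ → ℝ → ℝ := fun t x =>
    -(dot3 (du t x) (v t x) + dot3 (u t x) (dv t x)) with hF'def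
  have hFc : ∀ t ∈ Set.Ioo a b, Continuous (F t) := fun t ht => by
    have := (u2 t ht).continuous
    have := (v2 t ht).continuous
    simp only [hFdef, dot3]
    fun_prop
  have hFsq : ∀ t ∈ Set.Ioo a b, ∀ x, (u t x 0 - v t x 0) ^ 2 + (u t x 1 - v t x 1) ^ 2 +
      (u t x 2 - v t x 2) ^ 2 = 2 * F t x := fun t ht x => dot3_sub_self (us t ht x) (vs t ht x)
  have hF0 : ∀ t ∈ Set.Ioo a b, ∀ x, 0 ≤ F t x := fun t ht x => by
    have := hFsq t ht x
    nlinarith [sq_nonneg (u t x 0 - v t x 0), sq_nonneg (u t x 1 - v t x 1),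
      sq_nonneg (u t x 2 - v t x 2)]
  have hF2 : ∀ t ∈ Set.Ioo a b, ∀ x, F t x ≤ 2 := fun t ht x => by
    have h1 := us t ht x
    have h2 := vs t ht x
    simp only [hFdef, dot3] at *
    nlinarith [sq_nonneg (u t x 0 + v t x 0), sq_nonneg (u t x 1 + v t x 1),
      sq_nonneg (u t x 2 + v t x 2)]
  have hFd : ∀ t ∈ Set.Ioo a b, ∀ x, HasDerivAt (fun s => F s x) (F' t x) t := by
    intro t ht x
    have d1 := fun i => hasDerivAt_pi.1 (hu t ht x) i
    have d2 := fun i => hasDerivAt_pi.1 (hv t ht x) i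
    have := ((((d1 0).mul (d2 0)).add ((d1 1).mul (d2 1))).add ((d1 2).mul (d2 2))).const_sub 1
    refine HasDerivAt.congr_deriv this ?_
    simp only [hF'def, dot3]
    ring
  have hF'c : ContinuousOn (Function.uncurry F') (Set.Ioo a b ×ˢ Set.univ) := by
    have k : ∀ {h : ℝ → ℝ → V3}, ContinuousOn (Function.uncurry h) (Set.Ioo a b ×ˢ Set.univ) →
        ∀ i, ContinuousOn (fun p : ℝ × ℝ => h p.1 p.2 i) (Set.Ioo a b ×ˢ Set.univ) :=
      fun hh i => (continuous_apply i).comp_continuousOn hh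
    have k1 := k cu
    have k2 := k cv
    have k3 := k cdu
    have k4 := k cdv
    have : Function.uncurry F' = fun p : ℝ × ℝ => -(dot3 (du p.1 p.2) (v p.1 p.2) +
      dot3 (u p.1 p.2) (dv p.1 p.2)) := rfl
    rw [this]
    simp only [dot3]
    exact ((((((k3 0).mul (k2 0)).add ((k3 1).mul (k2 1))).add ((k3 2).mul (k2 2))).add
      ((((k1 0).mul (k4 0)).add ((k1 1).mul (k4 1))).add ((k1 2).mul (k4 2)))).neg)
  set En : ℝ → ℝ → ℝ := fun R t => ∫ x, chi R x * F t x ∂(muR R) with hEn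
  have hEn0 : ∀ R, ∀ t ∈ Set.Ioo a b, 0 ≤ En R t := fun R t ht => by
    refine integral_nonneg_of_ae ?_
    filter_upwards [ae_muR R] with x hx
    exact mul_nonneg (chi_nonneg hx) (hF0 t ht x)
  have hEnd : ∀ R, ∀ t ∈ Set.Ioo a b,
      HasDerivAt (En R) (∫ x, chi R x * F' t x ∂(muR R)) t := fun R t ht =>
    hasDerivAt_integral_muR ht hFc hFd hF'c (continuous_chi R)
  have hbound : ∀ R, 0 < R → ∀ t ∈ Set.Ico t₀ b, |∫ x, chi R x * F' t x ∂(muR R)| ≤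
      (4 * C + 1) * |En R t| + (16 * C + 48) / R := by
    intro R hR t ht
    have ht' := hmem t ht
    have bu : ∀ x, ‖u t x‖ ≤ 1 := fun x => norm_le_of_abs_le (abs_le_one_of_dot3 (us t ht' x))
    have bv : ∀ x, ‖v t x‖ ≤ 1 := fun x => norm_le_of_abs_le (abs_le_one_of_dot3 (vs t ht' x))
    have hw : ContDiff ℝ 2 fun x => u t x - v t x := (u2 t ht').sub (v2 t ht')
    have key := abs_integral_det3_halfLap_le hR (v2 t ht').continuous
      (fun x => abs_le_one_of_dot3 (vs t ht' x)) hw (fun x i => by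
        have h1 := abs_le.1 (abs_le_one_of_dot3 (us t ht' x) i)
        have h2 := abs_le.1 (abs_le_one_of_dot3 (vs t ht' x) i)
        rw [Pi.sub_apply, abs_le]
        constructor <;> linarith [h1.1, h1.2, h2.1, h2.2]) hC0 (hC t ht' R hR)
    have e1 : ∀ x, chi R x * F' t x = -(chi R x * det3 (v t x) (u t x - v t x)
        (halfLap (fun x => u t x - v t x) x)) := by
      intro x
      rw [halfLap_sub (u2 t ht') bu (v2 t ht') bv, ← cross3_dot3, ← hueq t ht, ← hveq t ht]
      ring
    have e2 : ∑ i, wnorm R (fun x => (((u t x - v t x) i : ℝ) : ℂ)) =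
        2 * ∫ x, (1 + x ^ 2)⁻¹ * F t x ∂(muR R) := by
      have cw := continuous_weight
      have c1 := (u2 t ht').continuous
      have c2 := (v2 t ht').continuous
      simp only [wnorm, Complex.norm_real, Real.norm_eq_abs, sq_abs, Pi.sub_apply]
      rw [Fin.sum_univ_three, ← integral_add (integrable_muR (by fun_prop) R)
        (integrable_muR (by fun_prop) R), ← integral_add (integrable_muR (by fun_prop) R)
        (integrable_muR (by fun_prop) R), ← integral_const_mul]
      congr 1
      ext x
      rw [← mul_add, ← mul_add, hFsq t ht' x]
      ring
    simp only [e1]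
    rw [integral_neg, abs_neg]
    rw [e2] at key
    refine key.trans ?_
    have h3 := integral_weight_le hR (hFc t ht') (hF2 t ht')
    rw [abs_of_nonneg (hEn0 R t ht')]
    have h4 := hEn0 R t ht'
    have h5 : (16 * C + 48) / R = 4 * C * (4 / R) + 48 / R := by ring
    rw [h5]
    have h6 := mul_le_mul_of_nonneg_left h3 (by positivity : 0 ≤ 4 * C)
    change _ ≤ 4 * C * (En R t + 4 / R) at h6
    linarith
  have hgron : ∀ t ∈ Set.Ico t₀ b, ∃ A, ∀ R, 0 < R → En R t ≤ A / R := by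
    intro t ht
    refine ⟨(16 * C + 48) / (4 * C + 1) * (Real.exp ((4 * C + 1) * (t - t₀)) - 1),
      fun R hR => ?_⟩
    have hsub : ∀ s ∈ Set.Icc t₀ t, s ∈ Set.Ico t₀ b := fun s hs => ⟨hs.1, hs.2.trans_lt ht.2⟩
    have h := norm_le_gronwallBound_of_norm_deriv_right_le (f := En R)
      (f' := fun t => ∫ x, chi R x * F' t x ∂(muR R)) (δ := 0) (K := 4 * C + 1)
      (ε := (16 * C + 48) / R) (a := t₀) (b := t)
      (fun s hs => (hEnd R s (hmem s (hsub s hs))).continuousAt.continuousWithinAt)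
      (fun s hs => (hEnd R s (hmem s (hsub s (Set.Ico_subset_Icc_self hs)))).hasDerivWithinAt)
      (by
        have : ∀ x, F t₀ x = 0 := fun x => by
          simp only [hFdef, h0]
          rw [vs t₀ ht₀ x, sub_self]
        simp [hEn, this])
      (fun s hs => hbound R hR s (hsub s (Set.Ico_subset_Icc_self hs))) t ⟨ht.1, le_rfl⟩
    rw [gronwallBound_of_K_ne_0 (by positivity)] at h
    refine (le_abs_self _).trans (h.trans (le_of_eq ?_))
    have : 4 * C + 1 ≠ 0 := by positivity
    field_simp
    ring
  intro t ht
  have ht' := hmem t ht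
  obtain ⟨A, hA⟩ := hgron t ht
  have hzero : ∀ R, 0 < R → En R t ≤ 0 := by
    intro R hR
    have hmono : ∀ R', R ≤ R' → En R t ≤ A / R' := by
      intro R' hRR
      refine le_trans ?_ (hA R' (hR.trans_le hRR))
      have hsub : Set.Icc (-R) R ⊆ Set.Icc (-R') R' := Set.Icc_subset_Icc (by linarith) hRR
      have c1 : Continuous fun x => chi R' x * F t x := (continuous_chi R').mul (hFc t ht')
      calc En R t ≤ ∫ x, chi R' x * F t x ∂(muR R) := by
            refine integral_mono (integrable_muR ((continuous_chi R).mul (hFc t ht')) R)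
              (integrable_muR c1 R) fun x => ?_
            refine mul_le_mul_of_nonneg_right ?_ (hF0 t ht' x)
            unfold chi
            have : (1 + R' ^ 2)⁻¹ ≤ (1 + R ^ 2)⁻¹ := inv_anti₀ (by positivity) (by nlinarith)
            linarith
        _ ≤ _ := by
            refine setIntegral_mono_set (integrable_muR c1 R') ?_ (LE.le.eventuallyLE hsub)
            filter_upwards [ae_restrict_mem measurableSet_Icc] with x hx
            exact mul_nonneg (chi_nonneg hx) (hF0 t ht' x)
    refine ge_of_tendsto (tendsto_const_nhds.div_atTop tendsto_id : Tendsto (fun R' => A / R')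
      atTop (𝓝 0)) ?_
    filter_upwards [eventually_ge_atTop R] with R' hR' using hmono R' hR'
  ext1 x
  refine eq_of_dot3_eq_one (us t ht' x) (vs t ht' x) ?_
  set R := |x| + 1 with hRdef
  have hR : 0 < R := by positivity
  have hx : x ∈ Set.Ioo (-R) R := abs_lt.1 (by linarith)
  have hcont : Continuous fun x => chi R x * F t x := (continuous_chi R).mul (hFc t ht')
  have hae : (fun x => chi R x * F t x) =ᵐ[muR R] 0 := by
    refine (integral_eq_zero_iff_of_nonneg_ae ?_ (integrable_muR hcont R)).1
      (le_antisymm (hzero R hR) (hEn0 R t ht'))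
    filter_upwards [ae_muR R] with x hx
    exact mul_nonneg (chi_nonneg hx) (hF0 t ht' x)
  have hae2 : (fun x => chi R x * F t x) =ᵐ[volume.restrict (Set.Ioo (-R) R)] fun _ => 0 :=
    hae.filter_mono (ae_mono (Measure.restrict_mono Set.Ioo_subset_Icc_self le_rfl))
  have := Measure.eqOn_open_of_ae_eq hae2 isOpen_Ioo hcont.continuousOn continuousOn_const hx
  simp only [mul_eq_zero] at this
  rcases this with h | h
  · exfalso
    unfold chi at h
    have h1 := inv_injective (sub_eq_zero.1 h)
    nlinarith [hx.1, hx.2]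
  · exact h

/-- Squared length of the spinor `(f, g)`. -/
def spinNorm (f g : ℂ) : ℝ := Complex.normSq f + Complex.normSq g

/-- Unnormalised Hopf map of the spinor `(f, g)`. -/
def hopf (f g : ℂ) : V3 :=
  ![2 * (f.re * g.re + f.im * g.im), 2 * (f.re * g.im - f.im * g.re),
    Complex.normSq f - Complex.normSq g]

/-- The point of the sphere represented by the spinor `(f, g)`. -/
def spinVec (f g : ℂ) : V3 := (spinNorm f g)⁻¹ • hopf f g

/-- The image in `V3` of the tangent direction encoded by `β` at the spinor `(f, g)`. -/
def spinTangent (f g : ℂ) : ℂ →ₗ[ℝ] V3 where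
  toFun β := ![(2 * (β * star f ^ 2 - star β * g ^ 2)).re / spinNorm f g ^ 2,
    (2 * (β * star f ^ 2 - star β * g ^ 2)).im / spinNorm f g ^ 2,
    -(4 * (β * star f * star g)).re / spinNorm f g ^ 2]
  map_add' a b := by
    ext i
    fin_cases i <;> simp <;> ring
  map_smul' c b := by
    ext i
    fin_cases i <;> simp <;> ring

/-- The tangent direction at the spinor `(f, g)` pointing to the spinor `(f', g')`. -/
def spinDiff (f g f' g' : ℂ) : ℂ :=
  -Complex.I * (f * g' - f' * g) * (star f' * f + star g' * g) / (spinNorm f' g' : ℂ)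

theorem spinNorm_ne_zero {f g : ℂ} (h : f ≠ 0 ∨ g ≠ 0) : spinNorm f g ≠ 0 := by
  unfold spinNorm
  have h1 := Complex.normSq_nonneg f
  have h2 := Complex.normSq_nonneg g
  rcases h with h | h
  · have := Complex.normSq_pos.2 h
    linarith
  · have := Complex.normSq_pos.2 h
    linarith

theorem dot3_spinVec {f g : ℂ} (h : spinNorm f g ≠ 0) :
    dot3 (spinVec f g) (spinVec f g) = 1 := by
  simp only [dot3, spinVec, hopf, Pi.smul_apply, smul_eq_mul, Matrix.cons_val_zero,
    Matrix.cons_val_one, Matrix.cons_val]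
  have hq : spinNorm f g = f.re * f.re + f.im * f.im + (g.re * g.re + g.im * g.im) := rfl
  generalize spinNorm f g = q at *
  simp only [Complex.normSq_apply]
  field_simp
  rw [hq]
  ring

theorem cross3_spinVec {f g f' g' : ℂ} (h : spinNorm f g ≠ 0) (h' : spinNorm f' g' ≠ 0) :
    cross3 (spinVec f g) (spinVec f g - spinVec f' g') = spinTangent f g (spinDiff f g f' g') := by
  obtain ⟨a, b⟩ := f
  obtain ⟨c, d⟩ := g
  obtain ⟨a', b'⟩ := f'
  obtain ⟨c', d'⟩ := g'
  have e : spinDiff ⟨a, b⟩ ⟨c, d⟩ ⟨a', b'⟩ ⟨c', d'⟩ = (((spinNorm ⟨a', b'⟩ ⟨c', d'⟩)⁻¹ : ℝ) : ℂ) *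
    (-Complex.I * (⟨a, b⟩ * ⟨c', d'⟩ - ⟨a', b'⟩ * ⟨c, d⟩) *
      (star ⟨a', b'⟩ * ⟨a, b⟩ + star ⟨c', d'⟩ * ⟨c, d⟩)) := by
    unfold spinDiff
    push_cast
    rw [div_eq_inv_mul]
  have hs : ∀ x y : ℝ, star (⟨x, y⟩ : ℂ) = ⟨x, -y⟩ := fun x y => rfl
  rw [e]
  ext i
  have hq : spinNorm ⟨a, b⟩ ⟨c, d⟩ = a * a + b * b + (c * c + d * d) := rfl
  have hq' : spinNorm ⟨a', b'⟩ ⟨c', d'⟩ = a' * a' + b' * b' + (c' * c' + d' * d') := rfl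
  clear e
  simp only [spinTangent, spinVec, LinearMap.coe_mk, AddHom.coe_mk]
  generalize spinNorm ⟨a, b⟩ ⟨c, d⟩ = q at *
  generalize spinNorm ⟨a', b'⟩ ⟨c', d'⟩ = q' at *
  fin_cases i <;>
  · simp only [cross3, cross_apply, hopf, Complex.normSq_apply,
      hs, Complex.mul_re, Complex.mul_im, Complex.sub_re,
      Complex.sub_im, Complex.add_re, Complex.add_im, Complex.neg_re, Complex.neg_im, Complex.I_re,
      Complex.I_im, Complex.ofReal_re, Complex.ofReal_im, pow_two, Pi.sub_apply, Pi.smul_apply,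
      smul_eq_mul, Matrix.cons_val_zero, Matrix.cons_val_one, Matrix.cons_val, Fin.zero_eta,
      Fin.mk_one, Fin.reduceFinMk,
      Complex.re_ofNat, Complex.im_ofNat]
    field_simp
    rw [hq]
    ring

theorem hasDerivAt_spinVec {f g : ℝ → ℂ} {f' g' : ℂ} {t : ℝ} (hf : HasDerivAt f f' t)
    (hg : HasDerivAt g g' t) (h : spinNorm (f t) (g t) ≠ 0) :
    HasDerivAt (fun s => spinVec (f s) (g s))
      (spinTangent (f t) (g t) (f t * g' - g t * f')) t := by
  have fr : HasDerivAt (fun s => (f s).re) f'.re t :=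
    Complex.reCLM.hasFDerivAt.comp_hasDerivAt t hf
  have fi : HasDerivAt (fun s => (f s).im) f'.im t :=
    Complex.imCLM.hasFDerivAt.comp_hasDerivAt t hf
  have gr : HasDerivAt (fun s => (g s).re) g'.re t :=
    Complex.reCLM.hasFDerivAt.comp_hasDerivAt t hg
  have gi : HasDerivAt (fun s => (g s).im) g'.im t :=
    Complex.imCLM.hasFDerivAt.comp_hasDerivAt t hg
  have hq : HasDerivAt (fun s => spinNorm (f s) (g s)) _ t :=
    ((fr.mul fr).add (fi.mul fi)).add ((gr.mul gr).add (gi.mul gi))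
  have hqi : HasDerivAt (fun s => (spinNorm (f s) (g s))⁻¹) _ t := hq.inv h
  have h₀ : HasDerivAt (fun s => hopf (f s) (g s) 0) _ t :=
    ((fr.mul gr).add (fi.mul gi)).const_mul 2
  have h₁ : HasDerivAt (fun s => hopf (f s) (g s) 1) _ t :=
    ((fr.mul gi).sub (fi.mul gr)).const_mul 2
  have h₂ : HasDerivAt (fun s => hopf (f s) (g s) 2) _ t :=
    ((fr.mul fr).add (fi.mul fi)).sub ((gr.mul gr).add (gi.mul gi))
  have hs : ∀ x : ℂ, star x = ⟨x.re, -x.im⟩ := fun x => rfl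
  have hQ : spinNorm (f t) (g t) =
    (f t).re * (f t).re + (f t).im * (f t).im + ((g t).re * (g t).re + (g t).im * (g t).im) := rfl
  rw [hasDerivAt_pi]
  intro i
  fin_cases i
  · refine HasDerivAt.congr_deriv (hqi.mul h₀) ?_
    simp only [spinTangent, LinearMap.coe_mk, AddHom.coe_mk]
    generalize spinNorm (f t) (g t) = q at *
    simp [hs, pow_two, hopf, Complex.normSq_apply]
    field_simp
    rw [hQ]
    ring
  · refine HasDerivAt.congr_deriv (hqi.mul h₁) ?_
    simp only [spinTangent, LinearMap.coe_mk, AddHom.coe_mk]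
    generalize spinNorm (f t) (g t) = q at *
    simp [hs, pow_two, hopf, Complex.normSq_apply]
    field_simp
    rw [hQ]
    ring
  · refine HasDerivAt.congr_deriv (hqi.mul h₂) ?_
    simp only [spinTangent, LinearMap.coe_mk, AddHom.coe_mk]
    generalize spinNorm (f t) (g t) = q at *
    simp [hs, pow_two, hopf, Complex.normSq_apply]
    field_simp
    rw [hQ]
    ring

/-- The integrand of the spinor flow. The first four variables are an evaluation point
with the values of the spinor and a derivative there, those from `ζ` on are a second
point with the same data, `A` and `B` are the conjugates of `F` and `G`, while `d` and `r` are
the inverses of `z - ζ` and of `A * F + B * G`. -/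
def flowKernel {R : Type*} [CommRing R] (n : ℕ) (z f g f' ζ F G F' G' A B d r : R) : R :=
  2 * ζ * (1 - z) ^ 2 * (f * G - F * g) * B * r * d ^ 2 - (1 - z) ^ 2 * f' * (z + ζ) * d +
    (2 * ζ * (1 - z) * (1 - ζ) * ((A * F' + B * G') * r) * d + n * z) * f

open Polynomial in
theorem natDegree_flow_numerator_le {n : ℕ} {p r : ℂ[X]} (hp : p.natDegree ≤ n)
    (hr : r.natDegree ≤ n) (ζ F G c ℓ : ℂ) :
    (C c * (1 - X) ^ 2 * (p * C G - C F * r) - (1 - X) ^ 2 * derivative p * (X ^ 2 - C (ζ ^ 2)) +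
      C ℓ * (1 - X) * (X - C ζ) * p + (n : ℂ[X]) * X * (X - C ζ) ^ 2 * p).natDegree ≤ n + 2 := by
  have hD : (X ^ 3 * ((n : ℂ[X]) * p - X * derivative p)).natDegree ≤ n + 2 := by
    rw [natDegree_le_iff_coeff_eq_zero]
    intro N hN
    obtain ⟨m, rfl⟩ : ∃ m, N = m + 3 := ⟨N - 3, by omega⟩
    have hm : n ≤ m := by omega
    rw [coeff_X_pow_mul, coeff_sub, coeff_natCast_mul]
    have : (X * derivative p).coeff m = m * p.coeff m := by
      cases m with
      | zero => simp
      | succ k =>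
        rw [coeff_X_mul, coeff_derivative]
        push_cast
        ring
    rw [this]
    rcases hm.eq_or_lt with rfl | h
    · ring
    · rw [coeff_eq_zero_of_natDegree_lt (hp.trans_lt h)]
      ring
  have hp' : X * derivative p = 0 ∨ (derivative p).natDegree + 1 ≤ n := by
    by_cases h : p.natDegree = 0
    · left
      rw [derivative_of_natDegree_zero h, mul_zero]
    · right
      have := natDegree_derivative_lt h
      omega
  have hcube : ((C (-ζ ^ 2 + 1) * X ^ 2 - 2 * X ^ 3 + C (2 * ζ ^ 2) * X - C (ζ ^ 2)) *
      derivative p).natDegree ≤ n + 2 := by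
    rcases hp' with h | h
    · rw [(mul_eq_zero.1 h).resolve_left X_ne_zero, mul_zero]
      simp
    · refine natDegree_mul_le.trans ?_
      have : (C (-ζ ^ 2 + 1) * X ^ 2 - 2 * X ^ 3 + C (2 * ζ ^ 2) * X -
        C (ζ ^ 2)).natDegree ≤ 3 := by compute_degree
      omega
  have hsq : ∀ a b c : ℂ, ∀ s : ℂ[X], s.natDegree ≤ n →
      ((C a * X ^ 2 + C b * X + C c) * s).natDegree ≤ n + 2 := fun a b c s hs => by
    refine natDegree_mul_le.trans ?_
    have : (C a * X ^ 2 + C b * X + C c).natDegree ≤ 2 := by compute_degree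
    omega
  have e : C c * (1 - X) ^ 2 * (p * C G - C F * r) -
      (1 - X) ^ 2 * derivative p * (X ^ 2 - C (ζ ^ 2)) +
      C ℓ * (1 - X) * (X - C ζ) * p + (n : ℂ[X]) * X * (X - C ζ) ^ 2 * p =
      (C (c * G) * X ^ 2 + C (-2 * c * G) * X + C (c * G)) * p +
      (C (-c * F) * X ^ 2 + C (2 * c * F) * X + C (-c * F)) * r +
      X ^ 3 * ((n : ℂ[X]) * p - X * derivative p) -
      (C (-ζ ^ 2 + 1) * X ^ 2 - 2 * X ^ 3 + C (2 * ζ ^ 2) * X - C (ζ ^ 2)) * derivative p +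
      (C (-ℓ) * X ^ 2 + C (ℓ * (1 + ζ)) * X + C (-ℓ * ζ)) * p +
      (C (-2 * n * ζ) * X ^ 2 + C (n * ζ ^ 2) * X + C 0) * p := by
    simp only [map_mul, map_neg, map_add, map_pow, map_one, map_ofNat, map_natCast, map_zero]
    ring
  rw [e]
  refine natDegree_add_le_of_degree_le (natDegree_add_le_of_degree_le ((natDegree_sub_le_of_le
    (natDegree_add_le_of_degree_le (natDegree_add_le_of_degree_le ?_ ?_) hD) hcube).trans
    (max_self _).le) ?_) ?_
  exacts [hsq _ _ _ p hp, hsq _ _ _ r hr, hsq _ _ _ p hp, hsq _ _ _ p hp]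

open Polynomial in
theorem sq_dvd_of_isRoot_derivative {N : ℂ[X]} {ζ : ℂ} (h0 : N.eval ζ = 0)
    (h1 : (derivative N).eval ζ = 0) : ∃ M, N = (X - C ζ) ^ 2 * M := by
  obtain ⟨M₁, rfl⟩ := dvd_iff_isRoot.2 h0
  simp only [derivative_mul, derivative_sub, derivative_X, derivative_C, eval_add, eval_mul,
    eval_sub, eval_X, eval_C, sub_self, zero_mul, add_zero, sub_zero, one_mul] at h1
  obtain ⟨M, rfl⟩ := dvd_iff_isRoot.2 h1
  exact ⟨M, by ring⟩

open Polynomial in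
/-- As a function of its evaluation point the flow integrand is a polynomial of degree at most
`n`, hence is recovered by Lagrange interpolation. -/
theorem sum_flowKernel_mul_basis {n : ℕ} {p r : ℂ[X]} (hp : p.natDegree ≤ n)
    (hr : r.natDegree ≤ n) {ζ A B : ℂ} (hq : A * p.eval ζ + B * r.eval ζ ≠ 0)
    {v : Fin (n + 1) → ℂ} (hv : Function.Injective v) (hvζ : ∀ i, v i ≠ ζ) {z : ℂ} (hz : z ≠ ζ) :
    ∑ i, flowKernel n (v i) (p.eval (v i)) (r.eval (v i)) ((derivative p).eval (v i)) ζ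
      (p.eval ζ) (r.eval ζ) ((derivative p).eval ζ) ((derivative r).eval ζ) A B (v i - ζ)⁻¹
      (A * p.eval ζ + B * r.eval ζ)⁻¹ * (Lagrange.basis Finset.univ v i).eval z =
    flowKernel n z (p.eval z) (r.eval z) ((derivative p).eval z) ζ
      (p.eval ζ) (r.eval ζ) ((derivative p).eval ζ) ((derivative r).eval ζ) A B (z - ζ)⁻¹
      (A * p.eval ζ + B * r.eval ζ)⁻¹ := by
  set q := A * p.eval ζ + B * r.eval ζ with hqdef
  set N : ℂ[X] := C (2 * ζ * B * q⁻¹) * (1 - X) ^ 2 * (p * C (r.eval ζ) - C (p.eval ζ) * r) -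
    (1 - X) ^ 2 * derivative p * (X ^ 2 - C (ζ ^ 2)) +
    C (2 * ζ * (1 - ζ) * ((A * (derivative p).eval ζ + B * (derivative r).eval ζ) * q⁻¹)) *
      (1 - X) * (X - C ζ) * p + (n : ℂ[X]) * X * (X - C ζ) ^ 2 * p with hN
  have hNdeg : N.natDegree ≤ n + 2 := natDegree_flow_numerator_le hp hr _ _ _ _ _
  obtain ⟨M, hM⟩ : ∃ M, N = (X - C ζ) ^ 2 * M := by
    refine sq_dvd_of_isRoot_derivative ?_ ?_
    · simp [hN]
    · simp [hN, derivative_pow]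
      field_simp
      rw [hqdef]
      ring
  have hMdeg : M.degree < (Finset.univ : Finset (Fin (n + 1))).card := by
    by_cases hM0 : M = 0
    · rw [hM0, degree_zero]
      exact WithBot.bot_lt_coe _
    rw [Finset.card_univ, Fintype.card_fin, degree_eq_natDegree hM0, Nat.cast_lt]
    have : N.natDegree = 2 + M.natDegree := by
      rw [hM, natDegree_mul (pow_ne_zero _ (X_sub_C_ne_zero ζ)) hM0, natDegree_pow,
        natDegree_X_sub_C]
    omega
  have hJ : ∀ w, w ≠ ζ → flowKernel n w (p.eval w) (r.eval w) ((derivative p).eval w) ζ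
      (p.eval ζ) (r.eval ζ) ((derivative p).eval ζ) ((derivative r).eval ζ) A B (w - ζ)⁻¹
      q⁻¹ = M.eval w := by
    intro w hw
    have hw' := sub_ne_zero.2 hw
    have h := congrArg (eval w) hM
    simp only [hN, eval_add, eval_sub, eval_mul, eval_pow, eval_X, eval_C, eval_one,
      eval_natCast] at h
    have h2 : M.eval w = ((w - ζ) ^ 2)⁻¹ * ((w - ζ) ^ 2 * M.eval w) := by
      field_simp
    rw [h2, ← h]
    unfold flowKernel
    field_simp
    ring
  rw [hJ z hz]
  conv_rhs => rw [Lagrange.eq_interpolate hv.injOn hMdeg, Lagrange.interpolate_apply,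
    eval_finsetSum]
  refine Finset.sum_congr rfl fun i _ => ?_
  rw [hJ _ (hvζ i), eval_mul, eval_C]

/-- The unit circle in the complex plane. -/
abbrev UnitCircle : Type := Metric.sphere (0 : ℂ) 1

instance : CompactSpace UnitCircle := Metric.sphere.compactSpace 0 1

/-- The Cayley transform as a map into the unit circle. -/
def cayCircle (x : ℝ) : UnitCircle := ⟨cay x, mem_sphere_zero_iff_norm.2 (norm_cay x)⟩

theorem continuous_cayCircle : Continuous cayCircle := continuous_cay.subtype_mk _

/-- The space of coefficients of polynomials of degree at most `n`. -/
abbrev Coeffs (n : ℕ) : Type := Fin (n + 1) → ℂ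

open Polynomial in
/-- The polynomial with given coefficients. -/
def polyOf (n : ℕ) : Coeffs n →ₗ[ℂ] ℂ[X] := ∑ k : Fin (n + 1), (monomial k).comp (LinearMap.proj k)

open Polynomial in
theorem polyOf_apply {n : ℕ} (a : Coeffs n) :
    polyOf n a = ∑ k : Fin (n + 1), monomial (k : ℕ) (a k) := by
  simp [polyOf]

open Polynomial in
theorem natDegree_polyOf_le {n : ℕ} (a : Coeffs n) : (polyOf n a).natDegree ≤ n := by
  rw [polyOf_apply]
  refine natDegree_sum_le_of_forall_le _ _ fun k _ => (natDegree_monomial_le _).trans ?_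
  omega

open Polynomial in
theorem polyOf_coeff {n : ℕ} {p : ℂ[X]} (hp : p.natDegree ≤ n) :
    polyOf n (fun k => p.coeff k) = p := by
  rw [polyOf_apply, Fin.sum_univ_eq_sum_range (fun k => monomial k (p.coeff k)) (n + 1)]
  exact (p.as_sum_range' (n + 1) (by omega)).symm

theorem eval_polyOf {n : ℕ} (a : Coeffs n) (z : ℂ) :
    (polyOf n a).eval z = ∑ k : Fin (n + 1), a k * z ^ (k : ℕ) := by
  rw [polyOf_apply, Polynomial.eval_finsetSum]
  simp

/-- The coordinate function on the unit circle. -/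
def circleCoord : C(UnitCircle, ℂ) := ⟨Subtype.val, continuous_subtype_val⟩

open Polynomial in
/-- Restriction of polynomials to the unit circle. -/
def onCircle (p : ℂ[X]) : C(UnitCircle, ℂ) := aeval circleCoord p

open Polynomial in
theorem onCircle_apply (p : ℂ[X]) (ζ : UnitCircle) : onCircle p ζ = p.eval (ζ : ℂ) :=
  aeval_continuousMap_apply p circleCoord ζ

/-- Interpolation nodes outside of the closed unit disc. -/
def node (n : ℕ) (i : Fin (n + 1)) : ℂ := 2 + (i : ℕ)

theorem node_injective (n : ℕ) : Function.Injective (node n) := fun i j h => by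
  unfold node at h
  exact Fin.ext (by exact_mod_cast add_left_cancel h)

theorem node_ne {n : ℕ} (i : Fin (n + 1)) {ζ : ℂ} (h : ‖ζ‖ = 1) : node n i ≠ ζ := by
  rintro rfl
  have : node n i = ((2 + (i : ℕ) : ℕ) : ℂ) := by simp [node]
  rw [this, Complex.norm_natCast] at h
  norm_cast at h
  omega

/-- The function `ζ ↦ (zᵢ - ζ)⁻¹` on the unit circle, for a node `zᵢ`. -/
def nodeInv (n : ℕ) (i : Fin (n + 1)) : C(UnitCircle, ℂ) :=
  ⟨fun ζ => (node n i - ζ)⁻¹, Continuous.inv₀ (by fun_prop) fun ζ =>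
    sub_ne_zero.2 (node_ne i (mem_sphere_zero_iff_norm.1 ζ.2))⟩

theorem integrable_comp_cayCircle (φ : C(UnitCircle, ℂ)) :
    Integrable fun y : ℝ => (1 + y ^ 2)⁻¹ • φ (cayCircle y) :=
  integrable_inv_one_add_sq.smul_bdd ‖φ‖
    (φ.continuous.comp continuous_cayCircle).aestronglyMeasurable
    (Eventually.of_forall fun _ => φ.norm_coe_le_norm _)

/-- The integral of a function on the circle against the measure `dx / (1 + x²)` on the line. -/
def lineIntegral : C(UnitCircle, ℂ) →L[ℝ] ℂ :=
  LinearMap.mkContinuous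
    { toFun := fun φ => ∫ y : ℝ, (1 + y ^ 2)⁻¹ • φ (cayCircle y)
      map_add' := fun φ ψ => by
        rw [← integral_add (integrable_comp_cayCircle φ) (integrable_comp_cayCircle ψ)]
        simp only [ContinuousMap.add_apply, smul_add]
      map_smul' := fun c φ => by
        rw [RingHom.id_apply, ← integral_smul]
        congr 1
        ext1 y
        rw [ContinuousMap.smul_apply, smul_comm] } Real.pi fun φ => by
    refine (norm_integral_le_of_norm_le (integrable_inv_one_add_sq.mul_const ‖φ‖)
      (Eventually.of_forall fun y => ?_)).trans (le_of_eq ?_)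
    · rw [norm_smul, Real.norm_eq_abs, abs_of_nonneg (by positivity)]
      exact mul_le_mul_of_nonneg_left (φ.norm_coe_le_norm _) (by positivity)
    · rw [integral_mul_const, integral_univ_inv_one_add_sq]

theorem lineIntegral_apply (φ : C(UnitCircle, ℂ)) :
    lineIntegral φ = ∫ y : ℝ, (1 + y ^ 2)⁻¹ • φ (cayCircle y) := rfl

/-- The squared length of a spinor, as a function on the circle. -/
def circleNorm {n : ℕ} (a b : Coeffs n) : C(UnitCircle, ℂ) :=
  star (onCircle (polyOf n a)) * onCircle (polyOf n a) +
    star (onCircle (polyOf n b)) * onCircle (polyOf n b)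

theorem isUnit_circleNorm {n : ℕ} {a b : Coeffs n}
    (h : ∀ ζ : ℂ, ‖ζ‖ = 1 → spinNorm ((polyOf n a).eval ζ) ((polyOf n b).eval ζ) ≠ 0) :
    IsUnit (circleNorm a b) := by
  rw [ContinuousMap.isUnit_iff_forall_ne_zero]
  intro ζ
  have := h ζ (mem_sphere_zero_iff_norm.1 ζ.2)
  simp only [circleNorm, ContinuousMap.add_apply, ContinuousMap.mul_apply,
    ContinuousMap.star_apply, onCircle_apply, Complex.star_def,
    ← Complex.normSq_eq_conj_mul_self]
  exact_mod_cast this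

/-- The flow integrand at a node, as a function on the circle. -/
def nodeKernel {n : ℕ} (i : Fin (n + 1)) (a b : Coeffs n) : C(UnitCircle, ℂ) :=
  flowKernel n (algebraMap ℂ _ (node n i)) (algebraMap ℂ _ ((polyOf n a).eval (node n i)))
    (algebraMap ℂ _ ((polyOf n b).eval (node n i)))
    (algebraMap ℂ _ ((polyOf n a).derivative.eval (node n i))) circleCoord
    (onCircle (polyOf n a)) (onCircle (polyOf n b)) (onCircle (polyOf n a).derivative)
    (onCircle (polyOf n b).derivative) (star (onCircle (polyOf n a)))
    (star (onCircle (polyOf n b))) (nodeInv n i) (Ring.inverse (circleNorm a b))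

/-- One component of the spinor flow. -/
def spinFieldAux {n : ℕ} (a b : Coeffs n) : Coeffs n := fun k =>
  ∑ i, Complex.I / (2 * Real.pi) * lineIntegral (nodeKernel i a b) *
    (Lagrange.basis Finset.univ (node n) i).coeff k

/-- The vector field on coefficients that generates the flow of rational solutions. -/
def spinField (n : ℕ) (c : Coeffs n × Coeffs n) : Coeffs n × Coeffs n :=
  (spinFieldAux c.1 c.2, spinFieldAux c.2 c.1)

theorem ContDiffAt.flowKernel {R E : Type*} [NormedCommRing R] [NormedAlgebra ℝ R]
    [NormedAddCommGroup E] [NormedSpace ℝ E] {c : E} {n : ℕ} {z ζ d : R}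
    {f g f' F G F' G' A B r : E → R} (hf : ContDiffAt ℝ 1 f c) (hg : ContDiffAt ℝ 1 g c)
    (hf' : ContDiffAt ℝ 1 f' c) (hF : ContDiffAt ℝ 1 F c) (hG : ContDiffAt ℝ 1 G c)
    (hF' : ContDiffAt ℝ 1 F' c) (hG' : ContDiffAt ℝ 1 G' c) (hA : ContDiffAt ℝ 1 A c)
    (hB : ContDiffAt ℝ 1 B c) (hr : ContDiffAt ℝ 1 r c) :
    ContDiffAt ℝ 1 (fun x => _root_.flowKernel n z (f x) (g x) (f' x) ζ (F x) (G x) (F' x) (G' x)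
      (A x) (B x) d (r x)) c := by
  unfold _root_.flowKernel
  fun_prop

theorem contDiff_of_linear {E F : Type*} [NormedAddCommGroup E] [NormedSpace ℝ E]
    [FiniteDimensional ℝ E] [NormedAddCommGroup F] [NormedSpace ℝ F] (L : E →ₗ[ℝ] F) :
    ContDiff ℝ 1 fun x => L x :=
  (LinearMap.toContinuousLinearMap L).contDiff

theorem contDiff_onCircle {n : ℕ} (L : Polynomial ℂ →ₗ[ℂ] Polynomial ℂ) :
    ContDiff ℝ 1 fun a : Coeffs n => onCircle (L (polyOf n a)) :=
  contDiff_of_linear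
    (((Polynomial.aeval circleCoord).toLinearMap.comp (L.comp (polyOf n))).restrictScalars ℝ)

theorem contDiff_algebraMap_eval {n : ℕ} (L : Polynomial ℂ →ₗ[ℂ] Polynomial ℂ) (z : ℂ) :
    ContDiff ℝ 1 fun a : Coeffs n => algebraMap ℂ C(UnitCircle, ℂ) ((L (polyOf n a)).eval z) :=
  contDiff_of_linear (((Algebra.linearMap ℂ C(UnitCircle, ℂ)).comp
    ((Polynomial.leval z).comp (L.comp (polyOf n)))).restrictScalars ℝ)

theorem contDiffAt_spinField {n : ℕ} {c : Coeffs n × Coeffs n}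
    (hc : ∀ ζ : ℂ, ‖ζ‖ = 1 → spinNorm ((polyOf n c.1).eval ζ) ((polyOf n c.2).eval ζ) ≠ 0) :
    ContDiffAt ℝ 1 (spinField n) c := by
  have ev : ∀ (L : Polynomial ℂ →ₗ[ℂ] Polynomial ℂ) z,
      ContDiff ℝ 1 (fun c : Coeffs n × Coeffs n => algebraMap ℂ C(UnitCircle, ℂ)
        ((L (polyOf n c.1)).eval z)) ∧
      ContDiff ℝ 1 (fun c : Coeffs n × Coeffs n => algebraMap ℂ C(UnitCircle, ℂ)
        ((L (polyOf n c.2)).eval z)) := fun L z =>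
    ⟨(contDiff_algebraMap_eval L z).comp contDiff_fst,
      (contDiff_algebraMap_eval L z).comp contDiff_snd⟩
  have oc : ∀ (L : Polynomial ℂ →ₗ[ℂ] Polynomial ℂ),
      ContDiff ℝ 1 (fun c : Coeffs n × Coeffs n => onCircle (L (polyOf n c.1))) ∧
      ContDiff ℝ 1 (fun c : Coeffs n × Coeffs n => onCircle (L (polyOf n c.2))) := fun L =>
    ⟨(contDiff_onCircle L).comp contDiff_fst, (contDiff_onCircle L).comp contDiff_snd⟩
  have st : ∀ {h : Coeffs n × Coeffs n → C(UnitCircle, ℂ)}, ContDiff ℝ 1 h →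
      ContDiff ℝ 1 fun c => star (h c) := fun hh =>
    (starL' ℝ : C(UnitCircle, ℂ) ≃L[ℝ] C(UnitCircle, ℂ)).contDiff.comp hh
  have inv : ∀ {h : Coeffs n × Coeffs n → C(UnitCircle, ℂ)}, ContDiff ℝ 1 h → IsUnit (h c) →
      ContDiffAt ℝ 1 (fun c => Ring.inverse (h c)) c := fun {h} hh hu => by
    obtain ⟨w, hw⟩ := hu
    have := contDiffAt_ringInverse (n := 1) ℝ w
    rw [hw] at this
    exact this.comp c hh.contDiffAt
  have id1 := oc LinearMap.id
  have hN1 : ContDiff ℝ 1 fun c : Coeffs n × Coeffs n => circleNorm c.1 c.2 :=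
    ((st id1.1).mul id1.1).add ((st id1.2).mul id1.2)
  have hN2 : ContDiff ℝ 1 fun c : Coeffs n × Coeffs n => circleNorm c.2 c.1 :=
    ((st id1.2).mul id1.2).add ((st id1.1).mul id1.1)
  have hi1 := inv hN1 (isUnit_circleNorm hc)
  have hi2 := inv hN2 (isUnit_circleNorm fun ζ hζ => by
    have := hc ζ hζ
    unfold spinNorm at *
    rwa [add_comm])
  have k1 : ∀ i, ContDiffAt ℝ 1 (fun c : Coeffs n × Coeffs n => nodeKernel i c.1 c.2) c :=
    fun i => ContDiffAt.flowKernel (ev LinearMap.id _).1.contDiffAt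
      (ev LinearMap.id _).2.contDiffAt (ev Polynomial.derivative _).1.contDiffAt
      id1.1.contDiffAt id1.2.contDiffAt (oc Polynomial.derivative).1.contDiffAt
      (oc Polynomial.derivative).2.contDiffAt (st id1.1).contDiffAt (st id1.2).contDiffAt hi1
  have k2 : ∀ i, ContDiffAt ℝ 1 (fun c : Coeffs n × Coeffs n => nodeKernel i c.2 c.1) c :=
    fun i => ContDiffAt.flowKernel (ev LinearMap.id _).2.contDiffAt
      (ev LinearMap.id _).1.contDiffAt (ev Polynomial.derivative _).2.contDiffAt
      id1.2.contDiffAt id1.1.contDiffAt (oc Polynomial.derivative).2.contDiffAt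
      (oc Polynomial.derivative).1.contDiffAt (st id1.2).contDiffAt (st id1.1).contDiffAt hi2
  refine ContDiffAt.prodMk ?_ ?_
  · refine contDiffAt_pi.2 fun k => ContDiffAt.sum fun i _ => ?_
    exact (contDiffAt_const.mul (lineIntegral.contDiff.contDiffAt.comp c (k1 i))).mul
      contDiffAt_const
  · refine contDiffAt_pi.2 fun k => ContDiffAt.sum fun i _ => ?_
    exact (contDiffAt_const.mul (lineIntegral.contDiff.contDiffAt.comp c (k2 i))).mul
      contDiffAt_const

theorem integral_eq_integral_Ioi_add {E : Type*} [NormedAddCommGroup E] [NormedSpace ℝ E]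
    {h : ℝ → E} (hh : Integrable h) (x : ℝ) :
    IntegrableOn (fun s => h (x + s) + h (x - s)) (Set.Ioi 0) ∧
      ∫ y, h y = ∫ s in Set.Ioi (0 : ℝ), (h (x + s) + h (x - s)) := by
  have h1 : Integrable fun s => h (x + s) := hh.comp_add_left x
  have h2 : Integrable fun s => h (x - s) := hh.comp_sub_left x
  refine ⟨h1.integrableOn.add h2.integrableOn, ?_⟩
  have h3 := integral_comp_neg_Ioi (0 : ℝ) fun s => h (x + s)
  simp only [neg_zero, ← sub_eq_add_neg] at h3
  rw [integral_add h1.integrableOn h2.integrableOn, h3, ← integral_add_left_eq_self h x,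
    ← integral_add_compl (measurableSet_Ioi (a := (0 : ℝ))) h1, Set.compl_Ioi]

/-- The even part around `x` of the conjugate Poisson kernel. -/
def conjPoisson (x s : ℝ) : ℝ := (x + s) / (1 + (x + s) ^ 2) + (x - s) / (1 + (x - s) ^ 2)

theorem integrable_conjPoisson (x : ℝ) : Integrable (conjPoisson x) := by
  have h1 : Integrable fun s : ℝ => (1 + (x + s) ^ 2)⁻¹ :=
    integrable_inv_one_add_sq.comp_add_left x
  have h2 : Integrable fun s : ℝ => (1 + (x - s) ^ 2)⁻¹ :=
    integrable_inv_one_add_sq.comp_sub_left x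
  refine ((h1.add h2).const_mul |x|).mono' (Continuous.aestronglyMeasurable ?_)
    (Eventually.of_forall fun s => ?_)
  · unfold conjPoisson
    exact (Continuous.div (by fun_prop) (by fun_prop) fun s => by positivity).add
      (Continuous.div (by fun_prop) (by fun_prop) fun s => by positivity)
  · have p1 : 0 < 1 + (x + s) ^ 2 := by positivity
    have p2 : 0 < 1 + (x - s) ^ 2 := by positivity
    have e1 : conjPoisson x s = x * (2 * (1 + x ^ 2 - s ^ 2) /
        ((1 + (x + s) ^ 2) * (1 + (x - s) ^ 2))) := by
      unfold conjPoisson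
      field_simp
      ring
    have e2 : (1 + (x + s) ^ 2)⁻¹ + (1 + (x - s) ^ 2)⁻¹ = 2 * (1 + x ^ 2 + s ^ 2) /
        ((1 + (x + s) ^ 2) * (1 + (x - s) ^ 2)) := by
      field_simp
      ring
    simp only [Pi.add_apply]
    rw [e1, e2, Real.norm_eq_abs, abs_mul]
    refine mul_le_mul_of_nonneg_left ?_ (abs_nonneg x)
    rw [abs_div, abs_of_pos (mul_pos p1 p2)]
    refine div_le_div_of_nonneg_right (abs_le.2 ⟨?_, ?_⟩) (mul_pos p1 p2).le <;>
      nlinarith [sq_nonneg x, sq_nonneg s]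

theorem integral_conjPoisson (x : ℝ) : ∫ s in Set.Ioi (0 : ℝ), conjPoisson x s = 0 := by
  have h := integral_Ioi_of_hasDerivAt_of_tendsto'
    (f := fun s => 1 / 2 * Real.log (((s - -x) ^ 2 + 1 ^ 2) / ((s - x) ^ 2 + 1 ^ 2)))
    (f' := conjPoisson x) (a := 0) (m := 1 / 2 * 0) ?_ (integrable_conjPoisson x).integrableOn
    ((tendsto_log_ratio 1 (-x) x one_pos atTop tendsto_inv_atTop_zero
      (eventually_ne_atTop 0)).const_mul _)
  · rw [h]
    have : (0 - -x) ^ 2 + (1 : ℝ) ^ 2 = (0 - x) ^ 2 + 1 ^ 2 := by ring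
    rw [this, div_self (by positivity)]
    simp
  · intro s _
    have p1 : (s - -x) ^ 2 + (1 : ℝ) ^ 2 ≠ 0 := by positivity
    have p2 : (s - x) ^ 2 + (1 : ℝ) ^ 2 ≠ 0 := by positivity
    have d1 : ∀ w : ℝ, HasDerivAt (fun s : ℝ => (s - w) ^ 2 + 1 ^ 2) (2 * (s - w)) s := fun w => by
      have := (((hasDerivAt_id s).sub_const w).pow 2).add_const (1 ^ 2)
      simpa using this
    have hdiv : HasDerivAt (fun s : ℝ => ((s - -x) ^ 2 + 1 ^ 2) / ((s - x) ^ 2 + 1 ^ 2)) _ s :=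
      (d1 (-x)).div (d1 x) p2
    refine HasDerivAt.congr_deriv ((hdiv.log (div_ne_zero p1 p2)).const_mul (1 / 2)) ?_
    have p3 : 1 + (x + s) ^ 2 ≠ 0 := by positivity
    have p4 : 1 + (x - s) ^ 2 ≠ 0 := by positivity
    have p1' : (s + x) ^ 2 + 1 ≠ 0 := by positivity
    have p2' : (s - x) ^ 2 + 1 ≠ 0 := by positivity
    unfold conjPoisson
    simp only [sub_neg_eq_add, one_pow] at *
    field_simp
    ring

theorem flowKernel_antisymm (n : ℕ) {x y : ℝ} (hxy : x ≠ y) (f g f' g' F G F' G' : ℂ) :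
    ((1 + y ^ 2)⁻¹ : ℝ) •
      (f * flowKernel n (cay x) g f g' (cay y) G F G' F' (star G) (star F)
          (cay x - cay y)⁻¹ (star G * G + star F * F)⁻¹ -
        g * flowKernel n (cay x) f g f' (cay y) F G F' G' (star F) (star G)
          (cay x - cay y)⁻¹ (star F * F + star G * G)⁻¹) =
      -2 * Complex.I * (((x - y) ^ 2)⁻¹ : ℝ) * spinDiff f g F G +
        Complex.I * ((1 - cay x) ^ 2 * (f * g' - g * f')) *
          (((x - y)⁻¹ + y / (1 + y ^ 2) : ℝ) : ℂ) := by
  have hx := ofReal_add_I_ne_zero x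
  have hy := ofReal_add_I_ne_zero y
  have hsub : ((x : ℂ) - y) ≠ 0 := by
    rw [← Complex.ofReal_sub]
    exact_mod_cast sub_ne_zero.2 hxy
  have hy' : (y : ℂ) - Complex.I ≠ 0 := by
    intro h
    have := congrArg Complex.im h
    simp at this
  have hb : ((1 : ℂ) + (y : ℂ) ^ 2) = (y + Complex.I) * (y - Complex.I) := by
    linear_combination Complex.I_sq
  have hd : (cay x - cay y)⁻¹ =
      (x + Complex.I) * (y + Complex.I) / (2 * Complex.I * (x - y)) := by
    rw [cay_sub_cay, inv_div]
    push_cast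
    ring
  have h1 : 1 - cay x = 2 * Complex.I / (x + Complex.I) := by
    unfold cay
    field_simp
    ring
  have k1 : (1 + (y : ℂ) ^ 2)⁻¹ * cay y * (1 - cay x) ^ 2 * ((cay x - cay y)⁻¹) ^ 2 =
      (((x : ℂ) - y) ^ 2)⁻¹ := by
    rw [hb, hd, h1, cay]
    have := Complex.I_ne_zero
    field_simp
  have k2 : (1 + (y : ℂ) ^ 2)⁻¹ * (cay x + cay y) * (cay x - cay y)⁻¹ =
      -Complex.I * (((x : ℂ) - y)⁻¹ + y / (1 + y ^ 2)) := by
    rw [hb, hd, cay, cay]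
    have := Complex.I_ne_zero
    field_simp
    linear_combination (2 * (x * y - Complex.I ^ 2)) * Complex.I_sq
  rw [add_comm (star G * G), Complex.real_smul]
  unfold spinDiff
  have hN : star F * F + star G * G = (spinNorm F G : ℂ) := by
    simp only [spinNorm, Complex.star_def, ← Complex.normSq_eq_conj_mul_self]
    push_cast
    ring
  rw [hN, div_eq_mul_inv]
  generalize (spinNorm F G : ℂ)⁻¹ = r
  push_cast
  unfold flowKernel
  linear_combination (-2 * (f * G - F * g) * (star F * f + star G * g) * r) * k1 -
    (1 - cay x) ^ 2 * (f * g' - g * f') * k2 -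
    2 * (((x : ℂ) - y) ^ 2)⁻¹ * (f * G - F * g) * (star F * f + star G * g) * r * Complex.I_sq

open Polynomial in
theorem nodeKernel_apply {n : ℕ} {a b : Coeffs n} (h : IsUnit (circleNorm a b))
    (i : Fin (n + 1)) (ζ : UnitCircle) :
    nodeKernel i a b ζ =
      flowKernel n (node n i) ((polyOf n a).eval (node n i)) ((polyOf n b).eval (node n i))
        ((derivative (polyOf n a)).eval (node n i)) (ζ : ℂ) ((polyOf n a).eval (ζ : ℂ))
        ((polyOf n b).eval (ζ : ℂ)) ((derivative (polyOf n a)).eval (ζ : ℂ))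
        ((derivative (polyOf n b)).eval (ζ : ℂ)) (star ((polyOf n a).eval (ζ : ℂ)))
        (star ((polyOf n b).eval (ζ : ℂ))) (node n i - ζ)⁻¹
        (star ((polyOf n a).eval (ζ : ℂ)) * (polyOf n a).eval (ζ : ℂ) +
          star ((polyOf n b).eval (ζ : ℂ)) * (polyOf n b).eval (ζ : ℂ))⁻¹ := by
  have hr : Ring.inverse (circleNorm a b) ζ =
      (star ((polyOf n a).eval (ζ : ℂ)) * (polyOf n a).eval (ζ : ℂ) +
          star ((polyOf n b).eval (ζ : ℂ)) * (polyOf n b).eval (ζ : ℂ))⁻¹ := by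
    refine eq_inv_of_mul_eq_one_left ?_
    have := DFunLike.congr_fun (Ring.inverse_mul_cancel _ h) ζ
    simpa only [circleNorm, ContinuousMap.add_apply, ContinuousMap.mul_apply,
      ContinuousMap.star_apply, onCircle_apply, ContinuousMap.one_apply] using this
  have hA : ∀ z : ℂ, algebraMap ℂ C(UnitCircle, ℂ) z ζ = z := fun z => by
    simp [_root_.algebraMap_apply]
  have h2 : (2 : C(UnitCircle, ℂ)) ζ = 2 := rfl
  rw [← hr]
  simp only [nodeKernel, flowKernel, ContinuousMap.add_apply, ContinuousMap.mul_apply,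
    ContinuousMap.sub_apply, ContinuousMap.pow_apply, ContinuousMap.star_apply, onCircle_apply,
    ContinuousMap.one_apply, ContinuousMap.natCast_apply, hA, h2, circleCoord, nodeInv,
    ContinuousMap.coe_mk]

/-- The value of the spinor flow as an integral over the line. -/
theorem eval_spinFieldAux {n : ℕ} (a b : Coeffs n) (z : ℂ) :
    Integrable (fun y : ℝ => ((1 + y ^ 2)⁻¹ : ℝ) • ∑ i, nodeKernel i a b (cayCircle y) *
      (Lagrange.basis Finset.univ (node n) i).eval z) ∧
    (polyOf n (spinFieldAux a b)).eval z = Complex.I / (2 * Real.pi) *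
      ∫ y : ℝ, ((1 + y ^ 2)⁻¹ : ℝ) • ∑ i, nodeKernel i a b (cayCircle y) *
        (Lagrange.basis Finset.univ (node n) i).eval z := by
  have hInt : ∀ i : Fin (n + 1), Integrable fun y : ℝ =>
      (((1 + y ^ 2)⁻¹ : ℝ) • nodeKernel i a b (cayCircle y)) *
        (Lagrange.basis Finset.univ (node n) i).eval z := fun i =>
    (integrable_comp_cayCircle _).mul_const _
  have hfun : (fun y : ℝ => ((1 + y ^ 2)⁻¹ : ℝ) • ∑ i, nodeKernel i a b (cayCircle y) *
      (Lagrange.basis Finset.univ (node n) i).eval z) = fun y : ℝ => ∑ i,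
      (((1 + y ^ 2)⁻¹ : ℝ) • nodeKernel i a b (cayCircle y)) *
        (Lagrange.basis Finset.univ (node n) i).eval z := by
    ext1 y
    simp only [Finset.smul_sum, smul_mul_assoc]
  rw [hfun]
  refine ⟨integrable_finsetSum _ fun i _ => hInt i, ?_⟩
  rw [integral_finsetSum _ fun i _ => hInt i]
  have hp : polyOf n (spinFieldAux a b) = ∑ i, (Complex.I / (2 * Real.pi) *
      lineIntegral (nodeKernel i a b)) • Lagrange.basis Finset.univ (node n) i := by
    have hsum : spinFieldAux a b = ∑ i, (Complex.I / (2 * Real.pi) *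
        lineIntegral (nodeKernel i a b)) •
          (fun k : Fin (n + 1) => (Lagrange.basis Finset.univ (node n) i).coeff k) := by
      ext k
      simp [spinFieldAux]
    rw [hsum, map_sum]
    refine Finset.sum_congr rfl fun i _ => ?_
    rw [map_smul, polyOf_coeff]
    rw [Lagrange.natDegree_basis ((node_injective n).injOn) (Finset.mem_univ i)]
    simp
  rw [hp, Polynomial.eval_finsetSum, Finset.mul_sum]
  refine Finset.sum_congr rfl fun i _ => ?_
  rw [integral_mul_const, ← lineIntegral_apply]
  simp only [Polynomial.eval_smul, smul_eq_mul]
  ring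

/-- The momentum `f X₂ - g X₁` of the spinor flow is the tangent direction of the half-Laplacian of
the associated map into the sphere. -/
theorem momentum_spinField {n : ℕ} {c : Coeffs n × Coeffs n}
    (hc : ∀ ζ : ℂ, ‖ζ‖ = 1 → spinNorm ((polyOf n c.1).eval ζ) ((polyOf n c.2).eval ζ) ≠ 0)
    {F G : ℝ → ℂ} (hF : ∀ x, F x = (polyOf n c.1).eval (cay x))
    (hG : ∀ x, G x = (polyOf n c.2).eval (cay x)) (x : ℝ) :
    IntegrableOn (fun s : ℝ => (s ^ 2)⁻¹ • (spinDiff (F x) (G x) (F (x - s)) (G (x - s)) +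
      spinDiff (F x) (G x) (F (x + s)) (G (x + s)))) (Set.Ioi 0) ∧
    F x * (polyOf n (spinField n c).2).eval (cay x) -
      G x * (polyOf n (spinField n c).1).eval (cay x) =
      (Real.pi)⁻¹ • ∫ s in Set.Ioi (0 : ℝ), (s ^ 2)⁻¹ •
        (spinDiff (F x) (G x) (F (x - s)) (G (x - s)) +
          spinDiff (F x) (G x) (F (x + s)) (G (x + s))) := by
  have hc' : ∀ ζ : ℂ, ‖ζ‖ = 1 →
      spinNorm ((polyOf n c.2).eval ζ) ((polyOf n c.1).eval ζ) ≠ 0 := fun ζ hζ => by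
    have := hc ζ hζ
    unfold spinNorm at *
    rwa [add_comm]
  obtain ⟨i1, e1⟩ := eval_spinFieldAux c.1 c.2 (cay x)
  obtain ⟨i2, e2⟩ := eval_spinFieldAux c.2 c.1 (cay x)
  set S1 : ℝ → ℂ := fun y => ((1 + y ^ 2)⁻¹ : ℝ) • ∑ i, nodeKernel i c.1 c.2 (cayCircle y) *
      (Lagrange.basis Finset.univ (node n) i).eval (cay x) with hS1
  set S2 : ℝ → ℂ := fun y => ((1 + y ^ 2)⁻¹ : ℝ) • ∑ i, nodeKernel i c.2 c.1 (cayCircle y) *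
      (Lagrange.basis Finset.univ (node n) i).eval (cay x) with hS2
  have hcayne : ∀ {y : ℝ}, x ≠ y → cay x ≠ cay y := fun {y} h h' => by
    have h3 := cay_sub_cay x y
    rw [h', sub_self] at h3
    have h4 := ofReal_add_I_ne_zero x
    have h5 := ofReal_add_I_ne_zero y
    rw [eq_comm, div_eq_zero_iff] at h3
    have h6 : ((x - y : ℝ) : ℂ) ≠ 0 := by exact_mod_cast sub_ne_zero.2 h
    simp_all
  set K : ℂ := (1 - cay x) ^ 2 * (F x * (Polynomial.derivative (polyOf n c.2)).eval (cay x) -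
    G x * (Polynomial.derivative (polyOf n c.1)).eval (cay x)) with hK
  have key : ∀ y : ℝ, x ≠ y → F x * S2 y - G x * S1 y =
      -2 * Complex.I * (((x - y) ^ 2)⁻¹ : ℝ) * spinDiff (F x) (G x) (F y) (G y) +
        Complex.I * K * (((x - y)⁻¹ + y / (1 + y ^ 2) : ℝ) : ℂ) := by
    intro y hxy
    have hq : ∀ a b : Coeffs n,
        (∀ ζ : ℂ, ‖ζ‖ = 1 → spinNorm ((polyOf n a).eval ζ) ((polyOf n b).eval ζ) ≠ 0) →
        star ((polyOf n a).eval (cay y)) * (polyOf n a).eval (cay y) +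
          star ((polyOf n b).eval (cay y)) * (polyOf n b).eval (cay y) ≠ 0 := fun a b h => by
      have := h (cay y) (norm_cay y)
      simp only [Complex.star_def, ← Complex.normSq_eq_conj_mul_self]
      exact_mod_cast this
    have hcy : ((cayCircle y : UnitCircle) : ℂ) = cay y := rfl
    have s1 := sum_flowKernel_mul_basis (natDegree_polyOf_le c.1) (natDegree_polyOf_le c.2)
      (hq _ _ hc) (node_injective n) (fun i => node_ne i (norm_cay y)) (hcayne hxy)
    have s2 := sum_flowKernel_mul_basis (natDegree_polyOf_le c.2) (natDegree_polyOf_le c.1)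
      (hq _ _ hc') (node_injective n) (fun i => node_ne i (norm_cay y)) (hcayne hxy)
    simp only [hS1, hS2, nodeKernel_apply (isUnit_circleNorm hc),
      nodeKernel_apply (isUnit_circleNorm hc'), hcy]
    rw [s1, s2, hF, hG, hF, hG, hK, hF, hG, ← flowKernel_antisymm n hxy]
    simp only [Complex.real_smul]
    ring
  have hHint : Integrable fun y => F x * S2 y - G x * S1 y :=
    (i2.const_mul _).sub (i1.const_mul _)
  obtain ⟨j1, j2⟩ := integral_eq_integral_Ioi_add hHint x
  set B : ℝ → ℂ := fun s => (s ^ 2)⁻¹ • (spinDiff (F x) (G x) (F (x - s)) (G (x - s)) +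
          spinDiff (F x) (G x) (F (x + s)) (G (x + s))) with hB
  have hpt : Set.EqOn (fun s => (F x * S2 (x + s) - G x * S1 (x + s)) +
      (F x * S2 (x - s) - G x * S1 (x - s)))
      (fun s => -2 * Complex.I * B s + Complex.I * K * (conjPoisson x s : ℂ)) (Set.Ioi 0) := by
    intro s hs
    have hs : (0 : ℝ) < s := hs
    have hs' : (s : ℂ) ≠ 0 := by exact_mod_cast hs.ne'
    simp only
    rw [key (x + s) (by linarith [hs]), key (x - s) (by linarith [hs])]
    simp only [hB, conjPoisson, Complex.real_smul]
    rw [show x - (x + s) = -s by ring, show x - (x - s) = s by ring]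
    push_cast
    rw [neg_sq, inv_neg]
    ring
  have hcp : IntegrableOn (fun s => Complex.I * K * (conjPoisson x s : ℂ)) (Set.Ioi 0) :=
    ((integrable_conjPoisson x).ofReal.const_mul _).integrableOn
  have hBint : IntegrableOn B (Set.Ioi 0) := by
    have h1 : IntegrableOn (fun s => -2 * Complex.I * B s) (Set.Ioi 0) := by
      have := (j1.congr_fun hpt measurableSet_Ioi).sub hcp
      refine this.congr_fun (fun s _ => ?_) measurableSet_Ioi
      simp
    have h2 := h1.const_mul (Complex.I / 2)
    refine IntegrableOn.congr_fun h2 (fun s _ => ?_) measurableSet_Ioi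
    linear_combination -B s * Complex.I_sq
  refine ⟨hBint, ?_⟩
  have e3 : F x * (polyOf n (spinField n c).2).eval (cay x) -
      G x * (polyOf n (spinField n c).1).eval (cay x) =
      Complex.I / (2 * Real.pi) * ∫ y, (F x * S2 y - G x * S1 y) := by
    rw [integral_sub (i2.const_mul _) (i1.const_mul _), integral_const_mul, integral_const_mul]
    simp only [spinField]
    rw [e1, e2]
    ring
  rw [e3, j2, setIntegral_congr_fun measurableSet_Ioi hpt,
    integral_add (hBint.const_mul _) hcp, integral_const_mul, integral_const_mul,
    integral_complex_ofReal, integral_conjPoisson, Complex.real_smul]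
  push_cast
  have : (Real.pi : ℂ) ≠ 0 := by exact_mod_cast Real.pi_ne_zero
  field_simp
  linear_combination -2 * (∫ s in Set.Ioi 0, B s) * Complex.I_sq

/-- The rational map into the sphere with the given spinor coefficients. -/
def spinMap {n : ℕ} (c : Coeffs n × Coeffs n) (x : ℝ) : V3 :=
  spinVec ((polyOf n c.1).eval (cay x)) ((polyOf n c.2).eval (cay x))

/-- The spinor has no zero on the unit circle. -/
def IsSpinRegular {n : ℕ} (c : Coeffs n × Coeffs n) : Prop :=
  ∀ ζ : ℂ, ‖ζ‖ = 1 → spinNorm ((polyOf n c.1).eval ζ) ((polyOf n c.2).eval ζ) ≠ 0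

theorem contDiff_cay {m : WithTop ℕ∞} : ContDiff ℝ m cay := by
  have h : ContDiff ℝ m fun x : ℝ => (x : ℂ) := Complex.ofRealCLM.contDiff
  have h' : ContDiff ℝ m fun x : ℝ => ((x : ℂ) + Complex.I)⁻¹ :=
    (h.add contDiff_const).inv ofReal_add_I_ne_zero
  exact (h.sub contDiff_const).mul h'

theorem contDiff_eval_cay {m : WithTop ℕ∞} (p : Polynomial ℂ) :
    ContDiff ℝ m fun x => p.eval (cay x) := by
  simp only [Polynomial.eval_eq_sum, Polynomial.sum]
  exact ContDiff.sum fun i _ => contDiff_const.mul (contDiff_cay.pow i)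

theorem contDiffOn_spinVec {m : WithTop ℕ∞} :
    ContDiffOn ℝ m (fun p : ℂ × ℂ => spinVec p.1 p.2) {p | spinNorm p.1 p.2 ≠ 0} := by
  have r1 : ContDiff ℝ m fun p : ℂ × ℂ => p.1.re := Complex.reCLM.contDiff.comp contDiff_fst
  have r2 : ContDiff ℝ m fun p : ℂ × ℂ => p.2.re := Complex.reCLM.contDiff.comp contDiff_snd
  have i1 : ContDiff ℝ m fun p : ℂ × ℂ => p.1.im := Complex.imCLM.contDiff.comp contDiff_fst
  have i2 : ContDiff ℝ m fun p : ℂ × ℂ => p.2.im := Complex.imCLM.contDiff.comp contDiff_snd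
  have hN : ContDiff ℝ m fun p : ℂ × ℂ => spinNorm p.1 p.2 := by
    simp only [spinNorm, Complex.normSq_apply]
    fun_prop
  have hH : ContDiff ℝ m fun p : ℂ × ℂ => hopf p.1 p.2 := by
    refine contDiff_pi.2 fun i => ?_
    fin_cases i <;> simp [hopf, Complex.normSq_apply] <;> fun_prop
  exact (hN.contDiffOn.inv fun p hp => hp).smul hH.contDiffOn

theorem contDiff_spinMap {n : ℕ} {m : WithTop ℕ∞} {c : Coeffs n × Coeffs n} (hc : IsSpinRegular c) :
    ContDiff ℝ m (spinMap c) := by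
  have := contDiffOn_spinVec.comp (s := Set.univ)
    ((contDiff_eval_cay (m := m) (polyOf n c.1)).prodMk
      (contDiff_eval_cay (polyOf n c.2))).contDiffOn fun x _ => hc (cay x) (norm_cay x)
  exact contDiffOn_univ.1 this

theorem norm_spinVec_le {f g : ℂ} (h : spinNorm f g ≠ 0) : ‖spinVec f g‖ ≤ 1 :=
  norm_le_of_abs_le (abs_le_one_of_dot3 (dot3_spinVec h))

/-- `cross3` as a continuous linear map in the second argument. -/
def cross3CLM (a : V3) : V3 →L[ℝ] V3 := LinearMap.toContinuousLinearMap (crossProduct a)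

theorem cross3CLM_apply (a b : V3) : cross3CLM a b = cross3 a b := rfl

theorem cross3_halfLap_spinMap {n : ℕ} {c : Coeffs n × Coeffs n} (hc : IsSpinRegular c) (x : ℝ) :
    cross3 (spinMap c x) (halfLap (spinMap c) x) =
      spinTangent ((polyOf n c.1).eval (cay x)) ((polyOf n c.2).eval (cay x))
        ((polyOf n c.1).eval (cay x) * (polyOf n (spinField n c).2).eval (cay x) -
          (polyOf n c.2).eval (cay x) * (polyOf n (spinField n c).1).eval (cay x)) := by
  obtain ⟨h1, h2⟩ := momentum_spinField hc (F := fun x => (polyOf n c.1).eval (cay x))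
    (G := fun x => (polyOf n c.2).eval (cay x)) (fun _ => rfl) (fun _ => rfl) x
  have hb : ∀ y, ‖spinMap c y‖ ≤ 1 := fun y => norm_spinVec_le (hc _ (norm_cay y))
  rw [h2, halfLap, ← cross3CLM_apply, map_smul, map_smul,
    ← ContinuousLinearMap.integral_comp_comm _ (integrableOn_symDiff2 (contDiff_spinMap hc) hb x)]
  have h3 := ContinuousLinearMap.integral_comp_comm (LinearMap.toContinuousLinearMap
    (spinTangent ((polyOf n c.1).eval (cay x)) ((polyOf n c.2).eval (cay x)))) h1
  rw [LinearMap.coe_toContinuousLinearMap'] at h3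
  rw [← h3]
  congr 1
  refine integral_congr_ae (Eventually.of_forall fun s => ?_)
  simp only [symDiff2, map_smul, map_add, cross3CLM_apply]
  rw [← cross3_spinVec (hc _ (norm_cay x)) (hc _ (norm_cay (x - s))),
    ← cross3_spinVec (hc _ (norm_cay x)) (hc _ (norm_cay (x + s)))]
  rfl

theorem GoodFam.congr {ι : Type*} {φ ψ : ι → ℝ → ℂ} (h : GoodFam φ)
    (e : ∀ t x, ψ t x = φ t x) : GoodFam ψ := by
  rwa [show ψ = φ from funext fun t => funext fun x => e t x]

theorem goodFam_eval_cay {ι : Type*} {n : ℕ} {a : ι → Coeffs n} {M : ℝ} (ha : ∀ t, ‖a t‖ ≤ M) :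
    GoodFam fun t x => (polyOf n (a t)).eval (cay x) := by
  have := goodFam_sum (φ := fun (k : Fin (n + 1)) t x => a t k * cay x ^ (k : ℕ)) fun k =>
    (goodFam_const (fun t => a t k) M fun t => (norm_le_pi_norm _ _).trans (ha t)).mul
      (goodFam_pow_cay k)
  exact this.congr fun t x => eval_polyOf _ _

theorem goodFam_chi : GoodFam fun (R : ℝ) x => ((chi R x : ℝ) : ℂ) := by
  have h : GoodFam fun (R : ℝ) (_ : ℝ) => (-((1 + R ^ 2)⁻¹ : ℝ) : ℂ) :=
    goodFam_const (fun R : ℝ => (-((1 + R ^ 2)⁻¹ : ℝ) : ℂ)) 1 fun R => by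
      rw [norm_neg, Complex.norm_real, Real.norm_eq_abs, abs_of_nonneg (by positivity)]
      exact inv_le_one_of_one_le₀ (by nlinarith [sq_nonneg R])
  refine ((goodFam_weight (ι := ℝ)).add h).congr fun R x => ?_
  simp [chi, sub_eq_add_neg]

theorem goodFam_spinMap {ι : Type*} {n : ℕ} {c : ι → Coeffs n × Coeffs n} {M m : ℝ} (hm : 0 < m)
    (hM : ∀ t, ‖c t‖ ≤ M) (hc : ∀ t, ∀ ζ : ℂ, ‖ζ‖ = 1 →
      m ≤ spinNorm ((polyOf n (c t).1).eval ζ) ((polyOf n (c t).2).eval ζ)) (i : Fin 3) :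
    GoodFam fun t x => ((spinMap (c t) x i : ℝ) : ℂ) := by
  have hf : GoodFam fun t x => (polyOf n (c t).1).eval (cay x) :=
    goodFam_eval_cay fun t => (norm_fst_le _).trans (hM t)
  have hg : GoodFam fun t x => (polyOf n (c t).2).eval (cay x) :=
    goodFam_eval_cay fun t => (norm_snd_le _).trans (hM t)
  have hN : GoodFam fun t x => ((spinNorm ((polyOf n (c t).1).eval (cay x))
      ((polyOf n (c t).2).eval (cay x)) : ℝ) : ℂ) := by
    refine ((hf.conj.mul hf).add (hg.conj.mul hg)).congr fun t x => ?_
    simp only [spinNorm, ← Complex.normSq_eq_conj_mul_self]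
    push_cast
    rfl
  have hNi := hN.inv m⁻¹ (fun t x => by
    have := hc t (cay x) (norm_cay x)
    exact_mod_cast (hm.trans_le this).ne') fun t x => by
    have := hc t (cay x) (norm_cay x)
    rw [norm_inv, Complex.norm_real, Real.norm_eq_abs, abs_of_pos (hm.trans_le this)]
    exact inv_anti₀ hm this
  have two : ∀ w : ℂ, GoodFam fun (_ : ι) (_ : ℝ) => w := fun w =>
    goodFam_const (fun _ => w) ‖w‖ fun _ => le_rfl
  have A := hf.conj.mul hg
  have B := hf.mul hg.conj
  fin_cases i
  · refine (hNi.mul (A.add B)).congr fun t x => ?_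
    simp only [spinMap, spinVec, Pi.smul_apply, smul_eq_mul, Complex.ofReal_mul,
      Complex.ofReal_inv]
    congr 1
    apply Complex.ext <;> simp [hopf] <;> ring
  · refine (hNi.mul ((two (-Complex.I)).mul (A.add ((two (-1)).mul B)))).congr fun t x => ?_
    simp only [spinMap, spinVec, Pi.smul_apply, smul_eq_mul, Complex.ofReal_mul,
      Complex.ofReal_inv]
    congr 1
    apply Complex.ext <;> simp [hopf]
    ring
  · refine (hNi.mul ((hf.conj.mul hf).add ((two (-1)).mul (hg.conj.mul hg)))).congr
      fun t x => ?_
    simp only [spinMap, spinVec, Pi.smul_apply, smul_eq_mul, Complex.ofReal_mul,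
      Complex.ofReal_inv]
    congr 1
    apply Complex.ext <;> simp [hopf, Complex.normSq_apply] <;> ring

theorem exists_commForm_spinMap_le {ι : Type*} {n : ℕ} {c : ι → Coeffs n × Coeffs n} {M m : ℝ}
    (hm : 0 < m) (hM : ∀ t, ‖c t‖ ≤ M) (hc : ∀ t, ∀ ζ : ℂ, ‖ζ‖ = 1 →
      m ≤ spinNorm ((polyOf n (c t).1).eval ζ) ((polyOf n (c t).2).eval ζ)) :
    ∃ C, 0 ≤ C ∧ ∀ t R i ε, 0 < ε → ∀ f g : ℝ → ℂ, Continuous f → Continuous g →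
      ‖commForm R ε (fun x => ((chi R x * spinMap (c t) x i : ℝ) : ℂ)) f g‖ ≤
        C * (wnorm R f + wnorm R g) := by
  have h : ∀ i, ∃ C, 0 ≤ C ∧ ∀ t R ε, 0 < ε → ∀ f g : ℝ → ℂ, Continuous f → Continuous g →
      ‖commForm R ε (fun x => ((chi R x * spinMap (c t) x i : ℝ) : ℂ)) f g‖ ≤
        C * (wnorm R f + wnorm R g) := fun i => by
    obtain ⟨-, C, _, hC, -, h⟩ := (goodFam_chi.comp (Prod.snd : ι × ℝ → ℝ)).mul
      ((goodFam_spinMap hm hM hc i).comp (Prod.fst : ι × ℝ → ι))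
    refine ⟨C, hC, fun t R ε hε f g hf hg => ?_⟩
    have := (h (t, R)).2 R ε hε f g hf hg
    simpa only [Complex.ofReal_mul] using this
  choose C hC h using h
  refine ⟨∑ i, C i, Finset.sum_nonneg fun i _ => hC i, fun t R i ε hε f g hf hg =>
    (h i t R ε hε f g hf hg).trans ?_⟩
  exact mul_le_mul_of_nonneg_right (Finset.single_le_sum (fun i _ => hC i) (Finset.mem_univ i))
    (add_nonneg (wnorm_nonneg _ _) (wnorm_nonneg _ _))

theorem continuousOn_spinTangent : ContinuousOn (fun p : ℂ × ℂ × ℂ => spinTangent p.1 p.2.1 p.2.2)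
    {p | spinNorm p.1 p.2.1 ≠ 0} := by
  have hN : Continuous fun p : ℂ × ℂ × ℂ => spinNorm p.1 p.2.1 ^ 2 := by
    simp only [spinNorm, Complex.normSq_apply]
    fun_prop
  refine continuousOn_pi.2 fun i => ?_
  fin_cases i
  all_goals
    refine ContinuousOn.div (Continuous.continuousOn ?_) hN.continuousOn
      fun p hp => pow_ne_zero 2 hp
    simp only [Complex.star_def]
    fun_prop

theorem continuous_eval_polyOf {n : ℕ} :
    Continuous fun p : Coeffs n × ℂ => (polyOf n p.1).eval p.2 := by
  simp only [eval_polyOf]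
  fun_prop

theorem continuous_spinNorm_polyOf {n : ℕ} : Continuous fun p : (Coeffs n × Coeffs n) × ℂ =>
    spinNorm ((polyOf n p.1.1).eval p.2) ((polyOf n p.1.2).eval p.2) := by
  have h1 : Continuous fun p : (Coeffs n × Coeffs n) × ℂ => (polyOf n p.1.1).eval p.2 :=
    continuous_eval_polyOf.comp (by fun_prop : Continuous fun p : (Coeffs n × Coeffs n) × ℂ =>
      (p.1.1, p.2))
  have h2 : Continuous fun p : (Coeffs n × Coeffs n) × ℂ => (polyOf n p.1.2).eval p.2 :=
    continuous_eval_polyOf.comp (by fun_prop : Continuous fun p : (Coeffs n × Coeffs n) × ℂ =>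
      (p.1.2, p.2))
  simp only [spinNorm, Complex.normSq_apply]
  fun_prop

theorem spinNorm_nonneg (f g : ℂ) : 0 ≤ spinNorm f g :=
  add_nonneg (Complex.normSq_nonneg f) (Complex.normSq_nonneg g)

theorem IsSpinRegular.eventually {n : ℕ} {c₀ : Coeffs n × Coeffs n} (hc : IsSpinRegular c₀) :
    ∃ m : ℝ, 0 < m ∧ ∀ᶠ c in 𝓝 c₀, ∀ ζ : ℂ, ‖ζ‖ = 1 →
      m ≤ spinNorm ((polyOf n c.1).eval ζ) ((polyOf n c.2).eval ζ) := by
  have hK : IsCompact (Metric.sphere (0 : ℂ) 1) := isCompact_sphere 0 1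
  have hcont : Continuous fun ζ : ℂ =>
      spinNorm ((polyOf n c₀.1).eval ζ) ((polyOf n c₀.2).eval ζ) :=
    continuous_spinNorm_polyOf.comp (by fun_prop : Continuous fun ζ : ℂ => (c₀, ζ))
  obtain ⟨ζ₀, hζ₀, hmin⟩ := hK.exists_isMinOn ⟨1, by simp⟩ hcont.continuousOn
  have hpos := lt_of_le_of_ne (spinNorm_nonneg _ _) (hc ζ₀ (mem_sphere_zero_iff_norm.1 hζ₀)).symm
  refine ⟨_, half_pos hpos, ?_⟩
  have := hK.eventually_forall_of_forall_eventually (x₀ := c₀)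
    (P := fun c ζ => spinNorm ((polyOf n c₀.1).eval ζ₀) ((polyOf n c₀.2).eval ζ₀) / 2 ≤
      spinNorm ((polyOf n c.1).eval ζ) ((polyOf n c.2).eval ζ)) fun ζ hζ => by
    refine (continuous_spinNorm_polyOf.tendsto (c₀, ζ)).eventually_const_le ?_
    have := isMinOn_iff.1 hmin ζ hζ
    linarith
  filter_upwards [this] with c h ζ hζ
  exact h ζ (mem_sphere_zero_iff_norm.2 hζ)

theorem exists_spinFlow {n : ℕ} {c₀ : Coeffs n × Coeffs n} (hc : IsSpinRegular c₀) (t₀ : ℝ) :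
    ∃ α : ℝ → Coeffs n × Coeffs n, α t₀ = c₀ ∧ ∃ δ > 0, ∃ M m : ℝ, 0 < m ∧
      ∀ t ∈ Set.Ioo (t₀ - δ) (t₀ + δ), HasDerivAt α (spinField n (α t)) t ∧ ‖α t‖ ≤ M ∧
        ∀ ζ : ℂ, ‖ζ‖ = 1 →
          m ≤ spinNorm ((polyOf n (α t).1).eval ζ) ((polyOf n (α t).2).eval ζ) := by
  obtain ⟨α, hα, ε, hε, hd⟩ :=
    (contDiffAt_spinField hc).exists_forall_mem_closedBall_exists_eq_forall_mem_Ioo_hasDerivAt₀ t₀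
  obtain ⟨m, hm, hev⟩ := hc.eventually
  have hcont : ContinuousAt α t₀ := (hd t₀ ⟨by linarith, by linarith⟩).continuousAt
  have hb : ∀ᶠ c in 𝓝 c₀, ‖c‖ ≤ ‖c₀‖ + 1 :=
    (continuous_norm.tendsto c₀).eventually_le_const (by linarith)
  have hall := hcont.eventually (by rw [hα]; exact hev.and hb)
  obtain ⟨δ, hδ, hball⟩ := Metric.eventually_nhds_iff_ball.1 hall
  refine ⟨α, hα, min ε δ, lt_min hε hδ, ‖c₀‖ + 1, m, hm, fun t ht => ?_⟩
  have h1 : t ∈ Set.Ioo (t₀ - ε) (t₀ + ε) :=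
    ⟨by linarith [ht.1, min_le_left ε δ], by linarith [ht.2, min_le_left ε δ]⟩
  have h2 := hball t (by
    rw [Real.ball_eq_Ioo]
    exact ⟨by linarith [ht.1, min_le_right ε δ], by linarith [ht.2, min_le_right ε δ]⟩)
  exact ⟨hd t h1, h2.2, h2.1⟩

/-- The velocity of `spinMap c` when the coefficients have velocity `X`. -/
def spinVelocity {n : ℕ} (c X : Coeffs n × Coeffs n) (x : ℝ) : V3 :=
  spinTangent ((polyOf n c.1).eval (cay x)) ((polyOf n c.2).eval (cay x))
    ((polyOf n c.1).eval (cay x) * (polyOf n X.2).eval (cay x) -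
      (polyOf n c.2).eval (cay x) * (polyOf n X.1).eval (cay x))

theorem hasDerivAt_spinMap {n : ℕ} {α : ℝ → Coeffs n × Coeffs n} {X : Coeffs n × Coeffs n} {t : ℝ}
    (h : HasDerivAt α X t) (hreg : IsSpinRegular (α t)) (x : ℝ) :
    HasDerivAt (fun s => spinMap (α s) x) (spinVelocity (α t) X x) t := by
  have hl : ∀ {β : ℝ → Coeffs n} {β' : Coeffs n}, HasDerivAt β β' t →
      HasDerivAt (fun s => (polyOf n (β s)).eval (cay x)) ((polyOf n β').eval (cay x)) t :=
    fun {β β'} h => by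
      simp only [eval_polyOf]
      exact HasDerivAt.fun_sum fun k _ => (hasDerivAt_pi.1 h k).mul_const _
  exact hasDerivAt_spinVec (hl h.fst) (hl h.snd) (hreg _ (norm_cay x))

theorem continuousOn_eval_cay {n : ℕ} {β : ℝ → Coeffs n} {s : Set ℝ} (hβ : ContinuousOn β s) :
    ContinuousOn (fun p : ℝ × ℝ => (polyOf n (β p.1)).eval (cay p.2)) (s ×ˢ Set.univ) := by
  have h1 : ContinuousOn (fun p : ℝ × ℝ => (β p.1, cay p.2)) (s ×ˢ Set.univ) :=
    (hβ.comp continuousOn_fst fun p hp => hp.1).prodMk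
      (continuous_cay.comp continuous_snd).continuousOn
  exact continuous_eval_polyOf.comp_continuousOn h1

theorem continuousOn_spinMap {n : ℕ} {α : ℝ → Coeffs n × Coeffs n} {s : Set ℝ}
    (hα : ContinuousOn α s) (hreg : ∀ t ∈ s, IsSpinRegular (α t)) :
    ContinuousOn (Function.uncurry fun t => spinMap (α t)) (s ×ˢ Set.univ) :=
  ContinuousOn.comp' (f := fun p : ℝ × ℝ => ((polyOf n (α p.1).1).eval (cay p.2),
      (polyOf n (α p.1).2).eval (cay p.2))) (contDiffOn_spinVec (m := 0)).continuousOn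
    ((continuousOn_eval_cay hα.fst).prodMk (continuousOn_eval_cay hα.snd))
    fun p hp => hreg p.1 hp.1 _ (norm_cay _)

theorem continuousOn_spinVelocity {n : ℕ} {α X : ℝ → Coeffs n × Coeffs n} {s : Set ℝ}
    (hα : ContinuousOn α s) (hX : ContinuousOn X s) (hreg : ∀ t ∈ s, IsSpinRegular (α t)) :
    ContinuousOn (Function.uncurry fun t => spinVelocity (α t) (X t)) (s ×ˢ Set.univ) := by
  have c1 := continuousOn_eval_cay hα.fst
  have c2 := continuousOn_eval_cay hα.snd
  have c3 := continuousOn_eval_cay hX.fst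
  have c4 := continuousOn_eval_cay hX.snd
  exact ContinuousOn.comp' (f := fun p : ℝ × ℝ => ((polyOf n (α p.1).1).eval (cay p.2),
      (polyOf n (α p.1).2).eval (cay p.2), (polyOf n (α p.1).1).eval (cay p.2) *
      (polyOf n (X p.1).2).eval (cay p.2) - (polyOf n (α p.1).2).eval (cay p.2) *
      (polyOf n (X p.1).1).eval (cay p.2))) continuousOn_spinTangent
    (c1.prodMk (c2.prodMk ((c1.mul c4).sub (c2.mul c3))))
    fun p hp => hreg p.1 hp.1 _ (norm_cay _)

theorem hasDerivAt_fst_of_contDiff {u : ℝ → ℝ → V3}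
    (hsmooth : ContDiff ℝ 2 fun p : ℝ × ℝ => u p.1 p.2) (t x : ℝ) :
    HasDerivAt (fun s => u s x) (fderiv ℝ (fun p : ℝ × ℝ => u p.1 p.2) (t, x) (1, 0)) t := by
  have h1 : HasFDerivAt (fun p : ℝ × ℝ => u p.1 p.2) _ ((fun s : ℝ => (s, x)) t) :=
    (hsmooth.differentiable (by norm_num) (t, x)).hasFDerivAt
  exact h1.comp_hasDerivAt t ((hasDerivAt_id t).prodMk (hasDerivAt_const t x))

/-- A solution that is rational and regular at some time remains so for a short time. -/
theorem exists_spinMap_of_solution {T : ℝ} {u : ℝ → ℝ → V3}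
    (hsmooth : ContDiff ℝ 2 fun p : ℝ × ℝ => u p.1 p.2)
    (hsphere : ∀ t x, dot3 (u t x) (u t x) = 1)
    (hsol : ∀ t ∈ Set.Ico 0 T, ∀ x,
      HasDerivAt (fun s => u s x) (cross3 (u t x) (halfLap (u t) x)) t)
    {t₀ : ℝ} (ht₀ : t₀ ∈ Set.Ico 0 T) {n : ℕ} {c₀ : Coeffs n × Coeffs n}
    (hc₀ : IsSpinRegular c₀) (h0 : u t₀ = spinMap c₀) :
    ∃ b > t₀, b ≤ T ∧ ∀ t ∈ Set.Ico t₀ b, ∃ c : Coeffs n × Coeffs n,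
      IsSpinRegular c ∧ u t = spinMap c := by
  obtain ⟨α, hα, δ, hδ, M, m, hm, hprop⟩ := exists_spinFlow hc₀ t₀
  have hbt : t₀ < min (t₀ + δ) T := lt_min (by linarith) ht₀.2
  have hbT : min (t₀ + δ) T ≤ T := min_le_right _ _
  have hI : ∀ t ∈ Set.Ioo (t₀ - δ) (min (t₀ + δ) T), t ∈ Set.Ioo (t₀ - δ) (t₀ + δ) := fun t ht =>
    ⟨ht.1, ht.2.trans_le (min_le_left _ _)⟩
  generalize min (t₀ + δ) T = b at hbt hbT hI
  have hreg : ∀ t ∈ Set.Ioo (t₀ - δ) b, IsSpinRegular (α t) := fun t ht ζ hζ =>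
    (hm.trans_le ((hprop _ (hI t ht)).2.2 ζ hζ)).ne'
  have hcd : Continuous fun p : ℝ × ℝ => fderiv ℝ (fun p : ℝ × ℝ => u p.1 p.2) p (1, 0) :=
    (hsmooth.continuous_fderiv (by norm_num)).clm_apply continuous_const
  have hαc : ContinuousOn α (Set.Ioo (t₀ - δ) b) := fun t ht =>
    (hprop t (hI t ht)).1.continuousAt.continuousWithinAt
  have hXc : ContinuousOn (fun t => spinField n (α t)) (Set.Ioo (t₀ - δ) b) := fun t ht =>
    ((contDiffAt_spinField (hreg t ht)).continuousAt.comp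
      (hprop t (hI t ht)).1.continuousAt).continuousWithinAt
  have hIco : ∀ t ∈ Set.Ico t₀ b, t ∈ Set.Ioo (t₀ - δ) b := fun t ht =>
    ⟨by linarith [ht.1], ht.2⟩
  obtain ⟨C, hC0, hC⟩ := exists_commForm_spinMap_le
    (c := fun t : Set.Ioo (t₀ - δ) b => α t) hm (fun t => (hprop _ (hI t t.2)).2.1)
    (fun t => (hprop _ (hI t t.2)).2.2)
  have h0' : u t₀ = spinMap (α t₀) := by rw [hα, h0]
  have cv : ContinuousOn (Function.uncurry fun t => spinMap (α t))
      (Set.Ioo (t₀ - δ) b ×ˢ Set.univ) := continuousOn_spinMap hαc hreg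
  have cdv : ContinuousOn (Function.uncurry fun t => spinVelocity (α t) (spinField n (α t)))
      (Set.Ioo (t₀ - δ) b ×ˢ Set.univ) :=
    continuousOn_spinVelocity (X := fun t => spinField n (α t)) hαc hXc hreg
  have cdu : ContinuousOn (Function.uncurry fun t x =>
      fderiv ℝ (fun p : ℝ × ℝ => u p.1 p.2) (t, x) (1, 0)) (Set.Ioo (t₀ - δ) b ×ˢ Set.univ) :=
    hcd.continuousOn
  have hv : ∀ t ∈ Set.Ioo (t₀ - δ) b, ∀ x, HasDerivAt (fun s => spinMap (α s) x)
      (spinVelocity (α t) (spinField n (α t)) x) t := fun t ht x =>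
    hasDerivAt_spinMap (hprop t (hI t ht)).1 (hreg t ht) x
  have hueq : ∀ t ∈ Set.Ico t₀ b, ∀ x, fderiv ℝ (fun p : ℝ × ℝ => u p.1 p.2) (t, x) (1, 0) =
      cross3 (u t x) (halfLap (u t) x) := fun t ht x =>
    (hasDerivAt_fst_of_contDiff hsmooth t x).unique
      (hsol t ⟨ht₀.1.trans ht.1, ht.2.trans_le hbT⟩ x)
  have hveq : ∀ t ∈ Set.Ico t₀ b, ∀ x, spinVelocity (α t) (spinField n (α t)) x =
      cross3 (spinMap (α t) x) (halfLap (spinMap (α t)) x) := fun t ht x =>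
    (cross3_halfLap_spinMap (hreg t (hIco t ht)) x).symm
  have hu2 : ∀ t ∈ Set.Ioo (t₀ - δ) b, ContDiff ℝ 2 (u t) := fun t _ =>
    hsmooth.comp (contDiff_prodMk_right t)
  have key := halfwave_unique (hIco t₀ ⟨le_rfl, hbt⟩)
    (u := u) (v := fun t => spinMap (α t))
    (du := fun t x => fderiv ℝ (fun p : ℝ × ℝ => u p.1 p.2) (t, x) (1, 0))
    (dv := fun t => spinVelocity (α t) (spinField n (α t)))
    (fun t _ x => hasDerivAt_fst_of_contDiff hsmooth t x) hv
    hsmooth.continuous.continuousOn cv cdu cdv hueq hveq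
    (fun t _ x => hsphere t x) (fun t ht x => dot3_spinVec (hreg t ht _ (norm_cay x)))
    hu2 (fun t ht => contDiff_spinMap (hreg t ht)) hC0
    (fun t ht R _ i ε hε f g hf hg => hC ⟨t, ht⟩ R i ε hε f g hf hg) h0'
  exact ⟨b, hbt, hbT, fun t ht => ⟨α t, hreg t (hIco t ht), key t ht⟩⟩

/-- `U` is represented by the spinor `(p, r)` of polynomials of degree at most `n` in the circle
coordinate, which may have common zeros. -/
def IsSpinRational (n : ℕ) (U : ℝ → V3) : Prop :=
  ∃ p r : Polynomial ℂ, p.natDegree ≤ n ∧ r.natDegree ≤ n ∧ (p ≠ 0 ∨ r ≠ 0) ∧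
    ∀ x, spinNorm (p.eval (cay x)) (r.eval (cay x)) • U x =
      hopf (p.eval (cay x)) (r.eval (cay x))

theorem spinNorm_mul (a f g : ℂ) : spinNorm (a * f) (a * g) = Complex.normSq a * spinNorm f g := by
  simp only [spinNorm, Complex.normSq_mul]
  ring

theorem hopf_mul (a f g : ℂ) : hopf (a * f) (a * g) = Complex.normSq a • hopf f g := by
  ext i
  fin_cases i <;> simp [hopf, Complex.normSq_apply] <;> ring

theorem continuous_spinNorm : Continuous fun p : ℂ × ℂ => spinNorm p.1 p.2 := by
  simp only [spinNorm, Complex.normSq_apply]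
  fun_prop

theorem continuous_hopf : Continuous fun p : ℂ × ℂ => hopf p.1 p.2 := by
  refine continuous_pi fun i => ?_
  fin_cases i <;> simp [hopf, Complex.normSq_apply] <;> fun_prop

theorem cay_injective : Function.Injective cay := fun x y h => by
  have h' := cay_sub_cay x y
  rw [h, sub_self, eq_comm, div_eq_zero_iff] at h'
  have h1 := ofReal_add_I_ne_zero x
  have h2 := ofReal_add_I_ne_zero y
  have : (x : ℂ) - y = 0 := by simpa [h1, h2, Complex.I_ne_zero] using h'
  exact Complex.ofReal_injective (sub_eq_zero.1 this)

theorem one_sub_cay (x : ℝ) : 1 - cay x = 2 * Complex.I / (x + Complex.I) := by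
  have h1 := ofReal_add_I_ne_zero x
  unfold cay
  field_simp
  ring

theorem exists_natDegree_le_eval_cay (A : Polynomial ℂ) {n : ℕ} (hA : A.natDegree ≤ n) :
    ∃ p : Polynomial ℂ, p.natDegree ≤ n ∧
      ∀ x : ℝ, p.eval (cay x) = (1 - cay x) ^ n * A.eval (x : ℂ) := by
  refine ⟨∑ k ∈ Finset.range (n + 1), Polynomial.C (A.coeff k) *
    ((Polynomial.C Complex.I * (1 + Polynomial.X)) ^ k * (1 - Polynomial.X) ^ (n - k)), ?_, ?_⟩
  · refine Polynomial.natDegree_sum_le_of_forall_le _ _ fun k hk => ?_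
    have hk' := Finset.mem_range_succ_iff.1 hk
    have h1 : (Polynomial.C Complex.I * (1 + Polynomial.X)).natDegree ≤ 1 := by compute_degree
    have h2 : (1 - Polynomial.X : Polynomial ℂ).natDegree ≤ 1 := by compute_degree
    refine (Polynomial.natDegree_C_mul_le _ _).trans (Polynomial.natDegree_mul_le.trans ?_)
    have h3 := Polynomial.natDegree_pow_le_of_le k h1
    have h4 := Polynomial.natDegree_pow_le_of_le (n - k) h2
    omega
  · intro x
    have hx : Complex.I * (1 + cay x) = (1 - cay x) * x := by
      have h1 := ofReal_add_I_ne_zero x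
      rw [one_sub_cay, cay]
      field_simp
      ring
    rw [Polynomial.eval_finsetSum, Polynomial.eval_eq_sum_range' (Nat.lt_succ_of_le hA),
      Finset.mul_sum]
    refine Finset.sum_congr rfl fun k hk => ?_
    have hk' := Finset.mem_range_succ_iff.1 hk
    simp only [Polynomial.eval_mul, Polynomial.eval_C, Polynomial.eval_pow, Polynomial.eval_add,
      Polynomial.eval_one, Polynomial.eval_X, Polynomial.eval_sub]
    rw [hx, mul_pow, ← Nat.sub_add_cancel hk', pow_add, Nat.add_sub_cancel]
    ring

theorem isSpinRational_of_isRationalFn {U : ℝ → V3} (hU : ∀ x, dot3 (U x) (U x) = 1)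
    (h : ∀ i, IsRationalFn fun x => U x i) : ∃ n, IsSpinRational n U := by
  by_cases hs : ∀ x, U x 2 = -1
  · refine ⟨0, 0, 1, by simp, by simp, by simp, fun x => ?_⟩
    have h0 := hU x
    rw [dot3, hs x] at h0
    have h1 : U x 0 = 0 := by nlinarith [mul_self_nonneg (U x 0), mul_self_nonneg (U x 1)]
    have h2 : U x 1 = 0 := by nlinarith [mul_self_nonneg (U x 0), mul_self_nonneg (U x 1)]
    ext i
    fin_cases i <;> simp [spinNorm, hopf, h1, h2, hs x]
  · push Not at hs
    obtain ⟨x₀, hx₀⟩ := hs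
    choose p q hq hpq using h
    have e : ∀ i x, (q i).eval x * U x i = (p i).eval x := fun i x => by
      rw [show U x i = _ from hpq i x, mul_div_cancel₀ _ (hq i x)]
    let ι : Polynomial ℝ → Polynomial ℂ := Polynomial.map Complex.ofRealHom
    have hι : ∀ (s : Polynomial ℝ) (x : ℝ), (ι s).eval (x : ℂ) = ((s.eval x : ℝ) : ℂ) :=
      fun s x => Polynomial.eval_map_apply Complex.ofRealHom x
    let A := ι (q 0 * q 1 * q 2 + q 0 * q 1 * p 2)
    let B := ι (p 0 * q 1 * q 2) + Polynomial.C Complex.I * ι (q 0 * p 1 * q 2)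
    obtain ⟨P, hP, hP'⟩ := exists_natDegree_le_eval_cay A (le_max_left A.natDegree B.natDegree)
    obtain ⟨R, hR, hR'⟩ := exists_natDegree_le_eval_cay B (le_max_right A.natDegree B.natDegree)
    have hA : ∀ x : ℝ, A.eval (x : ℂ) =
        (((q 0 * q 1 * q 2).eval x : ℝ) : ℂ) * (⟨1 + U x 2, 0⟩ : ℂ) := fun x => by
      simp only [A, hι, Polynomial.eval_add, Polynomial.eval_mul, ← e]
      apply Complex.ext <;> simp
      ring
    have hB : ∀ x : ℝ, B.eval (x : ℂ) =
        (((q 0 * q 1 * q 2).eval x : ℝ) : ℂ) * (⟨U x 0, U x 1⟩ : ℂ) := fun x => by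
      simp only [B, hι, Polynomial.eval_add, Polynomial.eval_mul, ← e, Polynomial.eval_C]
      apply Complex.ext <;> simp <;> ring
    refine ⟨_, P, R, hP, hR, Or.inl ?_, fun x => ?_⟩
    · rintro rfl
      have h0 := hP' x₀
      have h1 : (1 + U x₀ 2) ≠ 0 := fun h => hx₀ (by linarith)
      have h2 : (⟨1 + U x₀ 2, 0⟩ : ℂ) ≠ 0 := fun h => h1 (congrArg Complex.re h)
      have h3 : 1 - cay x₀ ≠ 0 := by
        rw [one_sub_cay]
        exact div_ne_zero (by simp) (ofReal_add_I_ne_zero x₀)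
      rw [hA] at h0
      simp [h2, h3, hq] at h0
    · rw [hP', hR', hA, hB, spinNorm_mul, hopf_mul, spinNorm_mul, hopf_mul, mul_smul, mul_smul]
      congr 2
      have h0 := hU x
      rw [dot3] at h0
      ext i
      fin_cases i <;> simp [spinNorm, hopf, Complex.normSq_apply]
      · linear_combination U x 0 * h0
      · linear_combination U x 1 * h0
      · linear_combination (U x 2 + 1) * h0

theorem exists_eq_X_sub_C_mul {n : ℕ} {p : Polynomial ℂ} {ζ : ℂ} (hp : p.natDegree ≤ n + 1)
    (h : p.eval ζ = 0) :
    ∃ p' : Polynomial ℂ, p = (Polynomial.X - Polynomial.C ζ) * p' ∧ p'.natDegree ≤ n := by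
  refine ⟨p /ₘ (Polynomial.X - Polynomial.C ζ),
    (Polynomial.mul_divByMonic_eq_iff_isRoot.2 h).symm, ?_⟩
  rw [Polynomial.natDegree_divByMonic _ (Polynomial.monic_X_sub_C ζ),
    Polynomial.natDegree_X_sub_C]
  omega

theorem IsSpinRational.exists_regular {U : ℝ → V3} (hU : Continuous U) {n : ℕ}
    (h : IsSpinRational n U) :
    ∃ m ≤ n, ∃ c : Coeffs m × Coeffs m, IsSpinRegular c ∧ U = spinMap c := by
  induction n with
  | zero =>
    obtain ⟨p, r, hp, hr, h0, h⟩ := h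
    have hp' := polyOf_coeff hp
    have hr' := polyOf_coeff hr
    have hc : IsSpinRegular ((fun k : Fin (0 + 1) => p.coeff k),
        fun k : Fin (0 + 1) => r.coeff k) := by
      intro ζ _
      rw [hp', hr']
      rw [Polynomial.eq_C_of_natDegree_le_zero hp, Polynomial.eq_C_of_natDegree_le_zero hr] at h0 ⊢
      refine spinNorm_ne_zero ?_
      simpa using h0
    refine ⟨0, le_rfl, _, hc, funext fun x => ?_⟩
    have := hc (cay x) (norm_cay x)
    rw [hp', hr'] at this
    rw [spinMap, spinVec, hp', hr', ← h x, inv_smul_smul₀ this]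
  | succ n ih =>
    obtain ⟨p, r, hp, hr, h0, h⟩ := h
    by_cases hz : ∃ ζ, p.eval ζ = 0 ∧ r.eval ζ = 0
    · obtain ⟨ζ, hpz, hrz⟩ := hz
      obtain ⟨p', rfl, hp'⟩ := exists_eq_X_sub_C_mul hp hpz
      obtain ⟨r', rfl, hr'⟩ := exists_eq_X_sub_C_mul hr hrz
      suffices h' : IsSpinRational n U by
        obtain ⟨m, hm, hc⟩ := ih h'
        exact ⟨m, hm.trans n.le_succ, hc⟩
      refine ⟨p', r', hp', hr', h0.imp right_ne_zero_of_mul right_ne_zero_of_mul, ?_⟩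
      have hfin : {x : ℝ | cay x = ζ}.Subsingleton := fun x hx y hy =>
        cay_injective (hx.trans hy.symm)
      have hdense : Dense {x : ℝ | cay x = ζ}ᶜ := (hfin.countable).dense_compl ℝ
      have hp1 : Continuous fun x => (p'.eval (cay x), r'.eval (cay x)) :=
        (p'.continuous.comp continuous_cay).prodMk (r'.continuous.comp continuous_cay)
      refine congrFun (Continuous.ext_on hdense ((continuous_spinNorm.comp hp1).smul hU)
        (continuous_hopf.comp hp1) fun x hx => ?_)
      have hx' : Complex.normSq (cay x - ζ) ≠ 0 := by
        rw [Ne, Complex.normSq_eq_zero, sub_eq_zero]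
        exact hx
      have := h x
      simp only [Polynomial.eval_mul, Polynomial.eval_sub, Polynomial.eval_X, Polynomial.eval_C,
        spinNorm_mul, hopf_mul, mul_smul] at this
      exact smul_right_injective _ hx' this
    · push Not at hz
      have hp' := polyOf_coeff hp
      have hr' := polyOf_coeff hr
      have hc : IsSpinRegular ((fun k : Fin (n + 1 + 1) => p.coeff k),
          fun k : Fin (n + 1 + 1) => r.coeff k) := by
        intro ζ _
        rw [hp', hr']
        exact spinNorm_ne_zero (or_iff_not_imp_left.2 fun h => hz ζ (not_not.1 h))
      refine ⟨n + 1, le_rfl, _, hc, funext fun x => ?_⟩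
      have := hc (cay x) (norm_cay x)
      rw [hp', hr'] at this
      rw [spinMap, spinVec, hp', hr', ← h x, inv_smul_smul₀ this]

theorem isSpinRational_spinMap {m n : ℕ} (hmn : m ≤ n) {c : Coeffs m × Coeffs m}
    (hc : IsSpinRegular c) : IsSpinRational n (spinMap c) := by
  refine ⟨polyOf m c.1, polyOf m c.2, (natDegree_polyOf_le _).trans hmn,
    (natDegree_polyOf_le _).trans hmn, ?_, fun x => smul_inv_smul₀ (hc _ (norm_cay x)) _⟩
  by_contra! h
  apply hc 1 norm_one
  simp [h.1, h.2, spinNorm]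

theorem isSpinRational_iff {n : ℕ} {U : ℝ → V3} : IsSpinRational n U ↔
    ∃ c : Metric.sphere (0 : Coeffs n × Coeffs n) 1, ∀ x,
      spinNorm ((polyOf n c.1.1).eval (cay x)) ((polyOf n c.1.2).eval (cay x)) • U x =
        hopf ((polyOf n c.1.1).eval (cay x)) ((polyOf n c.1.2).eval (cay x)) := by
  constructor
  · rintro ⟨p, r, hp, hr, h0, h⟩
    rw [← polyOf_coeff hp, ← polyOf_coeff hr] at h0 h
    generalize (fun k : Fin (n + 1) => p.coeff k) = a at *
    generalize (fun k : Fin (n + 1) => r.coeff k) = b at *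
    have hne : (a, b) ≠ 0 := by
      rintro h'
      obtain ⟨rfl, rfl⟩ := Prod.mk_eq_zero.1 h'
      simp at h0
    refine ⟨⟨((‖(a, b)‖ : ℂ))⁻¹ • (a, b), ?_⟩, fun x => ?_⟩
    · rw [mem_sphere_zero_iff_norm, norm_smul, norm_inv, Complex.norm_real, norm_norm,
        inv_mul_cancel₀ (norm_ne_zero_iff.2 hne)]
    · simp only [Prod.smul_fst, Prod.smul_snd, map_smul, Polynomial.eval_smul, smul_eq_mul,
        spinNorm_mul, hopf_mul, mul_smul, h]
  · rintro ⟨⟨c, hc⟩, h⟩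
    refine ⟨_, _, natDegree_polyOf_le c.1, natDegree_polyOf_le c.2, ?_, h⟩
    have inj : ∀ a : Coeffs n, polyOf n a = 0 → a = 0 := fun a ha => funext fun k => by
      have := congrArg (fun p => p.coeff (k : ℕ)) ha
      simpa [polyOf_apply, Polynomial.coeff_monomial, Fin.val_inj] using this
    by_contra! h0
    have : c = 0 := Prod.ext (inj _ h0.1) (inj _ h0.2)
    simp [this] at hc

theorem isClosed_isSpinRational {n : ℕ} {u : ℝ → ℝ → V3} (hu : ∀ x, Continuous fun t => u t x) :
    IsClosed {t | IsSpinRational n (u t)} := by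
  have hclosed : IsClosed {q : Metric.sphere (0 : Coeffs n × Coeffs n) 1 × ℝ | ∀ x,
      spinNorm ((polyOf n q.1.1.1).eval (cay x)) ((polyOf n q.1.1.2).eval (cay x)) • u q.2 x =
        hopf ((polyOf n q.1.1.1).eval (cay x)) ((polyOf n q.1.1.2).eval (cay x))} := by
    rw [Set.ofPred_forall]
    refine isClosed_iInter fun x => ?_
    have hc : Continuous fun q : Metric.sphere (0 : Coeffs n × Coeffs n) 1 × ℝ =>
        ((polyOf n q.1.1.1).eval (cay x), (polyOf n q.1.1.2).eval (cay x)) := by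
      simp only [eval_polyOf]
      fun_prop
    exact isClosed_eq ((continuous_spinNorm.comp hc).smul ((hu x).comp continuous_snd))
      (continuous_hopf.comp hc)
  convert isClosedMap_snd_of_compactSpace _ hclosed using 1
  ext t
  simp [isSpinRational_iff]

theorem isRationalFn_spinMap {n : ℕ} {c : Coeffs n × Coeffs n} (hc : IsSpinRegular c) (i : Fin 3) :
    IsRationalFn fun x => spinMap c x i := by
  have split : ∀ a : Coeffs n, ∃ P Q : Polynomial ℝ, ∀ x : ℝ, (polyOf n a).eval (cay x) =
      (((x : ℂ) + Complex.I) ^ n)⁻¹ * ⟨P.eval x, Q.eval x⟩ := fun a => by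
    let A : Polynomial ℂ := ∑ k : Fin (n + 1), Polynomial.C (a k) *
      ((Polynomial.X - Polynomial.C Complex.I) ^ (k : ℕ) *
        (Polynomial.X + Polynomial.C Complex.I) ^ (n - k))
    have hA : ∀ x : ℝ, (polyOf n a).eval (cay x) =
        (((x : ℂ) + Complex.I) ^ n)⁻¹ * A.eval (x : ℂ) := fun x => by
      have h1 := ofReal_add_I_ne_zero x
      simp only [A, eval_polyOf, Polynomial.eval_finsetSum, Polynomial.eval_mul,
        Polynomial.eval_C, Polynomial.eval_pow, Polynomial.eval_add, Polynomial.eval_sub,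
        Polynomial.eval_X, Finset.mul_sum]
      refine Finset.sum_congr rfl fun k _ => ?_
      have hk : ((x : ℂ) + Complex.I) ^ n =
          (x + Complex.I) ^ (k : ℕ) * (x + Complex.I) ^ (n - k) := by
        rw [← pow_add]
        congr 1
        omega
      rw [cay, div_pow, hk]
      field_simp
    have hB : ∀ B : Polynomial ℂ, ∃ P Q : Polynomial ℝ, ∀ x : ℝ,
        B.eval (x : ℂ) = ⟨P.eval x, Q.eval x⟩ := fun B => by
      induction B using Polynomial.induction_on' with
      | add p q hp hq =>
        obtain ⟨P, Q, h⟩ := hp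
        obtain ⟨P', Q', h'⟩ := hq
        refine ⟨P + P', Q + Q', fun x => ?_⟩
        rw [Polynomial.eval_add, h, h']
        apply Complex.ext <;> simp
      | monomial k z =>
        refine ⟨Polynomial.monomial k z.re, Polynomial.monomial k z.im, fun x => ?_⟩
        simp only [Polynomial.eval_monomial, ← Complex.ofReal_pow]
        apply Complex.ext
        · rw [Complex.re_mul_ofReal]
        · rw [Complex.im_mul_ofReal]
    obtain ⟨P, Q, h⟩ := hB A
    exact ⟨P, Q, fun x => by rw [hA, h]⟩
  obtain ⟨P, Q, h⟩ := split c.1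
  obtain ⟨P', Q', h'⟩ := split c.2
  have hne : ∀ x : ℝ, (P * P + Q * Q + (P' * P' + Q' * Q')).eval x ≠ 0 := fun x h0 => by
    apply hc (cay x) (norm_cay x)
    rw [h, h', spinNorm_mul, spinNorm, Complex.normSq_mk _ (Q.eval x),
      Complex.normSq_mk _ (Q'.eval x)]
    simp only [Polynomial.eval_add, Polynomial.eval_mul] at h0
    rw [h0, mul_zero]
  have hval : ∀ x, spinMap c x = ((P * P + Q * Q + (P' * P' + Q' * Q')).eval x)⁻¹ •
      hopf ⟨P.eval x, Q.eval x⟩ ⟨P'.eval x, Q'.eval x⟩ := fun x => by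
    have h1 : Complex.normSq (((x : ℂ) + Complex.I) ^ n)⁻¹ ≠ 0 := by
      rw [Ne, Complex.normSq_eq_zero]
      exact inv_ne_zero (pow_ne_zero _ (ofReal_add_I_ne_zero x))
    rw [spinMap, spinVec, h, h', spinNorm_mul, hopf_mul, smul_smul, mul_inv_rev,
      inv_mul_cancel_right₀ h1]
    simp [spinNorm, Complex.normSq_mk]
  refine ⟨![2 * (P * P' + Q * Q'), 2 * (P * Q' - Q * P'), P * P + Q * Q - (P' * P' + Q' * Q')] i,
    _, hne, fun x => ?_⟩
  simp only [hval x, Pi.smul_apply, smul_eq_mul]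
  rw [div_eq_inv_mul]
  congr 1
  fin_cases i <;> simp [hopf, Complex.normSq_mk]

theorem isSpinRational_of_solution {T : ℝ} {u : ℝ → ℝ → V3}
    (hsmooth : ContDiff ℝ 2 fun p : ℝ × ℝ => u p.1 p.2)
    (hsphere : ∀ t x, dot3 (u t x) (u t x) = 1)
    (hsol : ∀ t ∈ Set.Ico 0 T, ∀ x,
      HasDerivAt (fun s => u s x) (cross3 (u t x) (halfLap (u t) x)) t)
    {n : ℕ} (h0 : IsSpinRational n (u 0)) {t : ℝ} (ht : t ∈ Set.Ico 0 T) :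
    IsSpinRational n (u t) := by
  have hcx : ∀ t, Continuous (u t) := fun t =>
    hsmooth.continuous.comp (by fun_prop : Continuous fun x : ℝ => (t, x))
  have hct : ∀ x, Continuous fun t => u t x := fun x =>
    hsmooth.continuous.comp (by fun_prop : Continuous fun t : ℝ => (t, x))
  refine IsClosed.Icc_subset_of_forall_exists_gt (a := 0) (b := t)
    (s := {s | IsSpinRational n (u s)}) ((isClosed_isSpinRational hct).inter isClosed_Icc) h0
    ?_ ⟨ht.1, le_rfl⟩
  rintro t₀ ⟨hr, ht₀⟩ y hy
  obtain ⟨m, hmn, c, hc, hu⟩ := IsSpinRational.exists_regular (hcx t₀) hr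
  obtain ⟨b, hb, -, h⟩ := exists_spinMap_of_solution hsmooth hsphere hsol
    ⟨ht₀.1, ht₀.2.trans ht.2⟩ hc hu
  obtain ⟨z, hz, hzb⟩ := exists_between (lt_min hb hy)
  obtain ⟨c', hc', hz'⟩ := h z ⟨hz.le, hzb.trans_le (min_le_left _ _)⟩
  refine ⟨z, ?_, hz, (hzb.trans_le (min_le_right _ _)).le⟩
  rw [Set.mem_ofPred_eq, hz']
  exact isSpinRational_spinMap hmn hc'

theorem halfwave_rational_solutions_invariant
    (T : ℝ) (hT : 0 < T)
    (u G : ℝ → ℝ → V3)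
    (hsmooth : ContDiff ℝ (⊤ : ℕ∞) (fun p : ℝ × ℝ => u p.1 p.2))
    (hsphere : ∀ t x : ℝ, ∑ i, (u t x i) ^ 2 = 1)
    (hG : ∀ t : ℝ, HasHalfLap (u t) (G t))
    (hsol : ∀ t ∈ Set.Ico (0 : ℝ) T, ∀ x : ℝ,
      HasDerivAt (fun s => u s x) (cross3 (u t x) (G t x)) t)
    (hrat0 : ∀ i : Fin 3, IsRationalFn (fun x => u 0 x i)) :
    ∀ t ∈ Set.Ico (0 : ℝ) T, ∀ i : Fin 3, IsRationalFn (fun x => u t x i) := by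
  have hsph : ∀ t x, dot3 (u t x) (u t x) = 1 := fun t x => by
    have := hsphere t x
    simp only [Fin.sum_univ_three, pow_two] at this
    exact this
  have h2 : ContDiff ℝ 2 fun p : ℝ × ℝ => u p.1 p.2 := hsmooth.of_le (WithTop.coe_le_coe.2 le_top)
  have hG' : ∀ t x, G t x = halfLap (u t) x := fun t x =>
    (hG t).eq_halfLap (h2.comp (contDiff_prodMk_right t))
      (fun y => norm_le_of_abs_le (abs_le_one_of_dot3 (hsph t y))) x
  obtain ⟨n, hn⟩ := isSpinRational_of_isRationalFn (hsph 0) hrat0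
  intro t ht i
  obtain ⟨m, -, c, hc, hu⟩ := IsSpinRational.exists_regular (U := u t)
    (h2.comp (contDiff_prodMk_right t)).continuous
    (isSpinRational_of_solution h2 hsph (fun t ht x => hG' t x ▸ hsol t ht x) hn ht)
  rw [hu]
  exact isRationalFn_spinMap hc i
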